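/- arXiv:2301.02042 — 5 statements merged into one kernel-verified Lean document; each statement's English description precedes it below -/
import Mathlib

section
/- For all reals p ∈ (0,1), ε ∈ (0,1/10), τ ∈ (0, p(1−p)) there exists a positive real c, depending only on p, ε, τ, such that for all positive integers n, d with pn an integer and τ ≤ d/n ≤ (1−ε)p(1−p), there exists an (n, M, d; pn) optical orthogonal code with M ≥ c·n·C(n,pn) / Vol(n, d−1; pn). -/
open Finset

/-- The `i`-th cyclic shift of `x`: coordinate `j` of `cshift i x` is `x_{j+i}`
(indices mod `n`). -/
def cshift {q n : ℕ} (i : ℕ) (x : Fin n → Fin q) : Fin n → Fin q :=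
  fun j => x ⟨(j.1 + i) % n, Nat.mod_lt _ j.pos⟩
/-- `Vol(n,t;w) = ∑_{i=0}^{⌊t/2⌋} C(w,i)·C(n-w,i)`. -/
def volCW (n t w : ℕ) : ℕ := ∑ i ∈ Finset.range (t / 2 + 1), w.choose i * (n - w).choose i
/-- A hopping cyclic code: all cyclic shifts of every codeword belong to the code,
and the `n` cyclic shifts of every codeword are pairwise distinct. -/
def IsHCC {q n : ℕ} (C : Finset (Fin n → Fin q)) : Prop :=
  ∀ x ∈ C, (∀ i : ℕ, cshift i x ∈ C) ∧ Function.Injective fun i : Fin n => cshift i.1 x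


section Graph
open Classical in
/-- independent subsets of `F`. -/
noncomputable def indSets {V : Type*} (G : SimpleGraph V) (F : Finset V) : Finset (Finset V) :=
  F.powerset.filter fun K => ∀ u ∈ K, ∀ v ∈ K, ¬ G.Adj u v

theorem mem_indSets {V : Type*} (G : SimpleGraph V) (F K : Finset V) :
    K ∈ indSets G F ↔ K ⊆ F ∧ ∀ u ∈ K, ∀ v ∈ K, ¬ G.Adj u v := by
  simp [indSets]

theorem indSets_Z_le {V : Type*} (G : SimpleGraph V) (F : Finset V) (l : ℝ) (hl : 0 ≤ l) :
    ∑ K ∈ indSets G F, l ^ #K ≤ (1 + l) ^ #F := by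
  classical
  calc ∑ K ∈ indSets G F, l ^ #K ≤ ∑ K ∈ F.powerset, l ^ #K :=
        sum_le_sum_of_subset_of_nonneg (filter_subset _ _) (fun _ _ _ => by positivity)
    _ = (1 + l) ^ #F := by
        have := Finset.sum_pow_mul_eq_add_pow l (1:ℝ) F
        simp only [one_pow, mul_one] at this
        rw [this, add_comm]

theorem one_le_indSets_Z {V : Type*} (G : SimpleGraph V) (F : Finset V) (l : ℝ) (hl : 0 ≤ l) :
    1 ≤ ∑ K ∈ indSets G F, l ^ #K := by
  have : (∅ : Finset V) ∈ indSets G F := by simp [mem_indSets]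
  calc (1:ℝ) = l ^ #(∅ : Finset V) := by simp
    _ ≤ _ := single_le_sum (f := fun K : Finset V => l ^ #K) (fun _ _ => by positivity) this

open Classical in
theorem indSets_S_le {V : Type*} (G : SimpleGraph V) (F : Finset V) (l : ℝ) (hl : 0 ≤ l) (u : V) :
    ∑ K ∈ (indSets G F).filter (fun K => u ∈ K), l ^ #K ≤ l * ∑ K ∈ indSets G F, l ^ #K := by
  rw [mul_sum]
  have : ∀ K ∈ (indSets G F).filter (fun K => u ∈ K), l ^ #K = l * l ^ #(K.erase u) := by
    intro K hK
    rw [mem_filter] at hK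
    rw [← pow_succ', card_erase_add_one hK.2]
  rw [sum_congr rfl this]
  have hinj : Set.InjOn (fun K : Finset V => K.erase u) ((indSets G F).filter (fun K => u ∈ K)) := by
    intro K hK K' hK' h
    simp only [coe_filter, Set.mem_ofPred_eq] at hK hK'
    simp only at h
    rw [← insert_erase hK.2, ← insert_erase hK'.2, h]
  rw [← sum_image (f := fun K : Finset V => l * l ^ #K) hinj]
  apply sum_le_sum_of_subset_of_nonneg
  · intro K hK
    simp only [mem_image, mem_filter, mem_indSets] at hK ⊢
    obtain ⟨K', ⟨⟨h1, h2⟩, h3⟩, rfl⟩ := hK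
    exact ⟨(erase_subset _ _).trans h1, fun a ha b hb => h2 a (mem_of_mem_erase ha) b (mem_of_mem_erase hb)⟩
  · intros; positivity

open Classical in
theorem indSets_S_ge {V : Type*} (G : SimpleGraph V) (F : Finset V) (l : ℝ) (hl : 0 ≤ l) (u : V) (hu : u ∈ F) :
    l * (∑ K ∈ indSets G F, l ^ #K) * (1 - l * (#(F.filter (fun x => G.Adj u x)) + 1)) ≤
    ∑ K ∈ (indSets G F).filter (fun K => u ∈ K), l ^ #K := by
  set Z := ∑ K ∈ indSets G F, l ^ #K with hZ
  set N := insert u (F.filter (fun x => G.Adj u x)) with hN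
  have h1 : Z ≤ ∑ K ∈ (indSets G F).filter (fun K => Disjoint K N), l ^ #K
      + ∑ x ∈ N, ∑ K ∈ (indSets G F).filter (fun K => x ∈ K), l ^ #K := by
    rw [hZ, ← sum_filter_add_sum_filter_not (indSets G F) (fun K => Disjoint K N)]
    gcongr
    simp_rw [sum_filter]
    rw [sum_comm]
    apply sum_le_sum
    intro K _
    split_ifs with h
    · exact sum_nonneg (fun _ _ => by split_ifs <;> positivity)
    · rw [not_disjoint_iff] at h
      obtain ⟨x, hx, hx'⟩ := h
      calc l ^ #K = (if x ∈ K then l ^ #K else 0) := by rw [if_pos hx]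
        _ ≤ _ := single_le_sum (f := fun x => if x ∈ K then l ^ #K else 0)
          (fun _ _ => by split_ifs <;> positivity) hx'
  have h2 : ∑ x ∈ N, ∑ K ∈ (indSets G F).filter (fun K => x ∈ K), l ^ #K ≤ (#(F.filter (fun x => G.Adj u x)) + 1) * (l * Z) := by
    calc _ ≤ ∑ x ∈ N, l * Z := sum_le_sum fun x _ => indSets_S_le G F l hl x
      _ = (#N : ℝ) * (l * Z) := by simp
      _ = _ := by
        rw [hN, card_insert_of_notMem (by simp)]; push_cast; ring
  have h3 : l * ∑ K ∈ (indSets G F).filter (fun K => Disjoint K N), l ^ #K ≤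
      ∑ K ∈ (indSets G F).filter (fun K => u ∈ K), l ^ #K := by
    rw [mul_sum]
    have : ∀ K ∈ (indSets G F).filter (fun K => Disjoint K N), l * l ^ #K = l ^ #(insert u K) := by
      intro K hK
      rw [mem_filter] at hK
      have : u ∉ K := fun h => (disjoint_left.1 hK.2 h) (by simp [hN])
      rw [card_insert_of_notMem this, pow_succ']
    rw [sum_congr rfl this]
    have hinj : Set.InjOn (fun K : Finset V => insert u K) ((indSets G F).filter (fun K => Disjoint K N)) := by
      intro K hK K' hK' h
      simp only [coe_filter, Set.mem_ofPred_eq] at hK hK'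
      simp only at h
      have a1 : u ∉ K := fun h => (disjoint_left.1 hK.2 h) (by simp [hN])
      have a2 : u ∉ K' := fun h => (disjoint_left.1 hK'.2 h) (by simp [hN])
      rw [← erase_insert a1, ← erase_insert a2, h]
    rw [← sum_image (f := fun K : Finset V => l ^ #K) hinj]
    apply sum_le_sum_of_subset_of_nonneg
    · intro K hK
      simp only [mem_image, mem_filter, mem_indSets] at hK ⊢
      obtain ⟨K', ⟨⟨h1, h2⟩, h3⟩, rfl⟩ := hK
      have h4 : ∀ x ∈ K', ¬ G.Adj u x := fun x hx hux =>
        disjoint_left.1 h3 hx (by simp [hN, hux, h1 hx])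
      refine ⟨⟨insert_subset hu h1, ?_⟩, mem_insert_self _ _⟩
      intro a ha b hb
      rw [mem_insert] at ha hb
      rcases ha with rfl | ha <;> rcases hb with rfl | hb
      · simp
      · exact h4 b hb
      · exact fun h => h4 a ha h.symm
      · exact h2 a ha b hb
    · intros; positivity
  nlinarith [mul_le_mul_of_nonneg_left h1 hl, mul_le_mul_of_nonneg_left h2 hl]

open Classical in
theorem indSets_card_sum {V : Type*} (G : SimpleGraph V) (F : Finset V) (l : ℝ) (hl : 0 ≤ l) (hl2 : l ≤ 1 / 2)
    (hE : (∑ u ∈ F, #(F.filter (fun x => G.Adj u x)) : ℕ) * l ^ 2 ≤ (1:ℝ)) :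
    (∑ K ∈ indSets G F, l ^ #K) * (l * #F / 2 - 1) ≤ ∑ K ∈ indSets G F, #K * l ^ #K := by
  set Z := ∑ K ∈ indSets G F, l ^ #K with hZ
  have hZ1 : 1 ≤ Z := one_le_indSets_Z G F l hl
  have h1 : ∑ K ∈ indSets G F, #K * l ^ #K = ∑ u ∈ F, ∑ K ∈ (indSets G F).filter (fun K => u ∈ K), l ^ #K := by
    simp_rw [sum_filter]
    rw [sum_comm]
    apply sum_congr rfl
    intro K hK
    rw [mem_indSets] at hK
    rw [← sum_filter, sum_const, nsmul_eq_mul]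
    congr 2
    rw [filter_mem_eq_inter, inter_eq_right.2 hK.1]
  rw [h1]
  have h2 := sum_le_sum (fun u (hu : u ∈ F) => indSets_S_ge G F l hl u hu)
  refine le_trans ?_ h2
  rw [← mul_sum, ← hZ, sum_sub_distrib, ← mul_sum, sum_add_distrib]
  simp only [sum_const, nsmul_eq_mul, mul_one]
  push_cast at hE
  set E : ℝ := ∑ u ∈ F, (#(F.filter (fun x => G.Adj u x)) : ℝ)
  have : l * #F / 2 - 1 ≤ l * (#F - l * (E + #F)) := by
    have : (0:ℝ) ≤ #F := by positivity
    nlinarith [mul_nonneg hl this]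
  calc _ ≤ Z * (l * (#F - l * (E + #F))) := by gcongr
    _ = _ := by ring

open Classical in
theorem local_occ {V : Type*} (G : SimpleGraph V) (F : Finset V) (l Δ L : ℝ) (hl : 0 ≤ l) (hl2 : l ≤ 1 / 2)
    (hE : (∑ u ∈ F, #(F.filter (fun x => G.Adj u x)) : ℕ) * l ^ 2 ≤ (1:ℝ)) (hL : 0 ≤ L)
    (hΔ : L * (1 + Real.exp (4 * L + 2)) ≤ Δ * l) :
    0 ≤ l * (Δ - L) + ∑ K ∈ indSets G F, l ^ #K * (#K - L) := by
  have h1 := indSets_card_sum G F l hl hl2 hE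
  have h2 := indSets_Z_le G F l hl
  have h3 := one_le_indSets_Z G F l hl
  simp_rw [mul_sub, sum_sub_distrib, ← sum_mul]
  set Z := ∑ K ∈ indSets G F, l ^ #K with hZ
  have h4 : ∑ K ∈ indSets G F, l ^ #K * (#K:ℝ) = ∑ K ∈ indSets G F, #K * l ^ #K := by simp_rw [mul_comm]
  rw [h4]
  have h5 : 0 ≤ ∑ K ∈ indSets G F, #K * l ^ #K := sum_nonneg fun _ _ => by positivity
  have hD : 0 ≤ Δ * l := le_trans (by positivity) hΔ
  by_cases hc : 4 * L + 2 ≤ l * #F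
  · have : Z * (2 * L) ≤ Z * (l * #F / 2 - 1) := by gcongr; linarith
    nlinarith
  · push Not at hc
    have h6 : Z ≤ Real.exp (4 * L + 2) := by
      refine h2.trans ?_
      calc (1 + l) ^ #F ≤ (Real.exp l) ^ #F := by gcongr; linarith [Real.add_one_le_exp l]
        _ = Real.exp (l * #F) := by rw [← Real.exp_nat_mul]; ring_nf
        _ ≤ _ := Real.exp_le_exp.2 hc.le
    nlinarith

open Classical in
theorem graph_occ {V : Type*} [Fintype V] (G : SimpleGraph V) (l Δ L : ℝ) (hl : 0 ≤ l) (hl2 : l ≤ 1 / 2)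
    (hE : ∀ v, (∑ u ∈ univ.filter (G.Adj v), #((univ.filter (G.Adj v)).filter (fun x => G.Adj u x)) : ℕ) * l ^ 2 ≤ (1:ℝ)) (hL : 0 ≤ L)
    (hΔ : L * (1 + Real.exp (4 * L + 2)) ≤ Δ * l) (v : V) :
    0 ≤ ∑ I ∈ indSets G univ, l ^ #I * ((if v ∈ I then Δ else 0) + #(I.filter (G.Adj v)) - L) := by
  set N := insert v (univ.filter (G.Adj v)) with hN
  rw [← sum_fiberwise_of_maps_to (g := fun I => I \ N) (t := (indSets G univ).image (fun I => I \ N))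
    (fun I hI => mem_image_of_mem _ hI)]
  apply sum_nonneg
  intro J hJ
  rw [mem_image] at hJ
  obtain ⟨I0, hI0, hJ⟩ := hJ
  have hJN : Disjoint J N := by rw [← hJ]; exact sdiff_disjoint
  have hJi : ∀ a ∈ J, ∀ b ∈ J, ¬ G.Adj a b := by
    intro a ha b hb
    rw [mem_indSets] at hI0
    rw [← hJ] at ha hb
    exact hI0.2 a (mem_sdiff.1 ha).1 b (mem_sdiff.1 hb).1
  have hvJ : v ∉ J := fun h => disjoint_left.1 hJN h (by simp [hN])
  have hNJ : ∀ a ∈ J, ¬ G.Adj v a := fun a h h' => disjoint_left.1 hJN h (by simp [hN, h'])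
  set F := (univ.filter (G.Adj v)).filter (fun x => ∀ a ∈ J, ¬ G.Adj x a) with hF
  have hFv : ∀ x ∈ F, G.Adj v x := by intro x hx; simp [hF] at hx; exact hx.1
  have hFJ : ∀ x ∈ F, ∀ a ∈ J, ¬ G.Adj x a := by intro x hx; simp [hF] at hx; exact hx.2
  have hdis : ∀ K ∈ indSets G F, Disjoint J K := by
    intro K hK
    rw [mem_indSets] at hK
    rw [disjoint_left]
    intro a ha haK
    exact hNJ a ha (hFv a (hK.1 haK))
  have hset : (indSets G univ).filter (fun I => I \ N = J) =
      insert (insert v J) ((indSets G F).image (fun K => J ∪ K)) := by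
    ext I
    simp only [mem_filter, mem_indSets, mem_insert, mem_image, subset_univ, true_and]
    constructor
    · rintro ⟨h1, h2⟩
      by_cases hv : v ∈ I
      · left
        rw [← h2]
        ext a
        simp only [mem_insert, mem_sdiff, hN, mem_filter, mem_univ, true_and, not_or]
        constructor
        · intro ha
          by_cases hav : a = v
          · exact Or.inl hav
          · exact Or.inr ⟨ha, hav, h1 v hv a ha⟩
        · rintro (rfl | h)
          · exact hv
          · exact h.1
      · right
        refine ⟨I ∩ N, ⟨?_, fun a ha b hb => h1 a (mem_inter.1 ha).1 b (mem_inter.1 hb).1⟩, ?_⟩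
        · intro a ha
          rw [mem_inter] at ha
          have hav : a ≠ v := fun h => hv (h ▸ ha.1)
          simp only [hF, mem_filter, mem_univ, true_and]
          refine ⟨?_, fun b hb => h1 a ha.1 b ?_⟩
          · have := ha.2
            simp [hN, hav] at this
            exact this
          · rw [← h2] at hb; exact (mem_sdiff.1 hb).1
        · rw [← h2]; exact sdiff_union_inter I N
    · rintro (rfl | ⟨K, ⟨hK1, hK2⟩, rfl⟩)
      · refine ⟨?_, ?_⟩
        · intro a ha b hb
          rw [mem_insert] at ha hb
          rcases ha with rfl | ha <;> rcases hb with rfl | hb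
          · simp
          · exact hNJ b hb
          · exact fun h => hNJ a ha h.symm
          · exact hJi a ha b hb
        · rw [insert_sdiff_of_mem _ (by simp [hN])]
          exact sdiff_eq_self_of_disjoint hJN
      · refine ⟨?_, ?_⟩
        · intro a ha b hb
          rw [mem_union] at ha hb
          rcases ha with ha | ha <;> rcases hb with hb | hb
          · exact hJi a ha b hb
          · exact fun h => hFJ b (hK1 hb) a ha h.symm
          · exact hFJ a (hK1 ha) b hb
          · exact hK2 a ha b hb
        · rw [union_sdiff_distrib, sdiff_eq_self_of_disjoint hJN]
          rw [sdiff_eq_empty_iff_subset.2, union_empty]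
          intro a ha
          simp [hN, hFv a (hK1 ha)]
  rw [hset, sum_insert, sum_image]
  · have e1 : #((insert v J).filter (G.Adj v)) = 0 := by
      rw [card_eq_zero, filter_eq_empty_iff]
      intro a ha
      rw [mem_insert] at ha
      rcases ha with rfl | ha
      · simp
      · exact hNJ a ha
    have e2 : ∀ K ∈ indSets G F, l ^ #(J ∪ K) * ((if v ∈ J ∪ K then Δ else 0) + #((J ∪ K).filter (G.Adj v)) - L)
        = l ^ #J * (l ^ #K * (#K - L)) := by
      intro K hK
      rw [card_union_of_disjoint (hdis K hK), pow_add]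
      rw [mem_indSets] at hK
      have h1 : v ∉ J ∪ K := by
        rw [mem_union, not_or]
        exact ⟨hvJ, fun h => G.loopless.irrefl v (hFv v (hK.1 h))⟩
      have h2 : (J ∪ K).filter (G.Adj v) = K := by
        rw [filter_union, filter_eq_empty_iff.2 (fun a ha => hNJ a ha), empty_union, filter_eq_self]
        exact fun a ha => hFv a (hK.1 ha)
      rw [if_neg h1, h2]; ring
    rw [sum_congr rfl e2, ← mul_sum, e1, card_insert_of_notMem hvJ]
    have := local_occ G F l Δ L hl hl2 ?_ hL hΔ
    · simp only [mem_insert_self, if_true]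
      have : 0 ≤ l ^ #J * (l * (Δ - L) + ∑ K ∈ indSets G F, l ^ #K * (#K - L)) := by positivity
      rw [mul_add] at this
      refine this.trans_eq ?_
      rw [pow_succ]; push_cast; ring
    · refine le_trans ?_ (hE v)
      gcongr ?_ * _
      rw [Nat.cast_le]
      calc _ ≤ ∑ u ∈ F, #((univ.filter (G.Adj v)).filter (fun x => G.Adj u x)) := by
            apply sum_le_sum; intro u _; apply card_le_card
            apply filter_subset_filter; exact filter_subset _ _
        _ ≤ _ := sum_le_sum_of_subset (filter_subset _ _)
  · intro K hK K' hK' h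
    have a1 := hdis K hK
    have a2 := hdis K' hK'
    simp only at h
    rw [← union_sdiff_cancel_left a1, h, union_sdiff_cancel_left a2]
  · intro h
    rw [mem_image] at h
    obtain ⟨K, hK, h⟩ := h
    have : v ∈ J ∪ K := by rw [h]; simp
    rw [mem_union] at this
    rw [mem_indSets] at hK
    rcases this with h | h
    · exact hvJ h
    · exact G.loopless.irrefl v (hFv v (hK.1 h))

open Classical in
theorem graph_indep {V : Type*} [Fintype V] (G : SimpleGraph V) (l Δ L : ℝ) (hl : 0 < l) (hl2 : l ≤ 1 / 2)
    (hdeg : ∀ v, (#(univ.filter (G.Adj v)) : ℝ) ≤ Δ)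
    (hE : ∀ v, (∑ u ∈ univ.filter (G.Adj v), #((univ.filter (G.Adj v)).filter (fun x => G.Adj u x)) : ℕ) * l ^ 2 ≤ (1:ℝ)) (hL : 0 ≤ L)
    (hΔ : L * (1 + Real.exp (4 * L + 2)) ≤ Δ * l) :
    ∃ I : Finset V, (∀ u ∈ I, ∀ v ∈ I, ¬ G.Adj u v) ∧ L * Fintype.card V ≤ 2 * Δ * #I := by
  have h1 : 0 ≤ ∑ v, ∑ I ∈ indSets G univ, l ^ #I * ((if v ∈ I then Δ else 0) + #(I.filter (G.Adj v)) - L) :=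
    sum_nonneg fun v _ => graph_occ G l Δ L hl.le hl2 hE hL hΔ v
  rw [sum_comm] at h1
  have hne : (indSets G univ).Nonempty := ⟨∅, by simp [mem_indSets]⟩
  obtain ⟨I, hI, hI2⟩ := exists_le_of_sum_le hne (f := fun _ => (0:ℝ)) (by simpa using h1)
  rw [mem_indSets] at hI
  refine ⟨I, hI.2, ?_⟩
  rw [← mul_sum] at hI2
  have h2 := nonneg_of_mul_nonneg_right hI2 (by positivity)
  rw [sum_sub_distrib, sum_add_distrib] at h2
  have h3 : ∑ v, (if v ∈ I then Δ else 0) = Δ * #I := by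
    rw [← sum_filter]; simp [mul_comm]
  have h4 : ∑ v, (#(I.filter (G.Adj v)) : ℝ) ≤ Δ * #I := by
    have : ∑ v, (#(I.filter (G.Adj v)) : ℝ) = ∑ u ∈ I, (#(univ.filter (G.Adj u)) : ℝ) := by
      simp only [card_eq_sum_ones, sum_filter]
      push_cast
      rw [sum_comm]
      simp_rw [G.adj_comm]
    rw [this]
    calc _ ≤ ∑ u ∈ I, Δ := sum_le_sum fun u _ => hdeg u
      _ = _ := by simp [mul_comm]
  rw [h3] at h2
  simp at h2
  nlinarith
end Graph


section Mode
theorem mode_nat (n k : ℕ) (hk : k ≤ n) :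
    n ^ n ≤ (n + 1) * (n.choose k * k ^ k * (n - k) ^ (n - k)) := by
  set T : ℕ → ℕ := fun j => n.choose j * k ^ j * (n - k) ^ (n - j) with hT
  obtain ⟨m, rfl⟩ := Nat.exists_eq_add_of_le hk
  have hsum : (k + m) ^ (k + m) = ∑ j ∈ range (k + m + 1), T j := by
    rw [add_pow]
    apply sum_congr rfl
    intro j _
    simp only [hT, Nat.add_sub_cancel_left]
    push_cast
    ring
  have hstep : ∀ j < k + m, T j * ((j + 1) * m) = k ^ j * m ^ (k + m - j - 1) * (k+m).choose j * (m * ((j+1) * m))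
      ∧ T (j+1) * ((j + 1) * m) = k ^ j * m ^ (k + m - j - 1) * (k+m).choose j * (m * ((k + m - j) * k)) := by
    intro j hj
    simp only [hT, Nat.add_sub_cancel_left]
    have h := Nat.choose_succ_right_eq (k+m) j
    obtain ⟨e, he⟩ := Nat.exists_eq_add_of_lt hj
    have e1 : k + m - j = e + 1 := by omega
    have e2 : k + m - j - 1 = e := by omega
    have e3 : k + m - (j+1) = e := by omega
    rw [e1] at h
    rw [e2, e1, e3]
    constructor
    · ring
    · calc _ = ((k+m).choose (j+1) * (j+1)) * (k ^ (j+1) * m ^ e * m) := by ring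
        _ = _ := by rw [h]; ring
  have hup : ∀ j < k, T j ≤ T (j+1) := by
    intro j hj
    rcases Nat.eq_zero_or_pos m with rfl | hm
    · simp only [hT]
      have : k + 0 - k = 0 := by omega
      rw [this, zero_pow (by omega)]; simp
    obtain ⟨h1, h2⟩ := hstep j (by omega)
    have : 0 < (j + 1) * m := by positivity
    refine Nat.le_of_mul_le_mul_right (c := (j+1) * m) ?_ this
    rw [h1, h2]
    refine Nat.mul_le_mul_left _ (Nat.mul_le_mul_left _ ?_)
    obtain ⟨e, rfl⟩ := Nat.exists_eq_add_of_lt hj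
    have : j + e + 1 + m - j = e + 1 + m := by omega
    rw [this]
    nlinarith
  have hdown : ∀ j, k ≤ j → j < k + m → T (j+1) ≤ T j := by
    intro j hj hj2
    rcases Nat.eq_zero_or_pos m with rfl | hm
    · omega
    obtain ⟨h1, h2⟩ := hstep j (by omega)
    have : 0 < (j + 1) * m := by positivity
    refine Nat.le_of_mul_le_mul_right (c := (j+1) * m) ?_ this
    rw [h1, h2]
    refine Nat.mul_le_mul_left _ (Nat.mul_le_mul_left _ ?_)
    have a1 : k + m - j ≤ m := by omega
    calc (k + m - j) * k ≤ m * (j+1) := by gcongr; omega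
      _ = _ := by ring
  have hle1 : ∀ i, i ≤ k → T (k - i) ≤ T k := by
    intro i hi
    induction i with
    | zero => simp
    | succ i ih =>
      refine le_trans ?_ (ih (by omega))
      have : k - i = (k - (i+1)) + 1 := by omega
      rw [this]; exact hup _ (by omega)
  have hle2 : ∀ i, i ≤ m → T (k + i) ≤ T k := by
    intro i hi
    induction i with
    | zero => simp
    | succ i ih =>
      refine le_trans ?_ (ih (by omega))
      exact hdown (k+i) (by omega) (by omega)
  rw [hsum]
  calc ∑ j ∈ range (k + m + 1), T j ≤ ∑ j ∈ range (k + m + 1), T k := by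
        apply sum_le_sum
        intro j hj
        rw [mem_range] at hj
        rcases le_total j k with h | h
        · have := hle1 (k - j) (by omega)
          rwa [show k - (k - j) = j by omega] at this
        · have := hle2 (j - k) (by omega)
          rwa [show k + (j - k) = j by omega] at this
    _ = _ := by simp [hT]

theorem mode_real (n k : ℕ) (hk : k ≤ n) (hn : 0 < n) (a : ℝ) (ha : a * n = k) :
    1 ≤ ((n:ℝ) + 1) * (n.choose k * (a ^ k * (1 - a) ^ (n - k))) := by
  have h := mode_nat n k hk
  have hn' : (0:ℝ) < n := by exact_mod_cast hn
  have h' : ((n:ℝ)) ^ n ≤ (n + 1) * (n.choose k * k ^ k * (n - k : ℕ) ^ (n - k)) := by exact_mod_cast h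
  rw [Nat.cast_sub hk, ← ha] at h'
  have e : (n:ℝ) - a * n = (1 - a) * n := by ring
  rw [e, mul_pow, mul_pow] at h'
  have e2 : (n:ℝ) ^ k * n ^ (n - k) = n ^ n := by rw [← pow_add]; congr 1; omega
  have h2 : (n:ℝ) ^ n * 1 ≤ n ^ n * ((n + 1) * (n.choose k * (a ^ k * (1 - a) ^ (n - k)))) := by
    rw [mul_one]
    refine h'.trans_eq ?_
    rw [← e2]; ring
  exact le_of_mul_le_mul_left h2 (by positivity)
end Mode


section Balls
variable {n : ℕ}

def cnt (x u : Fin n → Fin 2) (s t : Fin 2) : ℕ := #{j | x j = s ∧ u j = t}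

theorem prod_cnt (f : Fin 2 → Fin 2 → ℝ) (x u : Fin n → Fin 2) :
    ∏ j, f (x j) (u j) = f 0 0 ^ cnt x u 0 0 * f 0 1 ^ cnt x u 0 1 * f 1 0 ^ cnt x u 1 0
      * f 1 1 ^ cnt x u 1 1 := by
  rw [← Finset.prod_fiberwise (s := univ) (g := fun j => ((x j, u j) : Fin 2 × Fin 2))]
  have : ∀ st : Fin 2 × Fin 2, ∏ i with ((x i, u i) : Fin 2 × Fin 2) = st, f (x i) (u i)
      = f st.1 st.2 ^ cnt x u st.1 st.2 := by
    rintro ⟨s, t⟩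
    rw [prod_congr rfl (g := fun _ => f s t)]
    · simp [cnt, Prod.ext_iff]
    · intro i hi
      simp at hi
      rw [hi.1, hi.2]
  simp only [this, Fintype.prod_prod_type, Fin.prod_univ_two]
  ring

theorem cnt_facts (x u : Fin n → Fin 2) :
    cnt x u 1 0 + cnt x u 1 1 = hammingNorm x ∧ cnt x u 0 1 + cnt x u 1 1 = hammingNorm u ∧
    cnt x u 1 0 + cnt x u 0 1 = hammingDist x u ∧
    cnt x u 0 0 + cnt x u 0 1 + cnt x u 1 0 + cnt x u 1 1 = n := by
  have e : ∀ s t, cnt x u s t = ∑ j, if x j = s ∧ u j = t then 1 else 0 := by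
    intro s t; rw [cnt, card_filter]
  have a : hammingNorm x = ∑ j, if x j ≠ 0 then 1 else 0 := by rw [hammingNorm, card_filter]
  have b : hammingNorm u = ∑ j, if u j ≠ 0 then 1 else 0 := by rw [hammingNorm, card_filter]
  have c : hammingDist x u = ∑ j, if x j ≠ u j then 1 else 0 := by rw [hammingDist, card_filter]
  have d : n = ∑ j : Fin n, 1 := by simp
  have key : ∀ s t : Fin 2, ((if s = 1 ∧ t = 0 then 1 else 0) + (if s = 1 ∧ t = 1 then 1 else 0) = if s ≠ 0 then 1 else 0)
     ∧ ((if s = 0 ∧ t = 1 then 1 else 0) + (if s = 1 ∧ t = 1 then 1 else 0) = if t ≠ 0 then 1 else 0)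
     ∧ ((if s = 1 ∧ t = 0 then 1 else 0) + (if s = 0 ∧ t = 1 then 1 else 0) = if s ≠ t then 1 else 0)
     ∧ ((if s = 0 ∧ t = 0 then 1 else 0) + (if s = 0 ∧ t = 1 then 1 else 0) + (if s = 1 ∧ t = 0 then 1 else 0) + (if s = 1 ∧ t = 1 then 1 else 0) = 1) := by
    decide
  refine ⟨?_, ?_, ?_, ?_⟩
  · rw [a, e, e, ← sum_add_distrib]
    exact sum_congr rfl fun j _ => (key (x j) (u j)).1
  · rw [b, e, e, ← sum_add_distrib]
    exact sum_congr rfl fun j _ => (key (x j) (u j)).2.1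
  · rw [c, e, e, ← sum_add_distrib]
    exact sum_congr rfl fun j _ => (key (x j) (u j)).2.2.1
  · conv_rhs => rw [d]
    rw [e, e, e, e, ← sum_add_distrib, ← sum_add_distrib, ← sum_add_distrib]
    exact sum_congr rfl fun j _ => (key (x j) (u j)).2.2.2

def cwBall (x : Fin n → Fin 2) (w t : ℕ) : Finset (Fin n → Fin 2) :=
  {u | hammingNorm u = w ∧ hammingDist x u ≤ t}

theorem cwBall_card (x : Fin n → Fin 2) (w t : ℕ) (hx : hammingNorm x = w) :
    #(cwBall x w t) ≤ volCW n t w := by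
  classical
  set S : Finset (Fin n) := {j | x j ≠ 0}
  have hS : #S = w := hx
  have hSc : #Sᶜ = n - w := by rw [card_compl, hS]; simp
  let F : (Fin n → Fin 2) → (Σ _ : ℕ, Finset (Fin n) × Finset (Fin n)) := fun u =>
    ⟨cnt x u 1 0, (univ.filter fun j => x j = 1 ∧ u j = 0, univ.filter fun j => x j = 0 ∧ u j = 1)⟩
  have : #(cwBall x w t) ≤ #((range (t/2+1)).sigma fun i => powersetCard i S ×ˢ powersetCard i Sᶜ) := by
    apply card_le_card_of_injOn F
    · intro u hu
      simp only [cwBall, coe_filter, mem_univ, true_and, Set.mem_ofPred_eq] at hu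
      obtain ⟨h1, h2, h3, h4⟩ := cnt_facts x u
      simp only [F, coe_sigma, Set.mem_sigma_iff, mem_coe, mem_range, mem_product, mem_powersetCard]
      refine ⟨by omega, ⟨?_, rfl⟩, ⟨?_, ?_⟩⟩
      · intro j hj; simp at hj; simp [S, hj.1]
      · intro j hj; simp at hj; simp [S, hj.1]
      · change cnt x u 0 1 = _; omega
    · intro u _ v _ huv
      simp only [F, Sigma.mk.injEq] at huv
      obtain ⟨_, h⟩ := huv
      have h := eq_of_heq h
      simp only [Prod.mk.injEq] at h
      ext j : 1
      have h1 : (x j = 1 ∧ u j = 0) ↔ (x j = 1 ∧ v j = 0) := by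
        simpa using congrArg (j ∈ ·) h.1
      have h2 : (x j = 0 ∧ u j = 1) ↔ (x j = 0 ∧ v j = 1) := by
        simpa using congrArg (j ∈ ·) h.2
      generalize x j = s at h1 h2
      generalize u j = a at h1 h2 ⊢
      generalize v j = b at h1 h2 ⊢
      revert s a b; decide
  refine this.trans_eq ?_
  rw [card_sigma, volCW]
  simp [hS, hSc]

/-- channel transition probability -/
def qch (a b : ℝ) (s t : Fin 2) : ℝ :=
  if s = 0 then (if t = 0 then 1 - b else b) else (if t = 0 then a else 1 - a)

theorem qch_nonneg {a b : ℝ} (ha : 0 ≤ a) (hb : 0 ≤ b) (hab : a + b ≤ 1/2) (s t) : 0 ≤ qch a b s t := by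
  unfold qch; split_ifs <;> linarith

theorem sum_prod_words (g : Fin n → Fin 2 → ℝ) :
    ∑ u : Fin n → Fin 2, ∏ j, g j (u j) = ∏ j, (g j 0 + g j 1) := by
  have := Finset.prod_univ_sum (fun _ : Fin n => (univ : Finset (Fin 2))) g
  rw [Fintype.piFinset_univ] at this
  rw [← this]; simp

structure BallHyp (n w δ : ℕ) (a b : ℝ) : Prop where
  hw : 0 < w
  hwn : w < n
  ha : a * w = δ
  hb : b * (n - w : ℕ) = δ
  hab : a + b ≤ 1/2

def Pst (n w δ : ℕ) (a b : ℝ) : ℝ := (a^δ*(1-a)^(w-δ)) * (b^δ * (1-b)^(n-w-δ))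

variable {w δ : ℕ} {a b : ℝ}

theorem BallHyp.a0 (h : BallHyp n w δ a b) : 0 ≤ a := by
  have := h.hw
  have h1 := h.ha
  by_contra hh
  push Not at hh
  have : a * w < 0 := mul_neg_of_neg_of_pos hh (by exact_mod_cast this)
  have : (0:ℝ) ≤ δ := by positivity
  linarith

theorem BallHyp.b0 (h : BallHyp n w δ a b) : 0 ≤ b := by
  have : 0 < n - w := by have := h.hwn; omega
  have h1 := h.hb
  by_contra hh
  push Not at hh
  have : b * (n - w : ℕ) < 0 := mul_neg_of_neg_of_pos hh (by exact_mod_cast this)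
  have : (0:ℝ) ≤ δ := by positivity
  linarith

theorem BallHyp.dw (h : BallHyp n w δ a b) : δ ≤ w := by
  have h1 := h.ha
  have h2 := h.a0; have h3 := h.b0; have h4 := h.hab
  have : (δ:ℝ) ≤ w := by
    rw [← h1]
    have : (0:ℝ) ≤ w := by positivity
    nlinarith
  exact_mod_cast this

theorem BallHyp.dnw (h : BallHyp n w δ a b) : δ ≤ n - w := by
  have h1 := h.hb
  have h2 := h.a0; have h3 := h.b0; have h4 := h.hab
  have : (δ:ℝ) ≤ (n - w : ℕ) := by
    rw [← h1]
    have : (0:ℝ) ≤ (n - w : ℕ) := by positivity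
    nlinarith
  exact_mod_cast this

theorem Pst_nonneg (h : BallHyp n w δ a b) : 0 ≤ Pst n w δ a b := by
  have h2 := h.a0; have h3 := h.b0; have h4 := h.hab
  have : 0 ≤ 1 - a := by linarith
  have : 0 ≤ 1 - b := by linarith
  unfold Pst; positivity

theorem Pst_vol (h : BallHyp n w δ a b) (t : ℕ) (ht : t / 2 = δ) :
    1 ≤ ((n:ℝ)+1)^2 * volCW n t w * Pst n w δ a b := by
  have h2 := h.a0; have h3 := h.b0; have h4 := h.hab
  have h5 : 0 ≤ 1 - a := by linarith
  have h6 : 0 ≤ 1 - b := by linarith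
  have hwn := h.hwn
  have m1 := mode_real w δ h.dw h.hw a h.ha
  have m2 := mode_real (n-w) δ h.dnw (by omega) b h.hb
  have hv : w.choose δ * (n-w).choose δ ≤ volCW n t w := by
    unfold volCW
    exact single_le_sum (f := fun i => w.choose i * (n-w).choose i) (fun _ _ => Nat.zero_le _) (by simp [ht])
  have hv' : (w.choose δ : ℝ) * (n-w).choose δ ≤ volCW n t w := by exact_mod_cast hv
  have c1 : (w:ℝ) + 1 ≤ n + 1 := by have : (w:ℝ) ≤ n := by exact_mod_cast hwn.le
                                    linarith
  have c2 : ((n - w : ℕ):ℝ) + 1 ≤ n + 1 := by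
    have : ((n-w:ℕ):ℝ) ≤ n := by exact_mod_cast Nat.sub_le _ _
    linarith
  calc (1:ℝ) ≤ (((w:ℝ) + 1) * (w.choose δ * (a ^ δ * (1 - a) ^ (w - δ)))) * ((((n - w : ℕ):ℝ) + 1) * ((n-w).choose δ * (b ^ δ * (1 - b) ^ (n - w - δ)))) := one_le_mul_of_one_le_of_one_le m1 m2
    _ = (((w:ℝ) + 1) * (((n - w : ℕ):ℝ) + 1)) * (w.choose δ * (n-w).choose δ) * Pst n w δ a b := by unfold Pst; ring
    _ ≤ (((n:ℝ) + 1) * ((n:ℝ) + 1)) * volCW n t w * Pst n w δ a b := by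
        have := Pst_nonneg h
        gcongr
    _ = _ := by ring

theorem P_lower (h : BallHyp n w δ a b) (x u : Fin n → Fin 2) (hx : hammingNorm x = w)
    (hu : hammingNorm u = w) (i0 : ℕ) (hi0 : i0 ≤ δ) (hd : hammingDist x u ≤ 2 * i0 + 1) :
    Pst n w δ a b * 9 ^ (δ - i0) ≤ ∏ j, qch a b (x j) (u j) := by
  have h2 := h.a0; have h3 := h.b0; have h4 := h.hab
  have h5 : 0 ≤ 1 - a := by linarith
  have h6 : 0 ≤ 1 - b := by linarith
  have hdw := h.dw; have hdnw := h.dnw; have hwn := h.hwn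
  rw [prod_cnt]
  obtain ⟨f1, f2, f3, f4⟩ := cnt_facts x u
  obtain ⟨i, hi⟩ : ∃ i, i = cnt x u 1 0 := ⟨_, rfl⟩
  have g1 : cnt x u 0 1 = i := by omega
  have g2 : cnt x u 1 1 = (w - δ) + (δ - i) := by omega
  have g3 : cnt x u 0 0 = (n - w - δ) + (δ - i) := by omega
  rw [g1, g2, g3, ← hi]
  have hie : i ≤ i0 := by omega
  obtain ⟨e, he⟩ := Nat.exists_eq_add_of_le (hie.trans hi0)
  have hab : 9 * (a * b) ≤ (1-a)*(1-b) := by nlinarith [sq_nonneg (a-b)]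
  have hP : Pst n w δ a b = (a^i * b^i * ((1-a)^(w-δ) * (1-b)^(n-w-δ))) * (a*b)^(δ-i) := by
    unfold Pst
    have : δ - i = e := by omega
    rw [this]
    nth_rewrite 1 [he]; nth_rewrite 2 [he]
    rw [pow_add, pow_add, mul_pow]; ring
  rw [hP]
  have hq : qch a b 0 0 = 1 - b ∧ qch a b 0 1 = b ∧ qch a b 1 0 = a ∧ qch a b 1 1 = 1 - a := by simp [qch]
  rw [hq.1, hq.2.1, hq.2.2.1, hq.2.2.2]
  calc _ ≤ (a^i * b^i * ((1-a)^(w-δ) * (1-b)^(n-w-δ))) * (a*b)^(δ-i) * 9 ^ (δ - i) := by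
        gcongr
        norm_num
    _ = (a^i * b^i * ((1-a)^(w-δ) * (1-b)^(n-w-δ))) * (9*(a*b))^(δ-i) := by rw [mul_pow]; ring
    _ ≤ (a^i * b^i * ((1-a)^(w-δ) * (1-b)^(n-w-δ))) * ((1-a)*(1-b))^(δ-i) := by gcongr
    _ = _ := by rw [mul_pow, pow_add, pow_add]; ring

theorem card_mul_le_sum {α : Type*} [Fintype α] (S : Finset α) (c : ℝ) (f : α → ℝ) (hf : ∀ u, 0 ≤ f u)
    (h : ∀ u ∈ S, c ≤ f u) : (#S : ℝ) * c ≤ ∑ u, f u := by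
  rw [← nsmul_eq_mul, ← sum_const]
  exact (sum_le_sum h).trans (sum_le_sum_of_subset_of_nonneg (subset_univ _) fun u _ _ => hf u)

theorem near_bound (h : BallHyp n w δ a b) (t : ℕ) (ht : t / 2 = δ) (x : Fin n → Fin 2)
    (hx : hammingNorm x = w) (i0 : ℕ) (hi0 : i0 ≤ δ) :
    (#(cwBall x w (2*i0+1)) : ℝ) * 9 ^ (δ - i0) ≤ ((n:ℝ)+1)^2 * volCW n t w := by
  have hs : ∑ u : Fin n → Fin 2, ∏ j, qch a b (x j) (u j) = 1 := by
    rw [sum_prod_words]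
    apply prod_eq_one
    intro j _
    unfold qch; split_ifs <;> simp_all
  have hle : (#(cwBall x w (2*i0+1)) : ℝ) * (Pst n w δ a b * 9 ^ (δ - i0)) ≤ 1 := by
    rw [← hs]
    refine card_mul_le_sum _ _ _ (fun u => prod_nonneg fun j _ => qch_nonneg h.a0 h.b0 h.hab _ _) fun u hu => ?_
    simp only [cwBall, mem_filter, mem_univ, true_and] at hu
    exact P_lower h x u hx hu.1 i0 hi0 hu.2
  have h1 := Pst_vol h t ht
  have h0 := Pst_nonneg h
  have hN0 : (0:ℝ) ≤ #(cwBall x w (2*i0+1)) := Nat.cast_nonneg _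
  generalize (#(cwBall x w (2*i0+1)) : ℝ) = N at *
  generalize Pst n w δ a b = P at *
  have hW0 : (0:ℝ) ≤ ((n:ℝ)+1)^2 * volCW n t w := by positivity
  generalize ((n:ℝ)+1)^2 * volCW n t w = W at *
  calc N * 9 ^ (δ - i0) = N * 9 ^ (δ - i0) * 1 := (mul_one _).symm
    _ ≤ N * 9 ^ (δ - i0) * (W * P) := by gcongr
    _ = N * (P * 9 ^ (δ - i0)) * W := by ring
    _ ≤ 1 * W := by gcongr
    _ = _ := one_mul _

theorem far_bound (h : BallHyp n w δ a b) (t : ℕ) (ht : t / 2 = δ) (x y : Fin n → Fin 2)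
    (hx : hammingNorm x = w) (hy : hammingNorm y = w) (k : ℕ) (hk : 2 * k ≤ hammingDist x y) :
    (#(cwBall x w t ∩ cwBall y w t) : ℝ) ≤ ((n:ℝ)+1)^2 * volCW n t w * (3/4)^k := by
  have h2 := h.a0; have h3 := h.b0; have h4 := h.hab
  have h5 : 0 ≤ 1 - a := by linarith
  have h6 : 0 ≤ 1 - b := by linarith
  set r : ℝ := √((1-b)*a) + √(b*(1-a)) with hr
  have hr0 : 0 ≤ r := by positivity
  have hr2 : r^2 ≤ 3/4 := by
    set m := √((1-a)*(1-b)) with hm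
    set l := √(a*b) with hl
    have hm2 : m^2 = (1-a)*(1-b) := Real.sq_sqrt (by positivity)
    have hl2 : l^2 = a*b := Real.sq_sqrt (by positivity)
    have hm0 : 0 ≤ m := Real.sqrt_nonneg _
    have hl0 : 0 ≤ l := Real.sqrt_nonneg _
    have hl4 : l ≤ 1/4 := by
      refine Real.sqrt_le_iff.2 ⟨by norm_num, ?_⟩
      nlinarith [sq_nonneg (a-b)]
    have hml : 1/2 + l ≤ m := by
      refine Real.le_sqrt_of_sq_le ?_
      nlinarith
    have hc : √((1-b)*a) * √(b*(1-a)) = m * l := by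
      rw [← Real.sqrt_mul (by positivity), hm, hl, ← Real.sqrt_mul (by positivity)]
      congr 1; ring
    have : r^2 = 1 - (m-l)^2 := by
      rw [hr, add_sq, Real.sq_sqrt (by positivity), Real.sq_sqrt (by positivity), mul_assoc, hc]
      have : (m-l)^2 = m^2 - 2*(m*l) + l^2 := by ring
      rw [this, hm2, hl2]; ring
    rw [this]; nlinarith
  have hr1 : r ≤ 1 := by nlinarith
  have hs : ∑ u : Fin n → Fin 2, ∏ j, (√(qch a b (x j) (u j)) * √(qch a b (y j) (u j))) = r ^ hammingDist x y := by
    rw [sum_prod_words (fun j t => √(qch a b (x j) t) * √(qch a b (y j) t))]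
    rw [hammingDist, ← prod_const, prod_filter]
    apply prod_congr rfl
    intro j _
    have key : ∀ s t : Fin 2, √(qch a b s 0) * √(qch a b t 0) + √(qch a b s 1) * √(qch a b t 1) = if s ≠ t then r else 1 := by
      intro s t
      fin_cases s <;> fin_cases t <;> simp [qch]
      · rw [Real.mul_self_sqrt h6, Real.mul_self_sqrt h3]; ring
      · rw [hr, Real.sqrt_mul h6, Real.sqrt_mul h3]
      · rw [hr, Real.sqrt_mul h6, Real.sqrt_mul h3]; ring
      · rw [Real.mul_self_sqrt h5, Real.mul_self_sqrt h2]; ring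
    exact key _ _
  have h0 := Pst_nonneg h
  have hle : (#(cwBall x w t ∩ cwBall y w t) : ℝ) * Pst n w δ a b ≤ (3/4)^k := by
    calc (#(cwBall x w t ∩ cwBall y w t) : ℝ) * Pst n w δ a b ≤ r ^ hammingDist x y := by
          rw [← hs]
          refine card_mul_le_sum _ _ _ (fun u => prod_nonneg fun j _ => mul_nonneg (Real.sqrt_nonneg _) (Real.sqrt_nonneg _)) fun u hu => ?_
          · simp only [cwBall, mem_inter, mem_filter, mem_univ, true_and] at hu
            have e1 := P_lower h x u hx hu.1.1 δ le_rfl (by omega)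
            have e2 := P_lower h y u hy hu.1.1 δ le_rfl (by omega)
            simp only [Nat.sub_self, pow_zero, mul_one] at e1 e2
            rw [prod_mul_distrib, ← Real.sqrt_prod _ (fun j _ => qch_nonneg h2 h3 h4 _ _), ← Real.sqrt_prod _ (fun j _ => qch_nonneg h2 h3 h4 _ _)]
            calc Pst n w δ a b = √(Pst n w δ a b) * √(Pst n w δ a b) := (Real.mul_self_sqrt h0).symm
              _ ≤ _ := mul_le_mul (Real.sqrt_le_sqrt e1) (Real.sqrt_le_sqrt e2) (Real.sqrt_nonneg _) (Real.sqrt_nonneg _)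
      _ ≤ r ^ (2*k) := pow_le_pow_of_le_one hr0 hr1 hk
      _ = (r^2)^k := pow_mul _ _ _
      _ ≤ _ := by gcongr
  have h1 := Pst_vol h t ht
  have hN0 : (0:ℝ) ≤ #(cwBall x w t ∩ cwBall y w t) := Nat.cast_nonneg _
  generalize (#(cwBall x w t ∩ cwBall y w t) : ℝ) = N at *
  generalize Pst n w δ a b = P at *
  have hW0 : (0:ℝ) ≤ ((n:ℝ)+1)^2 * volCW n t w := by positivity
  generalize ((n:ℝ)+1)^2 * volCW n t w = W at *
  calc N = N * 1 := (mul_one _).symm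
    _ ≤ N * (W * P) := by gcongr
    _ = (N * P) * W := by ring
    _ ≤ (3/4)^k * W := by gcongr
    _ = _ := by ring

theorem pairs_bound (h : BallHyp n w δ a b) (t : ℕ) (ht : t / 2 = δ) (x y : Fin n → Fin 2)
    (hx : hammingNorm x = w) (hy : hammingNorm y = w) :
    ((∑ u ∈ cwBall x w t, #(cwBall y w t ∩ cwBall u w t) : ℕ) : ℝ)
      ≤ 2 * ((n:ℝ)+1)^2 * (volCW n t w)^2 * (3/4)^(δ/2) := by
  set V : ℝ := (volCW n t w : ℝ) with hV
  have hV0 : 0 ≤ V := by positivity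
  set i0 := δ / 2 with hi0
  have hsplit : (∑ u ∈ cwBall x w t, #(cwBall y w t ∩ cwBall u w t) : ℕ)
      ≤ (∑ u ∈ cwBall y w (2*i0+1), volCW n t w) + ∑ u ∈ (cwBall x w t).filter (fun u => ¬ hammingDist y u ≤ 2*i0+1), #(cwBall y w t ∩ cwBall u w t) := by
    rw [← sum_filter_add_sum_filter_not (cwBall x w t) (fun u => hammingDist y u ≤ 2*i0+1)]
    gcongr ?_ + _
    refine (sum_le_sum (g := fun _ => volCW n t w) fun u hu => ?_).trans (sum_le_sum_of_subset_of_nonneg ?_ fun _ _ _ => Nat.zero_le _)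
    · exact (card_le_card inter_subset_left).trans (cwBall_card y w t hy)
    · intro u hu
      simp only [cwBall, mem_filter, mem_univ, true_and] at hu ⊢
      exact ⟨hu.1.1, hu.2⟩
  have e1 : ((∑ u ∈ cwBall y w (2*i0+1), volCW n t w : ℕ) : ℝ) ≤ ((n:ℝ)+1)^2 * V^2 * (3/4)^i0 := by
    have := near_bound h t ht y hy i0 (Nat.div_le_self _ _)
    have h9 : (4/3:ℝ)^i0 ≤ 9^(δ - i0) := by
      calc (4/3:ℝ)^i0 ≤ 9^i0 := by gcongr; norm_num
        _ ≤ _ := pow_le_pow_right₀ (by norm_num) (by omega)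
    have h43 : (4/3:ℝ)^i0 * (3/4)^i0 = 1 := by rw [← mul_pow]; norm_num
    rw [sum_const, smul_eq_mul]
    push_cast
    rw [← hV] at this ⊢
    calc (#(cwBall y w (2*i0+1)):ℝ) * V = (#(cwBall y w (2*i0+1)):ℝ) * (4/3:ℝ)^i0 * (V * (3/4)^i0) := by
          rw [show (#(cwBall y w (2*i0+1)):ℝ) * (4/3:ℝ)^i0 * (V * (3/4)^i0) = (#(cwBall y w (2*i0+1)):ℝ) * V * ((4/3:ℝ)^i0 * (3/4)^i0) by ring, h43, mul_one]
      _ ≤ (#(cwBall y w (2*i0+1)):ℝ) * 9^(δ - i0) * (V * (3/4)^i0) := by gcongr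
      _ ≤ (((n:ℝ)+1)^2 * V) * (V * (3/4)^i0) := by gcongr
      _ = _ := by ring
  have e2 : ((∑ u ∈ (cwBall x w t).filter (fun u => ¬ hammingDist y u ≤ 2*i0+1), #(cwBall y w t ∩ cwBall u w t) : ℕ) : ℝ) ≤ ((n:ℝ)+1)^2 * V^2 * (3/4)^i0 := by
    push_cast
    calc _ ≤ ∑ u ∈ (cwBall x w t).filter (fun u => ¬ hammingDist y u ≤ 2*i0+1), ((n:ℝ)+1)^2 * V * (3/4)^i0 := by
          apply sum_le_sum
          intro u hu
          simp only [cwBall, mem_filter, mem_univ, true_and] at hu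
          exact far_bound h t ht y u hy hu.1.1 i0 (by omega)
      _ = (#((cwBall x w t).filter (fun u => ¬ hammingDist y u ≤ 2*i0+1)) : ℝ) * (((n:ℝ)+1)^2 * V * (3/4)^i0) := by rw [sum_const, nsmul_eq_mul]
      _ ≤ V * (((n:ℝ)+1)^2 * V * (3/4)^i0) := by
          gcongr
          rw [hV, Nat.cast_le]
          exact (card_le_card (filter_subset _ _)).trans (cwBall_card x w t hx)
      _ = _ := by ring
  have : ((∑ u ∈ cwBall x w t, #(cwBall y w t ∩ cwBall u w t) : ℕ) : ℝ) ≤ _ := Nat.cast_le.2 hsplit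
  rw [Nat.cast_add] at this
  calc _ ≤ _ := this
    _ ≤ ((n:ℝ)+1)^2 * V^2 * (3/4)^i0 + ((n:ℝ)+1)^2 * V^2 * (3/4)^i0 := add_le_add e1 e2
    _ = _ := by ring

end Balls


section Union

def bw (p : ℝ) (s : Fin 2) : ℝ := if s = 0 then 1 - p else p

section Gen
variable {ι : Type*} [Fintype ι] [DecidableEq ι]

def Wt (p : ℝ) (x : ι → Fin 2) : ℝ := ∏ j, bw p (x j)

def EE (p : ℝ) (f : (ι → Fin 2) → ℝ) : ℝ := ∑ x, Wt p x * f x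

theorem Wt_update (p : ℝ) (x : ι → Fin 2) (j : ι) (b : Fin 2) :
    Wt p (Function.update x j b) * bw p (x j) = Wt p x * bw p b := by
  unfold Wt
  rw [← mul_prod_erase univ (fun i => bw p (Function.update x j b i)) (mem_univ j),
    ← mul_prod_erase univ (fun i => bw p (x i)) (mem_univ j)]
  have : ∏ i ∈ univ.erase j, bw p (Function.update x j b i) = ∏ i ∈ univ.erase j, bw p (x i) := by
    apply prod_congr rfl
    intro i hi
    rw [Function.update_of_ne (ne_of_mem_erase hi)]
  rw [this]
  simp
  ring

theorem bw_sum (p : ℝ) : ∑ b, bw p b = 1 := by simp [bw]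

theorem EE_update (p : ℝ) (f : (ι → Fin 2) → ℝ) (j : ι) :
    EE p f = EE p (fun x => ∑ b, bw p b * f (Function.update x j b)) := by
  unfold EE
  have h1 : ∑ x, Wt p x * f x = ∑ z : (ι → Fin 2) × Fin 2, Wt p z.1 * bw p z.2 * f z.1 := by
    rw [Fintype.sum_prod_type]
    apply sum_congr rfl
    intro x _
    simp only
    rw [← sum_mul, ← mul_sum, bw_sum, mul_one]
  have h2 : ∑ x, Wt p x * ∑ b, bw p b * f (Function.update x j b)
      = ∑ z : (ι → Fin 2) × Fin 2, Wt p z.1 * bw p z.2 * f (Function.update z.1 j z.2) := by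
    rw [Fintype.sum_prod_type]
    apply sum_congr rfl
    intro x _
    rw [mul_sum]
    exact sum_congr rfl fun _ _ => by ring
  rw [h1, h2]
  have hinv : Function.Involutive (fun z : (ι → Fin 2) × Fin 2 => (Function.update z.1 j z.2, z.1 j)) := by
    rintro ⟨x, b⟩
    simp
  refine Fintype.sum_equiv hinv.toPerm _ _ ?_
  rintro ⟨x, b⟩
  simp only [Function.Involutive.coe_toPerm, Function.update_idem, Function.update_eq_self]
  rw [Wt_update]

theorem EE_const (p : ℝ) (c : ℝ) : EE p (fun _ : ι → Fin 2 => c) = c := by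
  unfold EE
  rw [← sum_mul]
  have := Finset.prod_univ_sum (fun _ : ι => (univ : Finset (Fin 2))) (fun _ => bw p)
  rw [Fintype.piFinset_univ] at this
  simp only [bw_sum, prod_const_one] at this
  simp only [Wt]
  rw [← this, one_mul]

theorem EE_mul (p c : ℝ) (f : (ι → Fin 2) → ℝ) : EE p (fun x => c * f x) = c * EE p f := by
  unfold EE
  rw [mul_sum]
  exact sum_congr rfl fun _ _ => by ring

theorem EE_add (p : ℝ) (f g : (ι → Fin 2) → ℝ) : EE p (fun x => f x + g x) = EE p f + EE p g := by
  unfold EE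
  rw [← sum_add_distrib]
  exact sum_congr rfl fun _ _ => by ring

theorem bw_nonneg {p : ℝ} (h0 : 0 ≤ p) (h1 : p ≤ 1) (b) : 0 ≤ bw p b := by
  unfold bw; split_ifs <;> linarith

theorem Wt_nonneg {p : ℝ} (h0 : 0 ≤ p) (h1 : p ≤ 1) (x : ι → Fin 2) : 0 ≤ Wt p x :=
  prod_nonneg fun _ _ => bw_nonneg h0 h1 _

theorem EE_mono {p : ℝ} (h0 : 0 ≤ p) (h1 : p ≤ 1) (f g : (ι → Fin 2) → ℝ) (h : ∀ x, f x ≤ g x) :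
    EE p f ≤ EE p g :=
  sum_le_sum fun x _ => mul_le_mul_of_nonneg_left (h x) (Wt_nonneg h0 h1 x)

theorem EE_indep (p : ℝ) (g : Fin 2 → Fin 2 → ℝ) (σ : ι → ι) (hσ : Function.Injective σ) (J : Finset ι)
    (hJ : ∀ j ∈ J, ∀ k ∈ J, j ≠ σ k) :
    EE p (fun x => ∏ j ∈ J, g (x j) (x (σ j))) = (∑ s, ∑ t, bw p s * bw p t * g s t) ^ #J := by
  induction J using Finset.induction_on with
  | empty => simp [EE_const]
  | insert j0 J hj0 ih =>
    have ih := ih fun j hj k hk => hJ j (mem_insert_of_mem hj) k (mem_insert_of_mem hk)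
    rw [EE_update p _ j0, EE_update p _ (σ j0)]
    have : (fun x : ι → Fin 2 => ∑ b, bw p b * ∑ b1, bw p b1 * ∏ j ∈ insert j0 J,
          g ((Function.update (Function.update x (σ j0) b) j0 b1) j)
            ((Function.update (Function.update x (σ j0) b) j0 b1) (σ j)))
        = fun x => (∑ s, ∑ t, bw p s * bw p t * g s t) * ∏ j ∈ J, g (x j) (x (σ j)) := by
      ext x
      have hne : σ j0 ≠ j0 := (hJ j0 (mem_insert_self _ _) j0 (mem_insert_self _ _)).symm
      have : ∀ b b1, ∏ j ∈ insert j0 J,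
          g ((Function.update (Function.update x (σ j0) b) j0 b1) j)
            ((Function.update (Function.update x (σ j0) b) j0 b1) (σ j))
          = g b1 b * ∏ j ∈ J, g (x j) (x (σ j)) := by
        intro b b1
        rw [prod_insert hj0]
        congr 1
        · rw [Function.update_self, Function.update_of_ne hne, Function.update_self]
        · apply prod_congr rfl
          intro j hj
          have a1 : j ≠ j0 := fun h => hj0 (h ▸ hj)
          have a2 : j ≠ σ j0 := hJ j (mem_insert_of_mem hj) j0 (mem_insert_self _ _)
          have a3 : σ j ≠ j0 := (hJ j0 (mem_insert_self _ _) j (mem_insert_of_mem hj)).symm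
          have a4 : σ j ≠ σ j0 := fun h => a1 (hσ h)
          rw [Function.update_of_ne a1, Function.update_of_ne a2, Function.update_of_ne a3, Function.update_of_ne a4]
      simp only [this]
      simp only [Fin.sum_univ_two]
      ring
    rw [this, EE_mul, ih, card_insert_of_notMem hj0, pow_succ, mul_comm]

end Gen

variable {n : ℕ}

def sh (s : ℕ) (j : Fin n) : Fin n := ⟨(j.1 + s) % n, Nat.mod_lt _ j.pos⟩

theorem sh_inj (s : ℕ) : Function.Injective (sh s : Fin n → Fin n) := by
  intro a b h
  simp only [sh, Fin.mk.injEq] at h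
  have : a.1 + s ≡ b.1 + s [MOD n] := h
  have := Nat.ModEq.add_right_cancel' s this
  ext
  have := Nat.ModEq.eq_of_lt_of_lt this a.2 b.2
  exact this

theorem sh_val (s : ℕ) (hs : s < n) (j : Fin n) :
    (sh s j).1 = if j.1 + s < n then j.1 + s else j.1 + s - n := by
  simp only [sh]
  split_ifs with h
  · exact Nat.mod_eq_of_lt h
  · rw [Nat.mod_eq_sub_mod (by omega)]
    exact Nat.mod_eq_of_lt (by have := j.2; omega)

theorem hamming_pow (v : ℝ) (x y : Fin n → Fin 2) :
    v ^ hammingDist x y = ∏ j, if x j ≠ y j then v else 1 := by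
  rw [hammingDist, ← prod_const, prod_filter]

def col (n s : ℕ) (j : Fin n) : Fin 3 :=
  if n - s ≤ j.1 then 2 else if (j.1 / s) % 2 = 0 then 0 else 1

theorem col_ne (s : ℕ) (hs : 0 < s) (hs2 : 2 * s ≤ n) (j : Fin n) : col n s (sh s j) ≠ col n s j := by
  have hv := sh_val s (by omega) j
  have := j.2
  unfold col
  rw [hv]
  by_cases h : j.1 + s < n
  · rw [if_pos h]
    have e : (j.1 + s) / s = j.1 / s + 1 := Nat.add_div_right _ hs
    rw [e, if_neg (show ¬ n - s ≤ j.1 by omega)]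
    split_ifs <;> first | decide | omega
  · rw [if_neg h, if_neg (show ¬ n - s ≤ j.1 + s - n by omega), if_pos (show n - s ≤ j.1 by omega)]
    split_ifs <;> decide

theorem amgm3 (x y z : ℝ) (hx : 0 ≤ x) (hy : 0 ≤ y) (hz : 0 ≤ z) : x*y*z ≤ (x^3+y^3+z^3)/3 := by
  nlinarith [mul_nonneg (add_nonneg (add_nonneg hx hy) hz) (sq_nonneg (x-y)), mul_nonneg (add_nonneg (add_nonneg hx hy) hz) (sq_nonneg (x-z)), mul_nonneg (add_nonneg (add_nonneg hx hy) hz) (sq_nonneg (y-z))]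

theorem mgf_bound (p v : ℝ) (h0 : 0 ≤ p) (h1 : p ≤ 1) (hv : 0 < v) (s : ℕ) (hs : 0 < s) (hs2 : 2 * s ≤ n) :
    EE p (fun x : Fin n → Fin 2 => v ^ hammingDist x (cshift s x))
      ≤ Real.exp (-(2/3 * (p * (1 - p) * n) * (1 - v^3))) := by
  set h : Fin 2 → Fin 2 → ℝ := fun s t => if s ≠ t then v else 1 with hh
  have hh0 : ∀ s t, 0 ≤ h s t := by intro s t; simp only [hh]; split_ifs <;> linarith
  set r : ℝ := Real.exp (-(2/3 * (p * (1-p)) * (1-v^3))) with hr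
  have hr0 : 0 < r := Real.exp_pos _
  set ρ : ℝ := ∑ s, ∑ t, bw p s * bw p t * (h s t)^3 with hρ
  have hρ1 : ρ = 1 - 2 * (p * (1-p)) * (1 - v^3) := by
    simp [hρ, hh, bw]; ring
  have hρr : ρ ≤ r^3 := by
    rw [hr, ← Real.exp_nat_mul, hρ1]
    have := Real.add_one_le_exp (-(2 * (p * (1-p)) * (1 - v^3)))
    refine le_trans (by linarith) (this.trans_eq ?_)
    congr 1; push_cast; ring
  have hρ0 : 0 ≤ ρ := sum_nonneg fun s _ => sum_nonneg fun t _ => 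
    mul_nonneg (mul_nonneg (bw_nonneg h0 h1 _) (bw_nonneg h0 h1 _)) (pow_nonneg (hh0 _ _) _)
  set J : Fin 3 → Finset (Fin n) := fun c => univ.filter fun j => col n s j = c with hJ
  set X : Fin 3 → (Fin n → Fin 2) → ℝ := fun c x => ∏ j ∈ J c, h (x j) (x (sh s j)) with hX
  have hX0 : ∀ c x, 0 ≤ X c x := fun c x => prod_nonneg fun _ _ => hh0 _ _
  have hXE : ∀ c, EE p (fun x => (X c x)^3) ≤ (r ^ #(J c))^3 := by
    intro c
    have := EE_indep p (fun s t => (h s t)^3) (sh s) (sh_inj s) (J c) (by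
      intro j hj k hk
      simp only [hJ, mem_filter, mem_univ, true_and] at hj hk
      intro e
      have := col_ne s hs hs2 k
      rw [← e] at this
      exact this (hj.trans hk.symm))
    simp only [hX, ← prod_pow]
    rw [this, ← pow_mul, mul_comm, pow_mul]
    exact pow_le_pow_left₀ hρ0 hρr _
  have hcard : #(J 0) + #(J 1) + #(J 2) = n := by
    have := card_eq_sum_card_fiberwise (s := (univ : Finset (Fin n))) (t := univ) (f := col n s) (by simp)
    rw [Fin.sum_univ_three] at this
    simp at this
    exact this.symm
  have hprod : ∀ x : Fin n → Fin 2, v ^ hammingDist x (cshift s x) = X 0 x * X 1 x * X 2 x := by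
    intro x
    rw [hamming_pow]
    rw [← prod_fiberwise (s := univ) (g := col n s), Fin.prod_univ_three]
    rfl
  have hrn : Real.exp (-(2/3 * (p * (1 - p) * n) * (1 - v^3))) = r ^ n := by
    rw [hr, ← Real.exp_nat_mul]; congr 1; ring
  rw [hrn]
  have hle : ∀ x : Fin n → Fin 2, v ^ hammingDist x (cshift s x) ≤
      (r^n/3/(r^#(J 0))^3) * (X 0 x)^3 + ((r^n/3/(r^#(J 1))^3) * (X 1 x)^3 + (r^n/3/(r^#(J 2))^3) * (X 2 x)^3) := by
    intro x
    rw [hprod]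
    have := amgm3 (X 0 x / r^#(J 0)) (X 1 x / r^#(J 1)) (X 2 x / r^#(J 2)) 
      (div_nonneg (hX0 _ _) (by positivity)) (div_nonneg (hX0 _ _) (by positivity)) (div_nonneg (hX0 _ _) (by positivity))
    have e : r^n = r^#(J 0) * r^#(J 1) * r^#(J 2) := by rw [← pow_add, ← pow_add, hcard]
    have e2 : X 0 x * X 1 x * X 2 x = r^n * ((X 0 x / r^#(J 0)) * (X 1 x / r^#(J 1)) * (X 2 x / r^#(J 2))) := by
      rw [e]; field_simp
    rw [e2]
    refine (mul_le_mul_of_nonneg_left this (by positivity)).trans_eq ?_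
    rw [div_pow, div_pow, div_pow]
    ring
  refine (EE_mono h0 h1 _ _ hle).trans ?_
  rw [EE_add, EE_add, EE_mul, EE_mul, EE_mul]
  have hb : ∀ c, (r^n/3/(r^#(J c))^3) * EE p (fun x => (X c x)^3) ≤ r^n/3 := by
    intro c
    refine (mul_le_mul_of_nonneg_left (hXE c) (by positivity)).trans_eq ?_
    field_simp
  have := hb 0; have := hb 1; have := hb 2
  linarith

theorem Wt_eq (p : ℝ) (x : Fin n → Fin 2) : Wt p x = p ^ hammingNorm x * (1-p) ^ (n - hammingNorm x) := by
  unfold Wt bw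
  have h1 : ∏ j, (if x j = 0 then 1 - p else p) = (∏ j with x j = 0, (1-p)) * ∏ j with ¬ x j = 0, p := by
    rw [prod_ite]
  rw [h1, prod_const, prod_const, mul_comm]
  have : #(univ.filter fun j => x j = 0) + hammingNorm x = n := by
    have := card_filter_add_card_filter_not (s := (univ : Finset (Fin n))) (fun j => x j = 0)
    simpa [hammingNorm] using this
  rw [show n - hammingNorm x = #(univ.filter fun j => x j = 0) by omega]
  rfl

theorem shift_count (w : ℕ) (hw : w ≤ n) (hn : 0 < n) (p : ℝ) (hp : p * n = w) (κ T : ℝ) (hκ : 0 ≤ κ)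
    (s : ℕ) (hs : 0 < s) (hs2 : 2 * s ≤ n) :
    (#(univ.filter fun x : Fin n → Fin 2 => hammingNorm x = w ∧ (hammingDist x (cshift s x) : ℝ) ≤ T) : ℝ)
      ≤ (n+1) * n.choose w * Real.exp (κ*T/3 - 2/3 * (p*(1-p)*n) * (1 - Real.exp (-κ))) := by
  have hn' : (0:ℝ) < n := by exact_mod_cast hn
  have hw' : (w:ℝ) ≤ n := by exact_mod_cast hw
  have h0 : 0 ≤ p := by
    by_contra h; push Not at h
    have : p * n < 0 := mul_neg_of_neg_of_pos h hn'
    have : (0:ℝ) ≤ w := Nat.cast_nonneg _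
    linarith
  have h1 : p ≤ 1 := by
    by_contra h; push Not at h
    nlinarith
  set v := Real.exp (-(κ/3)) with hv
  have hv3 : v^3 = Real.exp (-κ) := by rw [hv, ← Real.exp_nat_mul]; congr 1; push_cast; ring
  have hm := mgf_bound p v h0 h1 (Real.exp_pos _) s hs hs2
  rw [hv3] at hm
  set S := univ.filter fun x : Fin n → Fin 2 => hammingNorm x = w ∧ (hammingDist x (cshift s x) : ℝ) ≤ T with hS
  set c : ℝ := p^w * (1-p)^(n-w) with hc
  have hlow : (#S : ℝ) * (c * Real.exp (-(κ*T/3))) ≤ EE p (fun x : Fin n → Fin 2 => v ^ hammingDist x (cshift s x)) := by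
    unfold EE
    rw [← nsmul_eq_mul, ← sum_const]
    refine (sum_le_sum (fun x hx => ?_)).trans (sum_le_sum_of_subset_of_nonneg (subset_univ _) fun x _ _ => mul_nonneg (Wt_nonneg h0 h1 x) (by positivity))
    simp only [hS, mem_filter, mem_univ, true_and] at hx
    rw [Wt_eq, hx.1]
    have hc0 : 0 ≤ c := by have : 0 ≤ 1 - p := by linarith
                           positivity
    refine mul_le_mul_of_nonneg_left ?_ hc0
    beta_reduce
    rw [hv, ← Real.exp_nat_mul]
    apply Real.exp_le_exp.2
    nlinarith [hx.2]
  have hmode := mode_real n w hw hn p hp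
  rw [← hc] at hmode
  have hS0 : (0:ℝ) ≤ #S := Nat.cast_nonneg _
  have hC0 : (0:ℝ) ≤ (n+1) * n.choose w := by positivity
  have hE := hlow.trans hm
  rw [Real.exp_sub]
  have e1 : Real.exp (κ*T/3) * Real.exp (-(κ*T/3)) = 1 := by rw [← Real.exp_add]; simp
  have hx0 := Real.exp_pos (κ*T/3)
  calc (#S : ℝ) = #S * 1 * (Real.exp (κ*T/3) * Real.exp (-(κ*T/3))) := by rw [e1]; ring
    _ ≤ #S * ((n+1) * (n.choose w * c)) * (Real.exp (κ*T/3) * Real.exp (-(κ*T/3))) := by gcongr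
    _ = (#S * (c * Real.exp (-(κ*T/3)))) * (((n+1) * n.choose w) * Real.exp (κ*T/3)) := by ring
    _ ≤ Real.exp (-(2/3 * (p * (1 - p) * n) * (1 - Real.exp (-κ)))) * (((n+1) * n.choose w) * Real.exp (κ*T/3)) := by gcongr
    _ = _ := by rw [Real.exp_neg]; field_simp

theorem cshift_sub (s : ℕ) (hs : s < n) (x : Fin n → Fin 2) :
    hammingDist x (cshift (n-s) x) = hammingDist x (cshift s x) := by
  unfold hammingDist
  refine card_bij (fun j _ => sh (n-s) j) ?_ (fun a _ b _ h => sh_inj _ h) ?_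
  · intro j hj
    simp only [mem_filter, mem_univ, true_and] at hj ⊢
    have e : cshift s x (sh (n-s) j) = x j := by
      change x (sh s (sh (n-s) j)) = _
      congr 1
      ext
      simp only [sh]
      have := j.2
      rw [Nat.mod_add_mod, show j.1 + (n-s) + s = j.1 + n by omega, Nat.add_mod_right, Nat.mod_eq_of_lt j.2]
    rw [e]
    exact fun h => hj h.symm
  · intro j hj
    simp only [mem_filter, mem_univ, true_and] at hj
    have e : sh (n-s) (sh s j) = j := by
      ext
      simp only [sh]
      have := j.2
      rw [Nat.mod_add_mod, show j.1 + s + (n-s) = j.1 + n by omega, Nat.add_mod_right, Nat.mod_eq_of_lt j.2]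
    refine ⟨sh s j, ?_, e⟩
    simp only [mem_filter, mem_univ, true_and]
    have : cshift (n-s) x (sh s j) = x j := by
      change x (sh (n-s) (sh s j)) = _
      rw [e]
    rw [this]
    exact fun h => hj h.symm

open Classical in
theorem union_count (w : ℕ) (hw : w ≤ n) (hn : 0 < n) (p : ℝ) (hp : p * n = w) (κ T : ℝ) (hκ : 0 ≤ κ) :
    (#(univ.filter fun x : Fin n → Fin 2 => hammingNorm x = w ∧ ∃ s, 0 < s ∧ s < n ∧ (hammingDist x (cshift s x) : ℝ) ≤ T) : ℝ)
      ≤ n / 2 * ((n+1) * n.choose w * Real.exp (κ*T/3 - 2/3 * (p*(1-p)*n) * (1 - Real.exp (-κ)))) := by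
  classical
  have hsub : (univ.filter fun x : Fin n → Fin 2 => hammingNorm x = w ∧ ∃ s, 0 < s ∧ s < n ∧ (hammingDist x (cshift s x) : ℝ) ≤ T)
     ⊆ (Icc 1 (n/2)).biUnion fun s => univ.filter fun x : Fin n → Fin 2 => hammingNorm x = w ∧ (hammingDist x (cshift s x) : ℝ) ≤ T := by
    intro x hx
    simp only [mem_filter, mem_univ, true_and, mem_biUnion, mem_Icc] at hx ⊢
    obtain ⟨hx, s, h1, h2, h3⟩ := hx
    by_cases h : s ≤ n / 2
    · exact ⟨s, ⟨h1, h⟩, hx, h3⟩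
    · refine ⟨n - s, ⟨by omega, by omega⟩, hx, ?_⟩
      rw [cshift_sub s h2]; exact h3
  have h1 := (card_le_card hsub).trans card_biUnion_le
  set K := ((n:ℝ)+1) * n.choose w * Real.exp (κ*T/3 - 2/3 * (p*(1-p)*n) * (1 - Real.exp (-κ))) with hK
  have hK0 : 0 ≤ K := by positivity
  calc _ ≤ ((∑ s ∈ Icc 1 (n/2), #(univ.filter fun x : Fin n → Fin 2 => hammingNorm x = w ∧ (hammingDist x (cshift s x) : ℝ) ≤ T) : ℕ) : ℝ) := Nat.cast_le.2 h1
    _ ≤ ∑ s ∈ Icc 1 (n/2), K := by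
        push_cast
        apply sum_le_sum
        intro s hs
        rw [mem_Icc] at hs
        exact shift_count w hw hn p hp κ T hκ s (by omega) (by omega)
    _ = ((n/2 : ℕ):ℝ) * K := by simp
    _ ≤ _ := by
        gcongr
        exact Nat.cast_div_le

end Union


section Shifts
variable {n : ℕ}

theorem cshift_add (a b : ℕ) (x : Fin n → Fin 2) : cshift a (cshift b x) = cshift (a + b) x := by
  ext j : 1
  simp only [cshift]
  congr 2
  rw [Nat.mod_add_mod]
  congr 1; 
  ring

theorem cshift_mod (a : ℕ) (x : Fin n → Fin 2) : cshift (a % n) x = cshift a x := by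
  ext j : 1
  simp only [cshift]
  congr 2
  rw [Nat.add_mod_mod]

theorem cshift_self (x : Fin n → Fin 2) : cshift n x = x := by
  ext j : 1
  simp only [cshift]
  congr 2
  rw [Nat.add_mod_right, Nat.mod_eq_of_lt j.2]

theorem cshift_zero (x : Fin n → Fin 2) : cshift 0 x = x := by
  ext j : 1
  simp only [cshift]
  congr 2
  rw [Nat.add_zero, Nat.mod_eq_of_lt j.2]

theorem cshift_cancel (s : ℕ) (hs : s ≤ n) (x : Fin n → Fin 2) : cshift (n - s) (cshift s x) = x := by
  rw [cshift_add, Nat.sub_add_cancel hs, cshift_self]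

theorem sh_bij (s : ℕ) : Function.Bijective (sh s : Fin n → Fin n) :=
  Finite.injective_iff_bijective.1 (sh_inj s)

theorem dist_cshift (s : ℕ) (x y : Fin n → Fin 2) :
    hammingDist (cshift s x) (cshift s y) = hammingDist x y := by
  unfold hammingDist
  refine card_bij (fun j _ => sh s j) ?_ (fun a _ b _ h => sh_inj _ h) ?_
  · intro j hj
    simp only [mem_filter, mem_univ, true_and] at hj ⊢
    exact hj
  · intro j hj
    obtain ⟨i, rfl⟩ := (sh_bij s).2 j
    refine ⟨i, ?_, rfl⟩
    simp only [mem_filter, mem_univ, true_and] at hj ⊢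
    exact hj

theorem norm_cshift (s : ℕ) (x : Fin n → Fin 2) : hammingNorm (cshift s x) = hammingNorm x := by
  have : cshift s (0 : Fin n → Fin 2) = 0 := rfl
  rw [← hammingDist_zero_right, ← hammingDist_zero_right x, ← dist_cshift s x 0, this]

theorem dist_cshift_left (s : ℕ) (hs : s ≤ n) (x y : Fin n → Fin 2) :
    hammingDist x (cshift s y) = hammingDist y (cshift (n - s) x) := by
  rw [← dist_cshift (n-s), cshift_cancel s hs, hammingDist_comm]

/-- words far from all their nontrivial shifts -/
def SelfFar (d : ℕ) (x : Fin n → Fin 2) : Prop := ∀ s, 0 < s → s < n → d ≤ hammingDist x (cshift s x)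

theorem SelfFar.shift {d : ℕ} {x : Fin n → Fin 2} (h : SelfFar d x) (s : ℕ) : SelfFar d (cshift s x) := by
  intro r h1 h2
  rw [cshift_add, add_comm, ← cshift_add, dist_cshift]
  exact h r h1 h2

theorem SelfFar.pair {d : ℕ} {x : Fin n → Fin 2} (h : SelfFar d x) (i j : ℕ) (hij : i < j) (hj : j < n) :
    d ≤ hammingDist (cshift i x) (cshift j x) := by
  have : j = i + (j - i) := by omega
  rw [this, ← cshift_add, dist_cshift]
  exact h _ (by omega) (by omega)

theorem code_of_reps (d w : ℕ) (hd : 0 < d) (I : Finset (Fin n → Fin 2))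
    (hw : ∀ x ∈ I, hammingNorm x = w) (hI : ∀ x ∈ I, SelfFar d x)
    (hx : ∀ x ∈ I, ∀ y ∈ I, x ≠ y → ∀ s < n, d ≤ hammingDist x (cshift s y)) :
    ∃ C : Finset (Fin n → Fin 2), IsHCC C ∧ (∀ x ∈ C, hammingNorm x = w) ∧
        (∀ x ∈ C, ∀ y ∈ C, x ≠ y → d ≤ hammingDist x y) ∧ #C = n * #I := by
  classical
  rcases Nat.eq_zero_or_pos n with rfl | hn
  · exact ⟨∅, by simp [IsHCC], by simp, by simp, by simp⟩
  have hfar : ∀ x ∈ I, ∀ y ∈ I, ∀ i j : Fin n, (x, i) ≠ (y, j) → d ≤ hammingDist (cshift i.1 x) (cshift j.1 y) := by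
    intro x hxI y hyI i j hne
    by_cases hxy : x = y
    · subst hxy
      have hij : i.1 ≠ j.1 := fun h => hne (by rw [Fin.ext h])
      rcases lt_or_gt_of_ne hij with h | h
      · exact (hI x hxI).pair _ _ h j.2
      · rw [hammingDist_comm]; exact (hI x hxI).pair _ _ h i.2
    · rw [← dist_cshift (n - i.1), cshift_cancel _ i.2.le, cshift_add, ← cshift_mod]
      exact hx x hxI y hyI hxy _ (Nat.mod_lt _ hn)
  refine ⟨(I ×ˢ (univ : Finset (Fin n))).image (fun z => cshift z.2.1 z.1), ?_, ?_, ?_, ?_⟩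
  · intro x hxC
    simp only [mem_image, mem_product, mem_univ, and_true, Prod.exists] at hxC
    obtain ⟨y, j, hy, rfl⟩ := hxC
    constructor
    · intro i
      simp only [mem_image, mem_product, mem_univ, and_true, Prod.exists]
      refine ⟨y, ⟨(i + j.1) % n, Nat.mod_lt _ hn⟩, hy, ?_⟩
      rw [cshift_mod, cshift_add]
    · intro a b hab
      by_contra hne
      have hab : cshift a.1 (cshift j.1 y) = cshift b.1 (cshift j.1 y) := hab
      have hne' : a.1 ≠ b.1 := fun h => hne (Fin.ext h)
      have hs := (hI y hy).shift j.1
      rcases lt_or_gt_of_ne hne' with h | h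
      · have := hs.pair _ _ h b.2
        rw [hab, hammingDist_self] at this; omega
      · have := hs.pair _ _ h a.2
        rw [hab, hammingDist_self] at this; omega
  · intro x hxC
    simp only [mem_image, mem_product, mem_univ, and_true, Prod.exists] at hxC
    obtain ⟨y, j, hy, rfl⟩ := hxC
    rw [norm_cshift]; exact hw y hy
  · intro x hxC y hyC hne
    simp only [mem_image, mem_product, mem_univ, and_true, Prod.exists] at hxC hyC
    obtain ⟨x, i, hx, rfl⟩ := hxC
    obtain ⟨y, j, hy, rfl⟩ := hyC
    refine hfar x hx y hy i j ?_
    intro h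
    simp only [Prod.mk.injEq] at h
    exact hne (by rw [h.1, h.2])
  · rw [card_image_of_injOn, card_product, card_univ, Fintype.card_fin, mul_comm]
    rintro ⟨x, i⟩ hz ⟨y, j⟩ hz' h
    simp only [coe_product, Set.mem_prod, mem_coe] at hz hz'
    by_contra hne
    have := hfar x hz.1 y hz'.1 i j hne
    simp only at h
    rw [h, hammingDist_self] at this
    omega

theorem card_weight (n w : ℕ) : #(univ.filter fun x : Fin n → Fin 2 => hammingNorm x = w) = n.choose w := by
  have : #(powersetCard w (univ : Finset (Fin n))) = n.choose w := by simp
  rw [← this]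
  refine card_bij (fun x _ => univ.filter fun j => x j ≠ 0) ?_ ?_ ?_
  · intro x hx
    simp only [mem_filter, mem_univ, true_and] at hx
    rw [mem_powersetCard]
    exact ⟨subset_univ _, hx⟩
  · intro x _ y _ h
    ext j : 1
    have := congrArg (j ∈ ·) h
    simp only [mem_filter, mem_univ, true_and] at this
    generalize x j = a at this
    generalize y j = b at this
    have hh : ∀ a b : Fin 2, ((a ≠ 0) = (b ≠ 0)) → a = b := by
      intro a b h
      have h' : a ≠ 0 ↔ b ≠ 0 := by rw [h]
      revert a b; decide
    exact hh a b this
  · intro S hS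
    rw [mem_powersetCard] at hS
    refine ⟨fun j => if j ∈ S then 1 else 0, ?_, ?_⟩
    · simp only [mem_filter, mem_univ, true_and, hammingNorm]
      rw [← hS.2]; congr 1; ext j; simp
    · ext j; simp

/-- orbit representatives -/
theorem exists_reps (hn : 0 < n) (V : Finset (Fin n → Fin 2)) (hV : ∀ x ∈ V, ∀ s, cshift s x ∈ V) :
    ∃ T ⊆ V, #V ≤ n * #T ∧ ∀ x ∈ T, ∀ y ∈ T, ∀ s, cshift s x = y → x = y := by
  classical
  let S : Setoid (Fin n → Fin 2) :=
    { r := fun x y => ∃ s, s ≤ n ∧ cshift s x = y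
      iseqv := ⟨fun x => ⟨0, Nat.zero_le _, cshift_zero x⟩, by
        rintro x y ⟨s, hs, rfl⟩
        exact ⟨n - s, Nat.sub_le _ _, cshift_cancel s hs x⟩, by
        rintro x y z ⟨s, hs, rfl⟩ ⟨r, hr, rfl⟩
        exact ⟨(r + s) % n, (Nat.mod_lt _ hn).le, by rw [cshift_mod, cshift_add]⟩⟩ }
  let rep : (Fin n → Fin 2) → (Fin n → Fin 2) := fun x => (Quotient.mk S x).out
  have hrep : ∀ x, ∃ s, s ≤ n ∧ cshift s (rep x) = x := fun x => Quotient.exact (Quotient.out_eq (Quotient.mk S x))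
  have hrep' : ∀ x, ∃ s, cshift s x = rep x := by
    intro x
    obtain ⟨s, hs, h⟩ := hrep x
    exact ⟨n - s, by rw [← h]; rw [cshift_cancel s hs, h]⟩
  have hrr : ∀ x, rep (rep x) = rep x := by
    intro x
    simp only [rep, Quotient.out_eq]
  refine ⟨V.image rep, ?_, ?_, ?_⟩
  · intro y hy
    rw [mem_image] at hy
    obtain ⟨x, hx, rfl⟩ := hy
    obtain ⟨s, hs⟩ := hrep' x
    rw [← hs]; exact hV x hx s
  · rw [mul_comm, mul_comm]
    refine card_le_mul_card_image V n ?_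
    intro t _
    have : V.filter (fun x => rep x = t) ⊆ (univ : Finset (Fin n)).image fun i => cshift i.1 t := by
      intro x hx
      simp only [mem_filter] at hx
      obtain ⟨s, hs, h⟩ := hrep x
      simp only [mem_image, mem_univ, true_and]
      exact ⟨⟨s % n, Nat.mod_lt _ hn⟩, by simp only; rw [cshift_mod, ← hx.2, h]⟩
    refine (card_le_card this).trans (card_image_le.trans (by simp))
  · intro x hx y hy s h
    rw [mem_image] at hx hy
    obtain ⟨x, hx, rfl⟩ := hx
    obtain ⟨y, hy, rfl⟩ := hy
    rw [← hrr x, ← hrr y]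
    have : Quotient.mk S (rep x) = Quotient.mk S (rep y) := Quotient.sound ⟨s % n, (Nat.mod_lt _ hn).le, by rw [cshift_mod, h]⟩
    simp only [rep] at this ⊢
    rw [this]

end Shifts


section Assemble
variable {n : ℕ}

set_option maxHeartbeats 1000000 in
open Classical in
theorem graph_code (d w : ℕ) (hd : 0 < d) {δ : ℕ} {a b : ℝ} (h : BallHyp n w δ a b) (hδ : (d-1)/2 = δ)
    (l L : ℝ) (hl : 0 < l) (hl2 : l ≤ 1/2) (hL : 0 ≤ L)
    (hE : n * (2 * ((n:ℝ)+1)^2 * (volCW n (d-1) w)^2 * (3/4)^(δ/2)) * l^2 ≤ 1)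
    (hΔ : L*(1+Real.exp (4*L+2)) ≤ volCW n (d-1) w * l)
    (hV : (n.choose w : ℝ) ≤ 2 * #(univ.filter fun x : Fin n → Fin 2 => hammingNorm x = w ∧ SelfFar d x)) :
    ∃ C : Finset (Fin n → Fin 2), IsHCC C ∧ (∀ x ∈ C, hammingNorm x = w) ∧
        (∀ x ∈ C, ∀ y ∈ C, x ≠ y → d ≤ hammingDist x y) ∧ L * n.choose w ≤ 4 * volCW n (d-1) w * #C := by
  have hn : 0 < n := lt_of_le_of_lt (Nat.zero_le _) h.hwn
  set t := d - 1 with ht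
  set V := univ.filter fun x : Fin n → Fin 2 => hammingNorm x = w ∧ SelfFar d x with hVdef
  obtain ⟨T, hTV, hTc, hTo⟩ := exists_reps hn V (by
    intro x hx s
    simp only [hVdef, mem_filter, mem_univ, true_and] at hx ⊢
    exact ⟨by rw [norm_cshift]; exact hx.1, hx.2.shift s⟩)
  have hTw : ∀ x ∈ T, hammingNorm x = w := fun x hx => by
    have := hTV hx
    simp only [hVdef, mem_filter, mem_univ, true_and] at this
    exact this.1
  have hTs : ∀ x ∈ T, SelfFar d x := fun x hx => by
    have := hTV hx
    simp only [hVdef, mem_filter, mem_univ, true_and] at this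
    exact this.2
  obtain ⟨G, hG⟩ : ∃ G : SimpleGraph T, ∀ y z, G.Adj y z ↔ (y ≠ z ∧ ∃ s, s < n ∧ hammingDist y.1 (cshift s z.1) ≤ t) :=
   ⟨{ Adj := fun y z => y ≠ z ∧ ∃ s, s < n ∧ hammingDist y.1 (cshift s z.1) ≤ t
      symm := ⟨by
        rintro y z ⟨hne, s, hs, hd⟩
        refine ⟨hne.symm, (n - s) % n, Nat.mod_lt _ hn, ?_⟩
        rw [cshift_mod, ← dist_cshift_left s hs.le]; exact hd⟩
      loopless := ⟨fun y hy => hy.1 rfl⟩ }, fun _ _ => Iff.rfl⟩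
  -- orbit injectivity
  have horb : ∀ (φ : T → (Fin n → Fin 2)), (∀ z, ∃ s, s ≤ n ∧ φ z = cshift s z.1) → Function.Injective φ := by
    intro φ hφ y z hyz
    obtain ⟨s, hs, h1⟩ := hφ y
    obtain ⟨r, hr, h2⟩ := hφ z
    rw [h1, h2] at hyz
    apply Subtype.ext
    refine hTo y.1 y.2 z.1 z.2 (n - r + s) ?_
    rw [← cshift_add, hyz, cshift_cancel r hr]
  have hφ : ∀ x : T, ∃ φ : T → (Fin n → Fin 2), (∀ z, ∃ s, s ≤ n ∧ φ z = cshift s z.1) ∧ ∀ z, G.Adj x z → φ z ∈ cwBall x.1 w t := by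
    intro x
    have : ∀ z : T, ∃ y : Fin n → Fin 2, (∃ s, s ≤ n ∧ y = cshift s z.1) ∧ (G.Adj x z → y ∈ cwBall x.1 w t) := by
      intro z
      by_cases hz : G.Adj x z
      · obtain ⟨hne, s, hs, hd⟩ := (hG _ _).1 hz
        refine ⟨cshift s z.1, ⟨s, hs.le, rfl⟩, fun _ => ?_⟩
        simp only [cwBall, mem_filter, mem_univ, true_and]
        exact ⟨by rw [norm_cshift]; exact hTw _ z.2, hd⟩
      · exact ⟨z.1, ⟨0, Nat.zero_le _, (cshift_zero _).symm⟩, fun h => (hz h).elim⟩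
    choose φ h1 h2 using this
    exact ⟨φ, h1, h2⟩
  choose φ hφ1 hφ2 using hφ
  have hdeg : ∀ x : T, (#(univ.filter (G.Adj x)) : ℝ) ≤ volCW n t w := by
    intro x
    rw [Nat.cast_le]
    refine le_trans ?_ (cwBall_card x.1 w t (hTw _ x.2))
    refine card_le_card_of_injOn (φ x) ?_ ((horb _ (hφ1 x)).injOn)
    intro z hz
    simp only [coe_filter, mem_univ, true_and, Set.mem_ofPred_eq] at hz
    exact hφ2 x z hz
  have hedge : ∀ x : T, (∑ u ∈ univ.filter (G.Adj x), #((univ.filter (G.Adj x)).filter (fun z => G.Adj u z)) : ℕ)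
      ≤ ∑ r ∈ range n, ∑ u' ∈ cwBall x.1 w t, #(cwBall (cshift r x.1) w t ∩ cwBall u' w t) := by
    intro x
    rw [sum_comm]
    have key : ∀ u ∈ univ.filter (G.Adj x), #((univ.filter (G.Adj x)).filter (fun z => G.Adj u z))
        ≤ ∑ r ∈ range n, #(cwBall (cshift r x.1) w t ∩ cwBall (φ x u) w t) := by
      intro u hu
      refine le_trans ?_ card_biUnion_le
      have : ∀ z : T, ∃ y : Fin n → Fin 2, (∃ s, s ≤ n ∧ y = cshift s z.1) ∧ (G.Adj x z → G.Adj u z → y ∈ (range n).biUnion fun r => cwBall (cshift r x.1) w t ∩ cwBall (φ x u) w t) := by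
        intro z
        by_cases hz : G.Adj x z ∧ G.Adj u z
        · obtain ⟨hz1, hz2⟩ := hz
          obtain ⟨_, s, hs, hd1⟩ := (hG _ _).1 hz1
          obtain ⟨_, s', hs', hd2⟩ := (hG _ _).1 hz2
          obtain ⟨q, hq, hqe⟩ := hφ1 x u
          refine ⟨cshift ((q + s') % n) z.1, ⟨_, (Nat.mod_lt _ hn).le, rfl⟩, fun _ _ => ?_⟩
          rw [mem_biUnion]
          refine ⟨(q + s' + (n - s)) % n, mem_range.2 (Nat.mod_lt _ hn), ?_⟩
          simp only [cwBall, mem_inter, mem_filter, mem_univ, true_and, cshift_mod]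
          refine ⟨⟨by rw [norm_cshift]; exact hTw _ z.2, ?_⟩, by rw [norm_cshift]; exact hTw _ z.2, ?_⟩
          · rw [← cshift_add, dist_cshift, hammingDist_comm, ← dist_cshift_left s hs.le]; exact hd1
          · rw [hqe, ← cshift_add, dist_cshift]; exact hd2
        · exact ⟨z.1, ⟨0, Nat.zero_le _, (cshift_zero _).symm⟩, fun h1 h2 => (hz ⟨h1, h2⟩).elim⟩
      choose ψ h1 h2 using this
      refine card_le_card_of_injOn ψ ?_ ((horb _ h1).injOn)
      intro z hz
      simp only [coe_filter, mem_univ, true_and, mem_filter, Set.mem_ofPred_eq] at hz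
      exact h2 z hz.1 hz.2
    refine (sum_le_sum key).trans ?_
    rw [← sum_image (s := univ.filter (G.Adj x)) (g := φ x) (f := fun u' => ∑ r ∈ range n, #(cwBall (cshift r x.1) w t ∩ cwBall u' w t)) ((horb _ (hφ1 x)).injOn)]
    refine sum_le_sum_of_subset_of_nonneg ?_ fun _ _ _ => Nat.zero_le _
    intro y hy
    simp only [mem_image, mem_filter, mem_univ, true_and] at hy
    obtain ⟨z, hz, rfl⟩ := hy
    exact hφ2 x z hz
  obtain ⟨I, hI, hIc⟩ := graph_indep G l (volCW n t w) L hl hl2 hdeg (by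
    intro x
    refine le_trans ?_ hE
    refine mul_le_mul_of_nonneg_right ?_ (by positivity)
    refine (Nat.cast_le.2 (hedge x)).trans ?_
    rw [Nat.cast_sum]
    refine (sum_le_sum (g := fun _ => 2 * ((n:ℝ)+1)^2 * (volCW n t w)^2 * (3/4)^(δ/2)) fun r _ => ?_).trans_eq ?_
    · exact pairs_bound h t hδ x.1 _ (hTw _ x.2) (by rw [norm_cshift]; exact hTw _ x.2)
    · simp) hL hΔ
  obtain ⟨C, h1, h2, h3, h4⟩ := code_of_reps d w hd (I.map (Function.Embedding.subtype _))
    (by intro x hx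
        simp only [mem_map, Function.Embedding.coe_subtype] at hx
        obtain ⟨y, _, rfl⟩ := hx
        exact hTw _ y.2)
    (by intro x hx
        simp only [mem_map, Function.Embedding.coe_subtype] at hx
        obtain ⟨y, _, rfl⟩ := hx
        exact hTs _ y.2)
    (by intro x hx y hy hne s hs
        simp only [mem_map, Function.Embedding.coe_subtype] at hx hy
        obtain ⟨x, hx, rfl⟩ := hx
        obtain ⟨y, hy, rfl⟩ := hy
        by_contra hlt
        exact hI x hx y hy <| (hG _ _).2 ⟨fun h => hne (by rw [h]), s, hs, by omega⟩)
  refine ⟨C, h1, h2, h3, ?_⟩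
  rw [card_map] at h4
  rw [h4, Nat.cast_mul]
  rw [Fintype.card_coe] at hIc
  have hTc' : (#V : ℝ) ≤ n * #T := by exact_mod_cast hTc
  calc L * n.choose w ≤ L * (2 * (n * #T)) := by gcongr; linarith
    _ = 2 * n * (L * #T) := by ring
    _ ≤ 2 * n * (2 * volCW n t w * #I) := by gcongr
    _ = _ := by ring

end Assemble


section Large

theorem ev_exp (K : ℝ) (k : ℕ) (a : ℝ) (ha : 0 < a) : ∃ N : ℕ, ∀ n : ℕ, N ≤ n → K * ((n:ℝ)+1)^k ≤ Real.exp (a * n) := by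
  have h1 := Real.tendsto_pow_mul_exp_neg_atTop_nhds_zero k
  have h2 : Filter.Tendsto (fun n : ℕ => a * ((n:ℝ)+1)) Filter.atTop Filter.atTop := by
    apply Filter.Tendsto.const_mul_atTop ha
    exact Filter.tendsto_atTop_add_const_right _ _ tendsto_natCast_atTop_atTop
  have h3 := h1.comp h2
  have hpos : 0 < a^k * Real.exp (-a) / (|K|+1) := by positivity
  obtain ⟨N, hN⟩ := Filter.eventually_atTop.1 (h3.eventually (gt_mem_nhds hpos))
  refine ⟨N, fun n hn => ?_⟩
  have := hN n hn
  simp only [Function.comp] at this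
  rw [mul_pow, lt_div_iff₀ (by positivity), show -(a * ((n:ℝ)+1)) = -a + -(a*n) by ring, Real.exp_add] at this
  have h4 : ((n:ℝ)+1)^k * Real.exp (-(a*n)) * (|K|+1) < 1 := by
    have hp : 0 < a^k * Real.exp (-a) := by positivity
    refine lt_of_mul_lt_mul_left (a := a^k * Real.exp (-a)) ?_ hp.le
    rw [mul_one]; refine lt_of_eq_of_lt ?_ this; ring
  have h5 : Real.exp (-(a*n)) * Real.exp (a*n) = 1 := by rw [← Real.exp_add]; simp
  have hK := le_abs_self K
  calc K * ((n:ℝ)+1)^k ≤ (|K|+1) * ((n:ℝ)+1)^k := by gcongr; linarith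
    _ = (((n:ℝ)+1)^k * Real.exp (-(a*n)) * (|K|+1)) * Real.exp (a*n) := by
      rw [show (((n:ℝ)+1)^k * Real.exp (-(a*n)) * (|K|+1)) * Real.exp (a*n) = ((n:ℝ)+1)^k * (|K|+1) * (Real.exp (-(a*n)) * Real.exp (a*n)) by ring, h5]; ring
    _ ≤ 1 * Real.exp (a*n) := by gcongr
    _ = _ := one_mul _

open Classical in
theorem many_good {n : ℕ} (w d : ℕ) (hw : w ≤ n) (hn : 0 < n) (p : ℝ) (hp : p * n = w) (hd : (d:ℝ) ≤ p*(1-p)*n)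
    (he : ((n:ℝ)+1)^2 ≤ Real.exp (1/10 * (p*(1-p)*n))) :
    (n.choose w : ℝ) ≤ 2 * #(univ.filter fun x : Fin n → Fin 2 => hammingNorm x = w ∧ SelfFar d x) := by
  have hu := union_count w hw hn p hp (Real.log 2) (p*(1-p)*n) (Real.log_nonneg (by norm_num))
  set μ := p*(1-p)*n with hμ
  have hμ0 : 0 ≤ μ := le_trans (Nat.cast_nonneg d) hd
  have hexp : Real.exp (Real.log 2 * μ/3 - 2/3 * μ * (1 - Real.exp (-Real.log 2))) ≤ Real.exp (-(1/10 * μ)) := by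
    apply Real.exp_le_exp.2
    rw [Real.exp_neg, Real.exp_log (by norm_num)]
    have := Real.log_two_lt_d9
    nlinarith
  have hcard : n.choose w ≤ #(univ.filter fun x : Fin n → Fin 2 => hammingNorm x = w ∧ SelfFar d x) + 
      #(univ.filter fun x : Fin n → Fin 2 => hammingNorm x = w ∧ ∃ s, 0 < s ∧ s < n ∧ (hammingDist x (cshift s x) : ℝ) ≤ μ) := by
    rw [← card_weight n w]
    refine le_trans (card_le_card ?_) (card_union_le _ _)
    intro x hx
    simp only [mem_filter, mem_univ, true_and, mem_union] at hx ⊢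
    by_cases h : SelfFar d x
    · exact Or.inl ⟨hx, h⟩
    · right
      unfold SelfFar at h
      push Not at h
      obtain ⟨s, h1, h2, h3⟩ := h
      refine ⟨hx, s, h1, h2, le_trans ?_ hd⟩
      exact_mod_cast h3.le
  have hcard' : (n.choose w : ℝ) ≤ #(univ.filter fun x : Fin n → Fin 2 => hammingNorm x = w ∧ SelfFar d x) + 
      #(univ.filter fun x : Fin n → Fin 2 => hammingNorm x = w ∧ ∃ s, 0 < s ∧ s < n ∧ (hammingDist x (cshift s x) : ℝ) ≤ μ) := by
    exact_mod_cast hcard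
  have hb : (n:ℝ) / 2 * ((n+1) * n.choose w * Real.exp (Real.log 2*μ/3 - 2/3 * μ * (1 - Real.exp (-Real.log 2)))) ≤ n.choose w / 2 := by
    calc _ ≤ (n:ℝ) / 2 * ((n+1) * n.choose w * Real.exp (-(1/10 * μ))) := by gcongr
      _ ≤ ((n:ℝ)+1) / 2 * ((n+1) * n.choose w * Real.exp (-(1/10 * μ))) := by gcongr; linarith
      _ = n.choose w / 2 * (((n:ℝ)+1)^2 * Real.exp (-(1/10 * μ))) := by ring
      _ ≤ n.choose w / 2 * (Real.exp (1/10 * μ) * Real.exp (-(1/10 * μ))) := by gcongr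
      _ = _ := by rw [← Real.exp_add]; simp
  linarith

theorem large_n (p τ : ℝ) (hp : p ∈ Set.Ioo (0 : ℝ) 1) (hτ : 0 < τ) :
    ∃ N : ℕ, ∀ n d w : ℕ, N ≤ n → 0 < n → 0 < d → (w : ℝ) = p * n →
      τ * n ≤ (d : ℝ) → (d : ℝ) ≤ p * (1 - p) * n →
      ∃ C : Finset (Fin n → Fin 2), IsHCC C ∧
        (∀ x ∈ C, hammingNorm x = w) ∧
        (∀ x ∈ C, ∀ y ∈ C, x ≠ y → d ≤ hammingDist x y) ∧
        τ / 2048 * n * (n.choose w : ℝ) / (volCW n (d - 1) w : ℝ) ≤ (C.card : ℝ) := by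
  classical
  obtain ⟨hp0, hp1⟩ := hp
  have hq : 0 < p * (1-p) := mul_pos hp0 (by linarith)
  obtain ⟨N1, hN1⟩ := ev_exp 1 2 (1/10 * (p*(1-p))) (by positivity)
  obtain ⟨N2, hN2⟩ := ev_exp 4 3 (τ/32) (by positivity)
  obtain ⟨N3, hN3⟩ := ev_exp 18 2 (τ/2) (by positivity)
  obtain ⟨N4, hN4⟩ := ev_exp 18 1 (τ/128) (by positivity)
  refine ⟨N1 + N2 + N3 + N4, fun n d w hN hn hd hw hdl hdu => ?_⟩
  have e1 := hN1 n (by omega)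
  have e2 := hN2 n (by omega)
  have e3 := hN3 n (by omega)
  have e4 := hN4 n (by omega)
  have hn' : (0:ℝ) < n := by exact_mod_cast hn
  have hw0 : 0 < w := by
    have : (0:ℝ) < w := by rw [hw]; positivity
    exact_mod_cast this
  have hwn : w < n := by
    have : (w:ℝ) < n := by rw [hw]; nlinarith
    exact_mod_cast this
  have hτ1 : τ ≤ 1 := by
    have : τ * n ≤ p * (1-p) * n := hdl.trans hdu
    have : τ ≤ p * (1-p) := le_of_mul_le_mul_right this hn'
    nlinarith [sq_nonneg (p - 1/2)]
  set δ := (d-1)/2 with hδ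
  have hnw : ((n - w : ℕ):ℝ) = (1-p) * n := by rw [Nat.cast_sub hwn.le, hw]; ring
  have hp1' : 0 < 1 - p := by linarith
  have hB : BallHyp n w δ (δ / w) (δ / (n - w : ℕ)) := by
    have hw0' : (0:ℝ) < w := by exact_mod_cast hw0
    have hnw0 : (0:ℝ) < (n - w : ℕ) := by rw [hnw]; positivity
    refine ⟨hw0, hwn, by field_simp, by field_simp, ?_⟩
    rw [hnw, hw]
    have : (δ:ℝ) / (p * n) + δ / ((1-p) * n) = δ / (p * (1-p) * n) := by
      field_simp; ring
    rw [this, div_le_iff₀ (by positivity)]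
    have h2 : 2 * δ ≤ d := by omega
    have h2' : 2 * (δ:ℝ) ≤ d := by exact_mod_cast h2
    linarith
  set V : ℝ := (volCW n (d-1) w : ℝ) with hVd
  have hδl : τ * n / 2 - 1 ≤ δ := by
    have h2 : d ≤ 2 * δ + 2 := by omega
    have h2' : (d:ℝ) ≤ 2 * δ + 2 := by exact_mod_cast h2
    linarith
  have hδ2l : τ * n / 4 - 1 ≤ (δ/2 : ℕ) := by
    have h2 : d ≤ 4 * (δ/2) + 4 := by omega
    have h2' : (d:ℝ) ≤ 4 * (δ/2 : ℕ) + 4 := by exact_mod_cast h2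
    linarith
  have he1 : Real.exp 1 ≤ 3 := by have := Real.exp_one_lt_d9; linarith
  have he2 : Real.exp 2 ≤ 9 := by
    rw [show (2:ℝ) = 1 + 1 by norm_num, Real.exp_add]
    have := Real.exp_pos 1
    nlinarith
  have hVl : 2 * Real.exp (τ/64 * n) ≤ V := by
    obtain ⟨x, hx⟩ : ∃ x : Fin n → Fin 2, hammingNorm x = w := by
      have : 0 < #(univ.filter fun x : Fin n → Fin 2 => hammingNorm x = w) := by
        rw [card_weight]; exact Nat.choose_pos hwn.le
      obtain ⟨x, hx⟩ := card_pos.1 this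
      exact ⟨x, by simpa using hx⟩
    have h1 := near_bound hB (d-1) rfl x hx 0 (Nat.zero_le _)
    have h2 : (1:ℝ) ≤ #(cwBall x w (2*0+1)) := by
      have : 0 < #(cwBall x w (2*0+1)) := card_pos.2 ⟨x, by simp [cwBall, hx]⟩
      exact_mod_cast this
    have h3 : Real.exp (2 * δ) ≤ 9 ^ δ := by
      rw [mul_comm, Real.exp_nat_mul]; gcongr
    have h4 : Real.exp (τ * n - 2) ≤ ((n:ℝ)+1)^2 * V := by
      calc Real.exp (τ * n - 2) ≤ Real.exp (2 * δ) := Real.exp_le_exp.2 (by linarith)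
        _ ≤ 1 * 9 ^ δ := by rw [one_mul]; exact h3
        _ ≤ (#(cwBall x w (2*0+1)) : ℝ) * 9^(δ - 0) := by rw [Nat.sub_zero]; exact mul_le_mul_of_nonneg_right h2 (by positivity)
        _ ≤ _ := h1
    have h5 : ((n:ℝ)+1)^2 * (2 * Real.exp (τ/64 * n)) ≤ Real.exp (τ * n - 2) := by
      have h6 : (18 * ((n:ℝ)+1)^2) * Real.exp (τ/64*n) ≤ Real.exp (τ/2 * n) * Real.exp (τ/64*n) := by gcongr
      rw [← Real.exp_add] at h6
      have h7 : Real.exp (τ/2 * n + τ/64*n) ≤ Real.exp 2 * Real.exp (τ * n - 2) := by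
        rw [← Real.exp_add]
        apply Real.exp_le_exp.2
        have : 0 < τ * n := by positivity
        linarith
      have h8 := Real.exp_pos (τ * n - 2)
      nlinarith
    exact le_of_mul_le_mul_left (h5.trans h4) (by positivity)
  have hV0 : 0 < V := lt_of_lt_of_le (by positivity) hVl
  obtain ⟨C, h1, h2, h3, h4⟩ := graph_code d w hd hB rfl (Real.exp (τ/64*n)/V) (τ/512*n) (by positivity)
    (by rw [div_le_iff₀ hV0]; linarith) (by positivity)
    (by
      rw [← hVd]
      have h34 : (3/4:ℝ)^(δ/2) ≤ 2 * Real.exp (-(τ/16*n)) := by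
        have : (3/4:ℝ) ≤ Real.exp (-(1/4)) := by have := Real.add_one_le_exp (-(1/4:ℝ)); linarith
        calc (3/4:ℝ)^(δ/2) ≤ (Real.exp (-(1/4)))^(δ/2) := by gcongr
          _ = Real.exp ((δ/2:ℕ) * (-(1/4))) := by rw [← Real.exp_nat_mul]
          _ ≤ Real.exp (1/4 + -(τ/16*n)) := Real.exp_le_exp.2 (by linarith)
          _ = Real.exp (1/4) * Real.exp (-(τ/16*n)) := Real.exp_add _ _
          _ ≤ _ := by
            gcongr
            have h := Real.exp_bound_div_one_sub_of_interval (x := 1/4) (by norm_num) (by norm_num)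
            norm_num at h ⊢; linarith
      have hsq : (Real.exp (τ/64*n))^2 = Real.exp (τ/32*n) := by
        rw [← Real.exp_nat_mul]; congr 1; push_cast; ring
      calc n * (2 * ((n:ℝ)+1)^2 * V^2 * (3/4)^(δ/2)) * (Real.exp (τ/64*n)/V)^2 
          = n * (2 * ((n:ℝ)+1)^2 * (3/4)^(δ/2)) * Real.exp (τ/32*n) := by
            rw [div_pow (Real.exp _), hsq]; field_simp
        _ ≤ ((n:ℝ)+1) * (2 * ((n:ℝ)+1)^2 * (2 * Real.exp (-(τ/16*n)))) * Real.exp (τ/32*n) := by gcongr; linarith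
        _ = (4 * ((n:ℝ)+1)^3) * (Real.exp (-(τ/16*n)) * Real.exp (τ/32*n)) := by ring
        _ ≤ Real.exp (τ/32*n) * (Real.exp (-(τ/16*n)) * Real.exp (τ/32*n)) := by gcongr
        _ = 1 := by rw [← Real.exp_add, ← Real.exp_add]; rw [Real.exp_eq_one_iff]; ring)
    (by
      rw [← hVd, mul_div_cancel₀ _ hV0.ne']
      have a1 : Real.exp (4 * (τ/512*n) + 2) ≤ 9 * Real.exp (τ/128*n) := by
        rw [Real.exp_add, mul_comm, show 4 * (τ/512*n) = τ/128*n by ring]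
        gcongr
      have a2 : 1 ≤ Real.exp (τ/128*n) := Real.one_le_exp (by positivity)
      calc τ/512*n * (1 + Real.exp (4 * (τ/512*n) + 2)) ≤ 1*(n+1) * (9 * Real.exp (τ/128*n) + 9 * Real.exp (τ/128*n)) := by
            gcongr <;> linarith
        _ = 18 * (n+1)^1 * Real.exp (τ/128*n) := by ring
        _ ≤ Real.exp (τ/128*n) * Real.exp (τ/128*n) := by gcongr
        _ = _ := by rw [← Real.exp_add]; congr 1; ring)
    (by
      refine many_good w d hwn.le hn p hw.symm hdu ?_
      rw [one_mul] at e1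
      refine e1.trans_eq ?_
      congr 1; ring)
  refine ⟨C, h1, h2, h3, ?_⟩
  rw [← hVd] at h4
  rw [div_le_iff₀ hV0]
  linarith

end Large


section Scan

def force {α : Type} (x : ℕ) (k : ℕ → α) : α :=
  Nat.rec (motive := fun _ => α) (k 0) (fun m _ => k (Nat.succ m)) x

theorem force_eq {α : Type} (x : ℕ) (k : ℕ → α) : force x k = k x := by cases x <;> rfl

/-- overlap check -/
def chk (X Y O M : ℕ) : Bool :=
  Nat.beq (Nat.land (Nat.add (Nat.mod (Nat.mul X Y) (Nat.mul 4095 O)) (Nat.mul (Nat.sub 2047 M) (Nat.div O 4096)))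
    (Nat.mul 2048 (Nat.div O 4096))) 0

def scan (T : ℕ) (hi Mf : ℕ → ℕ) (lo0 : ℕ) (fuel : ℕ) : ℕ → ℕ → ℕ → ℕ → ℕ → ℕ → Bool :=
  Nat.rec (motive := fun _ => ℕ → ℕ → ℕ → ℕ → ℕ → ℕ → Bool) (fun _ _ _ _ _ _ => true)
    (fun _ ih n t X Y O W =>
      force (Nat.mod (Nat.add (Nat.mul 1103515245 t) 12345) 2147483648) fun t' =>
      force (Bool.rec (motive := fun _ => ℕ) 0 1 (Nat.ble (Nat.div t' 32768) T)) fun e =>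
      force (Nat.add X (Nat.mul e (Nat.add (Nat.mul 4095 O) 1))) fun X' =>
      force (Nat.add (Nat.mul 4096 Y) e) fun Y' =>
      force (Nat.add (Nat.mul 4096 O) 1) fun O' =>
      force (Nat.add W e) fun W' =>
      force (Nat.succ n) fun n' =>
      cond (cond (Nat.ble lo0 n') (cond (Nat.ble (hi n') W') (cond (Nat.ble W' 2048) (chk X' Y' O' (Mf n')) false) false) true)
        (ih n' t' X' Y' O' W') false) fuel

def GoodM (n w M : ℕ) : Prop := ∃ A : Finset ℕ, A ⊆ range n ∧ #A = w ∧
  ∀ s, 0 < s → s < n → #(A.filter fun j => (j + s) % n ∈ A) ≤ M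

theorem GoodM.mono {n w w' M : ℕ} (h : GoodM n w M) (hw : w' ≤ w) : GoodM n w' M := by
  obtain ⟨A, hA, hc, hs⟩ := h
  obtain ⟨A', h1, h2⟩ := exists_subset_card_eq (hc ▸ hw : w' ≤ #A)
  refine ⟨A', h1.trans hA, h2, fun s h0 hn => le_trans (card_le_card ?_) (hs s h0 hn)⟩
  intro j hj
  rw [mem_filter] at hj ⊢
  exact ⟨h1 hj.1, h1 hj.2⟩

def ScInv (n X Y O W : ℕ) : Prop := ∃ A : Finset ℕ, A ⊆ range n ∧ X = ∑ j ∈ A, 4096 ^ j ∧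
  Y = ∑ j ∈ A, 4096 ^ (n - 1 - j) ∧ O = ∑ t ∈ range n, 4096 ^ t ∧ W = #A

theorem ones_eq (n : ℕ) : 4095 * (∑ t ∈ range n, 4096 ^ t) + 1 = 4096 ^ n := by
  induction n with
  | zero => simp
  | succ k ih => rw [sum_range_succ, mul_add, pow_succ]; omega

theorem ScInv.step0 {n X Y O W : ℕ} (h : ScInv n X Y O W) : ScInv (n+1) X (4096 * Y) (4096 * O + 1) W := by
  obtain ⟨A, hA, rfl, rfl, rfl, rfl⟩ := h
  refine ⟨A, hA.trans (by simp), rfl, ?_, ?_, rfl⟩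
  · rw [mul_sum]
    refine sum_congr rfl fun j hj => ?_
    have := mem_range.1 (hA hj)
    rw [← pow_succ']
    congr 1; omega
  · rw [sum_range_succ', mul_sum]
    simp [pow_succ, mul_comm]

theorem ScInv.step1 {n X Y O W : ℕ} (h : ScInv n X Y O W) :
    ScInv (n+1) (X + (4095 * O + 1)) (4096 * Y + 1) (4096 * O + 1) (W+1) := by
  have h0 := h
  obtain ⟨A, hA, rfl, rfl, rfl, rfl⟩ := h
  have hn : n ∉ A := fun hh => by have := mem_range.1 (hA hh); omega
  refine ⟨insert n A, ?_, ?_, ?_, ?_, ?_⟩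
  · intro j hj
    rw [mem_insert] at hj
    rcases hj with rfl | hj
    · simp
    · have := mem_range.1 (hA hj); rw [mem_range]; omega
  · rw [sum_insert hn, ones_eq, add_comm]
  · rw [sum_insert hn, mul_sum, add_comm]
    congr 1
    · simp
    · refine sum_congr rfl fun j hj => ?_
      have := mem_range.1 (hA hj)
      rw [← pow_succ']
      congr 1; omega
  · rw [sum_range_succ', mul_sum]
    simp [pow_succ, mul_comm]
  · rw [card_insert_of_notMem hn]

theorem digit_eq (m : ℕ) : ∀ (c : ℕ → ℕ) (_ : ∀ t, c t < 4096) (t : ℕ) (_ : t < m),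
    (∑ i ∈ range m, c i * 4096 ^ i) / 4096 ^ t % 4096 = c t := by
  induction m with
  | zero => intro c _ t ht; omega
  | succ k ih =>
    intro c hc t ht
    have e : ∑ i ∈ range (k+1), c i * 4096 ^ i = c 0 + 4096 * ∑ i ∈ range k, c (i+1) * 4096 ^ i := by
      rw [sum_range_succ', mul_sum, add_comm]
      congr 1
      · simp
      · exact sum_congr rfl fun i _ => by ring
    rw [e]
    cases t with
    | zero => 
      have := hc 0
      rw [pow_zero, Nat.div_one]; omega
    | succ s =>
      have h1 := hc 0
      rw [pow_succ', ← Nat.div_div_eq_div_mul]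
      have : (c 0 + 4096 * ∑ i ∈ range k, c (i+1) * 4096 ^ i) / 4096 = ∑ i ∈ range k, c (i+1) * 4096 ^ i := by omega
      rw [this]
      exact ih (fun i => c (i+1)) (fun i => hc _) s (by omega)

theorem digit_bit (m : ℕ) (c : ℕ → ℕ) (hc : ∀ t, c t < 4096) (t : ℕ) (ht : t < m) :
    (∑ i ∈ range m, c i * 4096 ^ i).testBit (12 * t + 11) = decide (2048 ≤ c t) := by
  have h := digit_eq m c hc t ht
  set N := ∑ i ∈ range m, c i * 4096 ^ i
  rw [Nat.testBit_eq_decide_div_mod_eq, pow_add, pow_mul, ← Nat.div_div_eq_div_mul]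
  have : (2:ℕ)^12 = 4096 := by norm_num
  rw [this]
  have := hc t
  apply decide_eq_decide.2
  norm_num
  omega

theorem chk_sound {n X Y O W M : ℕ} (h : ScInv n X Y O W) (hW : W ≤ 2048) (hc : chk X Y O M = true) : GoodM n W M := by
  obtain ⟨A, hA, rfl, rfl, rfl, rfl⟩ := h
  refine ⟨A, hA, rfl, fun s hs hsn => ?_⟩
  by_cases hM : 2048 ≤ M
  · exact (card_filter_le _ _).trans (hW.trans hM)
  let o : ℕ → ℕ := fun t => #((A ×ˢ A).filter fun q => (q.1 + (n - 1 - q.2)) % n = t)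
  have hn : 0 < n := by omega
  have ho : ∀ t, o t ≤ #A := by
    intro t
    refine card_le_card_of_injOn (fun q => q.1) ?_ ?_
    · intro q hq
      simp only [coe_filter, Set.mem_ofPred_eq, mem_product] at hq
      exact hq.1.1
    · rintro ⟨i, j⟩ hq ⟨i', j'⟩ hq' heq
      simp only [coe_filter, Set.mem_ofPred_eq, mem_product] at hq hq' heq
      subst heq
      have h1 := mem_range.1 (hA hq.1.2)
      have h2 := mem_range.1 (hA hq'.1.2)
      have h3 : (i + (n-1-j)) ≡ (i + (n-1-j')) [MOD n] := hq.2.trans hq'.2.symm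
      have h4 := Nat.ModEq.add_left_cancel' _ h3
      have h5 := Nat.ModEq.eq_of_lt_of_lt h4 (by omega) (by omega)
      congr 1; omega
  have hlow : #(A.filter fun j => (j + s) % n ∈ A) ≤ o (s - 1) := by
    refine card_le_card_of_injOn (fun j => ((j+s)%n, j)) ?_ ?_
    · intro j hj
      simp only [coe_filter, Set.mem_ofPred_eq, mem_product] at hj ⊢
      refine ⟨⟨hj.2, hj.1⟩, ?_⟩
      have := mem_range.1 (hA hj.1)
      rw [Nat.mod_add_mod]
      have : j + s + (n - 1 - j) = (s - 1) + n := by omega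
      rw [this, Nat.add_mod_right, Nat.mod_eq_of_lt (by omega)]
    · intro j _ j' _ heq
      simp only [Prod.mk.injEq] at heq
      exact heq.2
  have hmod : (∑ j ∈ A, 4096 ^ j) * (∑ j ∈ A, 4096 ^ (n-1-j)) ≡ ∑ t ∈ range n, o t * 4096 ^ t
      [MOD 4095 * (∑ t ∈ range n, 4096 ^ t)] := by
    have e1 : (∑ j ∈ A, 4096 ^ j) * (∑ j ∈ A, 4096 ^ (n-1-j)) = ∑ q ∈ A ×ˢ A, 4096 ^ (q.1 + (n - 1 - q.2)) := by
      rw [sum_mul_sum, sum_product]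
      exact sum_congr rfl fun i _ => sum_congr rfl fun j _ => by rw [pow_add]
    have e2 : ∑ t ∈ range n, o t * 4096 ^ t = ∑ q ∈ A ×ˢ A, 4096 ^ ((q.1 + (n - 1 - q.2)) % n) := by
      rw [← sum_fiberwise_of_maps_to (s := A ×ˢ A) (t := range n) (g := fun q => (q.1 + (n - 1 - q.2)) % n)
        (fun q _ => mem_range.2 (Nat.mod_lt _ hn))]
      refine sum_congr rfl fun t _ => ?_
      rw [sum_congr rfl (g := fun _ => 4096 ^ t), sum_const, smul_eq_mul]
      intro q hq
      rw [(mem_filter.1 hq).2]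
    rw [e1, e2]
    have h1 : 4096 ^ n ≡ 1 [MOD 4095 * (∑ t ∈ range n, 4096 ^ t)] := by
      rw [← ones_eq n]
      simp [Nat.ModEq]
    have h2 : ∀ k, 4096 ^ k ≡ 4096 ^ (k % n) [MOD 4095 * (∑ t ∈ range n, 4096 ^ t)] := by
      intro k
      conv_lhs => rw [← Nat.mod_add_div k n, pow_add, pow_mul]
      have := (h1.pow (k / n)).mul_left (4096 ^ (k % n))
      simpa using this
    exact Nat.ModEq.sum fun q _ => h2 _
  have hpos : 0 < ∑ t ∈ range n, 4096 ^ t := sum_pos (fun _ _ => by positivity) ⟨0, mem_range.2 hn⟩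
  have hlt : ∑ t ∈ range n, o t * 4096 ^ t < 4095 * (∑ t ∈ range n, 4096 ^ t) := by
    have : ∑ t ∈ range n, o t * 4096 ^ t ≤ 2048 * (∑ t ∈ range n, 4096 ^ t) := by
      rw [mul_sum]
      exact sum_le_sum fun t _ => Nat.mul_le_mul_right _ ((ho t).trans hW)
    omega
  have hR : ((∑ j ∈ A, 4096 ^ j) * (∑ j ∈ A, 4096 ^ (n-1-j))) % (4095 * (∑ t ∈ range n, 4096 ^ t))
      = ∑ t ∈ range n, o t * 4096 ^ t := by
    rw [hmod, Nat.mod_eq_of_lt hlt]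
  obtain ⟨m, rfl⟩ : ∃ m, n = m + 1 := ⟨n-1, by omega⟩
  have hdiv : (∑ t ∈ range (m+1), 4096 ^ t) / 4096 = ∑ t ∈ range m, 4096 ^ t := by
    rw [sum_range_succ']
    simp only [pow_succ, ← sum_mul]
    omega
  have hc' := Nat.eq_of_beq_eq_true hc
  change Nat.land (((∑ j ∈ A, 4096 ^ j) * (∑ j ∈ A, 4096 ^ (m+1-1-j))) % (4095 * (∑ t ∈ range (m+1), 4096 ^ t)) +
    (2047 - M) * ((∑ t ∈ range (m+1), 4096 ^ t) / 4096)) (2048 * ((∑ t ∈ range (m+1), 4096 ^ t) / 4096)) = 0 at hc'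
  rw [hR, hdiv] at hc'
  have hs1 : ∑ t ∈ range (m+1), o t * 4096 ^ t + (2047 - M) * ∑ t ∈ range m, 4096 ^ t
      = ∑ t ∈ range (m+1), (o t + if t < m then 2047 - M else 0) * 4096 ^ t := by
    rw [sum_range_succ, sum_range_succ, mul_sum, add_right_comm, ← sum_add_distrib]
    congr 1
    · refine sum_congr rfl fun t ht => ?_
      rw [if_pos (mem_range.1 ht)]; ring
    · simp
  have hs2 : 2048 * ∑ t ∈ range m, 4096 ^ t = ∑ t ∈ range m, (fun _ => 2048) t * 4096 ^ t := by
    rw [mul_sum]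
  rw [hs1, hs2] at hc'
  have hb := congrArg (fun z => Nat.testBit z (12 * (s-1) + 11)) hc'
  simp only at hb
  have hb' := Nat.testBit_and (∑ t ∈ range (m+1), (o t + if t < m then 2047 - M else 0) * 4096 ^ t)
    (∑ t ∈ range m, (fun _ => 2048) t * 4096 ^ t) (12 * (s-1) + 11)
  rw [digit_bit (m+1) (fun t => o t + if t < m then 2047 - M else 0) ?_ (s-1) (by omega),
    digit_bit m (fun _ => 2048) (fun _ => by norm_num) (s-1) (by omega)] at hb'
  · have := hb'.symm.trans hb
    simp only [Nat.zero_testBit, le_refl, decide_true, Bool.and_true, decide_eq_false_iff_not] at this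
    rw [if_pos (by omega)] at this
    omega
  · intro t
    have := ho t
    split_ifs <;> omega

theorem scan_succ (T : ℕ) (hi Mf : ℕ → ℕ) (lo0 f n t X Y O W : ℕ) :
    scan T hi Mf lo0 (f+1) n t X Y O W =
      force (Nat.mod (Nat.add (Nat.mul 1103515245 t) 12345) 2147483648) fun t' =>
      force (Bool.rec (motive := fun _ => ℕ) 0 1 (Nat.ble (Nat.div t' 32768) T)) fun e =>
      force (Nat.add X (Nat.mul e (Nat.add (Nat.mul 4095 O) 1))) fun X' =>
      force (Nat.add (Nat.mul 4096 Y) e) fun Y' =>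
      force (Nat.add (Nat.mul 4096 O) 1) fun O' =>
      force (Nat.add W e) fun W' =>
      force (Nat.succ n) fun n' =>
      cond (cond (Nat.ble lo0 n') (cond (Nat.ble (hi n') W') (cond (Nat.ble W' 2048) (chk X' Y' O' (Mf n')) false) false) true)
        (scan T hi Mf lo0 f n' t' X' Y' O' W') false := rfl

theorem scan_sound (T : ℕ) (hi Mf : ℕ → ℕ) (lo0 : ℕ) (fuel : ℕ) : ∀ (n t X Y O W : ℕ), ScInv n X Y O W →
    scan T hi Mf lo0 fuel n t X Y O W = true →
    ∀ m, lo0 ≤ m → n < m → m ≤ n + fuel → GoodM m (hi m) (Mf m) := by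
  induction fuel with
  | zero => intros; omega
  | succ f ih =>
    intro n t X Y O W hI hs m h0 h1 h2
    rw [scan_succ] at hs
    simp only [force_eq] at hs
    rw [Bool.cond_false_right, Bool.and_eq_true] at hs
    obtain ⟨hs1, hs2⟩ := hs
    generalize Nat.ble _ T = bb at hs1 hs2
    obtain ⟨e, he⟩ : ∃ e : ℕ, e = Bool.rec (motive := fun _ => ℕ) 0 1 bb := ⟨_, rfl⟩
    rw [← he] at hs1 hs2
    have hI' : ScInv (n+1) (X + e * (4095 * O + 1)) (4096 * Y + e) (4096 * O + 1) (W + e) := by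
      cases bb
      · subst he; simpa using hI.step0
      · subst he; simpa using hI.step1
    by_cases hm : m = n + 1
    · subst hm
      rw [show Nat.ble lo0 (Nat.succ n) = true from Nat.ble_eq_true_of_le h0] at hs1
      simp only [cond_true, Bool.cond_false_right, Bool.and_eq_true] at hs1
      obtain ⟨h3, h4, h5⟩ := hs1
      exact (chk_sound hI' (Nat.le_of_ble_eq_true h4) h5).mono (Nat.le_of_ble_eq_true h3)
    · exact ih _ _ _ _ _ _ hI' hs2 m h0 (by omega) (by omega)

theorem ScInv.init : ScInv 0 0 0 0 0 := ⟨∅, by simp⟩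

theorem scan_good {T : ℕ} {hi Mf : ℕ → ℕ} {lo0 fuel seed : ℕ} (hf : 0 < lo0)
    (h : scan T hi Mf lo0 fuel 0 seed 0 0 0 0 = true) (m : ℕ) (h0 : lo0 ≤ m) (h1 : m ≤ fuel) :
    GoodM m (hi m) (Mf m) :=
  scan_sound T hi Mf lo0 fuel 0 seed 0 0 0 0 ScInv.init h m h0 (by omega) (by omega)

end Scan


section Tables

def MM (lo n : ℕ) : ℕ := Nat.div (Nat.add (Nat.add (Nat.mul lo lo) (Nat.mul lo n)) n) (Nat.mul 2 n)

def tsc (L R b b2 seed T : ℕ) : Bool :=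
  scan T (fun n => Nat.div (Nat.mul b n) 1000) (fun n => MM (Nat.div (Nat.mul b2 n) 1000) n) L R 0 seed 0 0 0 0

def chain (n : ℕ) : List (ℕ × ℕ) → ℕ → Bool
  | [], cur => Nat.ble (Nat.succ (Nat.mul 8 cur)) n
  | q :: l, cur => cond (force (Nat.div (Nat.mul 65536 cur) n) fun T => force (MM q.2 n) fun M =>
      scan T (fun _ => cur) (fun _ => M) n n 0 q.1 0 0 0 0) (force (Nat.sub q.2 1) fun c => chain n l c) false

def allc : ℕ → List (List (ℕ × ℕ)) → Bool
  | _, [] => true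
  | n, l :: ls => cond (force (Nat.div n 2) fun c => chain n l c) (force (Nat.succ n) fun n' => allc n' ls) false

def qall : ℕ → List ℕ → Bool
  | _, [] => true
  | w, s :: l => cond (scan 16384 (fun _ => w) (fun _ => Nat.div (Nat.succ w) 2) (Nat.mul 4 w) (Nat.mul 4 w) 0 s 0 0 0 0)
      (force (Nat.succ w) fun w' => qall w' l) false

def CovM (n w : ℕ) : Prop := ∃ M, GoodM n w M ∧ 2 * M * n ≤ w * n + w * w + n

theorem covM_of {n hi lo w : ℕ} (h : GoodM n hi (MM lo n)) (hl : lo ≤ w) (hh : w ≤ hi) : CovM n w := by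
  refine ⟨_, h.mono hh, ?_⟩
  have h1 : MM lo n * (2 * n) ≤ lo * lo + lo * n + n := Nat.div_mul_le_self _ _
  have h2 : lo * lo ≤ w * w := Nat.mul_le_mul hl hl
  have h3 : lo * n ≤ w * n := Nat.mul_le_mul_right n hl
  nlinarith

theorem tsc_cov {L R b b2 seed T : ℕ} (h : tsc L R b b2 seed T = true) (hL : 0 < L) (n w : ℕ) (h0 : L ≤ n) (h1 : n ≤ R)
    (h2 : b2 * n / 1000 ≤ w) (h3 : w ≤ b * n / 1000) : CovM n w :=
  covM_of (hi := b * n / 1000) (scan_good hL h n h0 h1) h2 h3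

theorem chain_cov {n : ℕ} (hn : 0 < n) (l : List (ℕ × ℕ)) : ∀ cur, chain n l cur = true → ∀ w, n ≤ 8 * w → w ≤ cur → CovM n w := by
  induction l with
  | nil =>
    intro cur h w h1 h2
    have := Nat.le_of_ble_eq_true h
    change 8 * cur + 1 ≤ n at this
    omega
  | cons q l ih =>
    intro cur h w h1 h2
    unfold chain at h
    simp only [force_eq, Bool.cond_false_right, Bool.and_eq_true] at h
    by_cases hw : q.2 ≤ w
    · exact covM_of (scan_good hn h.1 n le_rfl le_rfl) hw h2
    · exact ih _ h.2 w h1 (by change w ≤ q.2 - 1; omega)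

theorem allc_cov (ls : List (List (ℕ × ℕ))) : ∀ n0, 0 < n0 → allc n0 ls = true → ∀ n w, n0 ≤ n → n < n0 + ls.length →
    n ≤ 8 * w → 2 * w ≤ n → CovM n w := by
  induction ls with
  | nil => intro n0 _ _ n w h1 h2; simp at h2; omega
  | cons l ls ih =>
    intro n0 hn0 h n w h1 h2 h3 h4
    unfold allc at h
    simp only [force_eq, Bool.cond_false_right, Bool.and_eq_true] at h
    rw [List.length_cons] at h2
    by_cases hn : n = n0
    · subst hn
      exact chain_cov hn0 l _ h.1 w h3 (by change w ≤ n / 2; omega)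
    · exact ih _ (by omega) h.2 n w (by change n0 + 1 ≤ n; omega) (by change n < n0 + 1 + _; omega) h3 h4

theorem qall_good (l : List ℕ) : ∀ w0, 0 < w0 → qall w0 l = true → ∀ w, w0 ≤ w → w < w0 + l.length →
    GoodM (4 * w) w ((w + 1) / 2) := by
  induction l with
  | nil => intro n0 _ _ w h1 h2; simp at h2; omega
  | cons s l ih =>
    intro n0 hn0 h w h1 h2
    unfold qall at h
    simp only [force_eq, Bool.cond_false_right, Bool.and_eq_true] at h
    rw [List.length_cons] at h2
    by_cases hn : w = n0
    · subst hn
      exact scan_good (by change 0 < 4 * w; omega) h.1 (4 * w) le_rfl le_rfl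
    · exact ih _ (by omega) h.2 w (by change n0 + 1 ≤ w; omega) (by change w < n0 + 1 + _; omega)

theorem cov_small (n w : ℕ) (h1 : 2 ≤ n) (h2 : n < 100) (h3 : n ≤ 8 * w) (h4 : 2 * w ≤ n) : CovM n w := by
  have h : allc 2 [
    [(37,1)], [(188,1)], [(5,1)], [(7,1)], [(1,3),(2,1)], [(2,1)], [(1,3),(3,1)], [(1,3),(8,1)], [(8,4),(8,1)],
    [(188,3),(8,1)], [(10,4),(11,1)], [(7,4),(9,1)], [(3,6),(9,3),(6,1)], [(1304,4),(19,1)], [(3,6),(14,3),(7,1)],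
    [(9,6),(12,3)], [(7,7),(176,3)], [(1,7),(24,3)], [(40,8),(1,5),(8,3)], [(120,7),(36,3)], [(33,9),(333,5),(7,1)],
    [(14,9),(118,5),(7,3)], [(840,9),(116,5),(7,3)], [(745,9),(116,5),(7,3)], [(57,10),(1,6),(7,3)],
    [(37,10),(886,5),(7,1)], [(13,11),(28,6),(7,1)], [(14,11),(70,6),(7,1)], [(280,11),(20,6),(3,3)],
    [(120,12),(7,8),(52,3)], [(42,13),(481,8),(59,3)], [(7,13),(176,8),(10,5)], [(50,14),(30,9),(26,5)],
    [(120,13),(7,8),(13,5)], [(37,14),(20,9),(10,5)], [(94,14),(1036,8),(8,5)], [(44,16),(99,11),(95,5)],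
    [(913,14),(26,8),(7,5)], [(124,16),(9,11),(349,5)], [(19,16),(9,10),(45,5)], [(1011,16),(52,10),(39,5)],
    [(1090,16),(290,10),(13,5)], [(44,17),(19,11),(106,5)], [(488,17),(26,11),(39,5)], [(101,18),(15,12),(37,7),(3,3)],
    [(1972,17),(1240,10),(7,5)], [(1844,19),(15,12),(1711,5)], [(1290,19),(7,13),(26,7)], [(34,20),(19,14),(52,8),(3,5)],
    [(1449,19),(24,13),(44,7)], [(1026,20),(1292,13),(6,7)], [(1237,20),(503,13),(7,7)], [(348,21),(277,14),(1016,7)],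
    [(39,21),(9,14),(357,7)], [(348,23),(1677,15),(126,8),(7,5)], [(264,22),(15,14),(23,8)], [(250,23),(30,16),(276,8)],
    [(24,23),(242,16),(464,8)], [(82,24),(52,17),(10,10),(7,7)], [(38,24),(23,17),(43,10),(3,5)], [(568,24),(594,16),(233,8)],
    [(232,24),(143,16),(50,8)], [(1653,24),(254,16),(77,8)], [(47,26),(1342,17),(129,9)], [(45,27),(240,19),(126,12),(3,7)],
    [(78,26),(1036,17),(47,9)], [(344,27),(231,19),(77,10),(3,5)], [(283,27),(105,19),(160,10),(3,5)],
    [(1106,27),(123,19),(47,10),(3,5)], [(1167,27),(1036,17),(125,9)], [(186,29),(259,20),(119,12),(3,7)],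
    [(124,29),(30,20),(47,12),(9,10)], [(64,30),(112,22),(7,13),(7,7)], [(437,29),(80,20),(1743,10)],
    [(1035,30),(1357,20),(47,12),(7,7)], [(259,30),(361,20),(1990,10)], [(112,31),(52,22),(9,13),(15,10)],
    [(78,31),(80,22),(21,13),(7,5)], [(106,33),(226,23),(168,13),(7,7)], [(361,32),(1488,22),(119,12),(9,10)],
    [(1193,33),(498,23),(897,13),(11,10)], [(555,33),(44,23),(46,13),(7,7)], [(1220,33),(304,23),(46,13),(7,7)],
    [(32,34),(1274,23),(119,14),(7,7)], [(24,34),(383,23),(231,14),(7,9)], [(134,34),(226,23),(1756,12),(7,5)],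
    [(106,36),(136,26),(63,17),(15,10)], [(2000,35),(26,25),(1733,14),(9,10)], [(313,36),(136,25),(1318,14),(9,10)],
    [(831,36),(1206,25),(1892,14),(31,7)], [(106,37),(138,26),(94,15),(6,9)], [(624,36),(1183,25),(664,14),(9,10)],
    [(283,37),(160,26),(170,15),(9,12)], [(643,37),(613,25),(433,14),(9,12)], [(763,38),(32,26),(215,15),(7,9)],
    [(27,39),(124,28),(26,17),(9,12)], [(106,39),(160,28),(252,17),(9,10)], [(283,39),(431,27),(310,15),(9,10)]] = true := by decide +kernel
    
  exact allc_cov _ 2 (by norm_num) h n w h1 (by simpa using h2) h3 h4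

theorem quart_small (w : ℕ) (h1 : 1 ≤ w) (h2 : w < 25) : GoodM (4 * w) w ((w + 1) / 2) := by
  have h : qall 1 [1, 3, 8, 1, 1, 1, 7, 10, 4, 11, 26, 3, 2, 2, 3, 3, 3, 2, 2, 2, 2, 2, 3, 2] = true := by decide +kernel
  exact qall_good _ 1 (by norm_num) h w h1 (by simpa using h2)

theorem quart_scan : scan 17250 (fun n => Nat.div n 4) (fun n => Nat.div (Nat.succ (Nat.div n 4)) 2) 100 2399 0 11 0 0 0 0 = true := by
  decide +kernel

theorem quart_mid (w : ℕ) (h1 : 25 ≤ w) (h2 : w < 600) : GoodM (4 * w) w ((w + 1) / 2) := by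
  have h := scan_good (by norm_num) quart_scan (4 * w) (by omega) (by omega)
  have e : Nat.div (4 * w) 4 = w := by change 4 * w / 4 = w; omega
  simp only [e] at h
  exact h

theorem tier_1 : tsc 100 199 500 455 1 32450 = true := by decide +kernel
theorem tier_2 : tsc 100 199 455 395 145 30620 = true := by decide +kernel
theorem tier_3 : tsc 100 199 395 330 13 26630 = true := by decide +kernel
theorem tier_4 : tsc 100 199 330 265 286 21120 = true := by decide +kernel
theorem tier_5 : tsc 100 199 265 205 131 18760 = true := by decide +kernel
theorem tier_6 : tsc 100 199 205 150 35 14170 = true := by decide +kernel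
theorem tier_7 : tsc 100 199 150 125 1 13200 = true := by decide +kernel
theorem tier_8 : tsc 200 399 500 440 10 32450 = true := by decide +kernel
theorem tier_9 : tsc 200 399 440 370 109 29210 = true := by decide +kernel
theorem tier_10 : tsc 200 399 370 295 352 25480 = true := by decide +kernel
theorem tier_11 : tsc 200 399 295 220 279 19780 = true := by decide +kernel
theorem tier_12 : tsc 200 399 220 150 295 14530 = true := by decide +kernel
theorem tier_13 : tsc 200 399 150 125 2 9600 = true := by decide +kernel
theorem tier_14 : tsc 400 799 500 420 184 32900 = true := by decide +kernel
theorem tier_15 : tsc 400 799 420 335 191 28830 = true := by decide +kernel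
theorem tier_16 : tsc 400 799 335 250 31 22340 = true := by decide +kernel
theorem tier_17 : tsc 400 799 250 170 42 17350 = true := by decide +kernel
theorem tier_18 : tsc 400 799 170 125 1 11630 = true := by decide +kernel
theorem tier_19 : tsc 800 1499 500 410 15 34250 = true := by decide +kernel
theorem tier_20 : tsc 800 1499 410 310 43 28190 = true := by decide +kernel
theorem tier_21 : tsc 800 1499 310 210 43 21340 = true := by decide +kernel
theorem tier_22 : tsc 800 1499 210 125 3 13890 = true := by decide +kernel

theorem cov_mid (n w : ℕ) (h1 : 100 ≤ n) (h2 : n < 1500) (h3 : n ≤ 8 * w) (h4 : 2 * w ≤ n) : CovM n w := by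
  by_cases a0 : n ≤ 199
  · by_cases c1 : 455 * n / 1000 ≤ w
    · exact tsc_cov tier_1 (by norm_num) n w (by omega) (by omega) (by omega) (by omega)
    by_cases c2 : 395 * n / 1000 ≤ w
    · exact tsc_cov tier_2 (by norm_num) n w (by omega) (by omega) (by omega) (by omega)
    by_cases c3 : 330 * n / 1000 ≤ w
    · exact tsc_cov tier_3 (by norm_num) n w (by omega) (by omega) (by omega) (by omega)
    by_cases c4 : 265 * n / 1000 ≤ w
    · exact tsc_cov tier_4 (by norm_num) n w (by omega) (by omega) (by omega) (by omega)
    by_cases c5 : 205 * n / 1000 ≤ w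
    · exact tsc_cov tier_5 (by norm_num) n w (by omega) (by omega) (by omega) (by omega)
    by_cases c6 : 150 * n / 1000 ≤ w
    · exact tsc_cov tier_6 (by norm_num) n w (by omega) (by omega) (by omega) (by omega)
    exact tsc_cov tier_7 (by norm_num) n w (by omega) (by omega) (by omega) (by omega)
  by_cases a1 : n ≤ 399
  · by_cases c8 : 440 * n / 1000 ≤ w
    · exact tsc_cov tier_8 (by norm_num) n w (by omega) (by omega) (by omega) (by omega)
    by_cases c9 : 370 * n / 1000 ≤ w
    · exact tsc_cov tier_9 (by norm_num) n w (by omega) (by omega) (by omega) (by omega)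
    by_cases c10 : 295 * n / 1000 ≤ w
    · exact tsc_cov tier_10 (by norm_num) n w (by omega) (by omega) (by omega) (by omega)
    by_cases c11 : 220 * n / 1000 ≤ w
    · exact tsc_cov tier_11 (by norm_num) n w (by omega) (by omega) (by omega) (by omega)
    by_cases c12 : 150 * n / 1000 ≤ w
    · exact tsc_cov tier_12 (by norm_num) n w (by omega) (by omega) (by omega) (by omega)
    exact tsc_cov tier_13 (by norm_num) n w (by omega) (by omega) (by omega) (by omega)
  by_cases a2 : n ≤ 799
  · by_cases c14 : 420 * n / 1000 ≤ w
    · exact tsc_cov tier_14 (by norm_num) n w (by omega) (by omega) (by omega) (by omega)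
    by_cases c15 : 335 * n / 1000 ≤ w
    · exact tsc_cov tier_15 (by norm_num) n w (by omega) (by omega) (by omega) (by omega)
    by_cases c16 : 250 * n / 1000 ≤ w
    · exact tsc_cov tier_16 (by norm_num) n w (by omega) (by omega) (by omega) (by omega)
    by_cases c17 : 170 * n / 1000 ≤ w
    · exact tsc_cov tier_17 (by norm_num) n w (by omega) (by omega) (by omega) (by omega)
    exact tsc_cov tier_18 (by norm_num) n w (by omega) (by omega) (by omega) (by omega)
  by_cases c19 : 410 * n / 1000 ≤ w
  · exact tsc_cov tier_19 (by norm_num) n w (by omega) (by omega) (by omega) (by omega)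
  by_cases c20 : 310 * n / 1000 ≤ w
  · exact tsc_cov tier_20 (by norm_num) n w (by omega) (by omega) (by omega) (by omega)
  by_cases c21 : 210 * n / 1000 ≤ w
  · exact tsc_cov tier_21 (by norm_num) n w (by omega) (by omega) (by omega) (by omega)
  exact tsc_cov tier_22 (by norm_num) n w (by omega) (by omega) (by omega) (by omega)

end Tables


section Existence

def CovW (n w : ℕ) : Prop := ∀ d, d * n < w * (n - w) → ∃ x : Fin n → Fin 2, hammingNorm x = w ∧ SelfFar d x

theorem word_of_goodM {n w M : ℕ} (h : GoodM n w M) : ∃ x : Fin n → Fin 2, hammingNorm x = w ∧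
    ∀ s, 0 < s → s < n → cnt x (cshift s x) 1 1 ≤ M := by
  obtain ⟨A, hA, hc, hs⟩ := h
  refine ⟨fun j => if j.1 ∈ A then 1 else 0, ?_, fun s h0 h1 => le_trans ?_ (hs s h0 h1)⟩
  · rw [← hc, hammingNorm]
    refine card_bij (fun j _ => j.1) ?_ (fun a _ b _ h => Fin.ext h) ?_
    · intro j hj
      simpa using hj
    · intro j hj
      exact ⟨⟨j, mem_range.1 (hA hj)⟩, by simpa using hj, rfl⟩
  · unfold cnt
    refine card_le_card_of_injOn (fun j => j.1) ?_ (fun a _ b _ h => Fin.ext h)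
    intro j hj
    simpa [cshift] using hj

theorem goodM_of_word {n w M : ℕ} (x : Fin n → Fin 2) (hx : hammingNorm x = w)
    (h : ∀ s, 0 < s → s < n → cnt x (cshift s x) 1 1 ≤ M) : GoodM n w M := by
  have h2 : ∀ a : Fin 2, a ≠ 0 ↔ a = 1 := by decide
  refine ⟨(univ.filter fun j => x j = 1).image (fun j => j.1), ?_, ?_, fun s h0 h1 => le_trans ?_ (h s h0 h1)⟩
  · intro j hj
    simp only [mem_image] at hj
    obtain ⟨i, _, rfl⟩ := hj
    simp
  · rw [card_image_of_injective _ Fin.val_injective, ← hx, hammingNorm]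
    congr 1
    ext j
    simp [h2]
  · rw [cnt]
    rw [← card_image_of_injective (univ.filter fun j => x j = 1 ∧ cshift s x j = 1) Fin.val_injective]
    apply card_le_card
    intro j hj
    simp only [mem_filter, mem_image, mem_univ, true_and] at hj ⊢
    obtain ⟨⟨i, hi, rfl⟩, k, hk, hki⟩ := hj
    refine ⟨i, ⟨hi, ?_⟩, rfl⟩
    rw [← hk, cshift]
    congr 1
    exact Fin.ext hki.symm

theorem covW_of_covM {n w : ℕ} (hw : w ≤ n) (h : CovM n w) : CovW n w := by
  obtain ⟨M, hM, hb⟩ := h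
  intro d hd
  obtain ⟨x, hx, hs⟩ := word_of_goodM hM
  refine ⟨x, hx, fun s h0 h1 => ?_⟩
  obtain ⟨a1, a2, a3, -⟩ := cnt_facts x (cshift s x)
  rw [norm_cshift] at a2
  have h3 := hs s h0 h1
  have hn : 0 < n := by omega
  have h4 : 2 * w ≤ hammingDist x (cshift s x) + 2 * M := by omega
  obtain ⟨k, rfl⟩ := Nat.exists_eq_add_of_le hw
  rw [Nat.add_sub_cancel_left] at hd
  by_contra hlt
  push Not at hlt
  have h5 : 2 * w + 1 ≤ d + 2 * M := by omega
  have h6 := Nat.mul_le_mul_right (w + k) h5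
  nlinarith

theorem covW_compl {n w : ℕ} (hw : w ≤ n) (h : CovW n (n - w)) : CovW n w := by
  intro d hd
  obtain ⟨x, hx, hs⟩ := h d (by rw [Nat.sub_sub_self hw, mul_comm (n - w)]; exact hd)
  refine ⟨fun j => x j + 1, ?_, fun s h0 h1 => ?_⟩
  · have e : hammingNorm (fun j => x j + 1) + hammingNorm x = n := by
      rw [hammingNorm, hammingNorm, card_filter, card_filter, ← sum_add_distrib]
      have : ∀ a : Fin 2, ((if a + 1 ≠ 0 then 1 else 0) + if a ≠ 0 then 1 else 0) = 1 := by decide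
      rw [sum_congr rfl fun j _ => this (x j)]
      simp
    omega
  · refine le_trans (hs s h0 h1) (le_of_eq ?_)
    rw [hammingDist, hammingDist]
    congr 1
    ext j
    rw [mem_filter, mem_filter]
    simp [cshift]

theorem GoodM.pad {n n' w M : ℕ} (h : GoodM n' w M) (hn : 2 * n' ≤ n) : GoodM n w M := by
  obtain ⟨A, hA, hc, hs⟩ := h
  have hlt : ∀ j ∈ A, j < n' := fun j hj => mem_range.1 (hA hj)
  refine ⟨A, fun j hj => ?_, hc, fun s h0 h1 => ?_⟩
  · have := hlt j hj
    rw [mem_range]; omega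
  · by_cases c1 : s < n'
    · refine le_trans (card_le_card ?_) (hs s h0 c1)
      intro j hj
      rw [mem_filter] at hj ⊢
      have h2 := hlt j hj.1
      rw [Nat.mod_eq_of_lt (by omega)] at hj
      have h3 := hlt _ hj.2
      rw [Nat.mod_eq_of_lt h3]
      exact hj
    · by_cases c2 : n - s < n'
      · refine le_trans (card_le_card ?_) (hs (n' - (n - s)) (by omega) (by omega))
        intro j hj
        rw [mem_filter] at hj ⊢
        have h2 := hlt j hj.1
        refine ⟨hj.1, ?_⟩
        have h3 := hlt _ hj.2
        by_cases c3 : j + s < n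
        · rw [Nat.mod_eq_of_lt c3] at h3; omega
        · have e : j + s = (j + s - n) + n := by omega
          have e2 : (j + s) % n = j + s - n := by
            rw [e, Nat.add_mod_right, Nat.mod_eq_of_lt (by omega)]
            omega
          have e3 : j + (n' - (n - s)) = (j + s - n) + n' := by omega
          rw [e3, Nat.add_mod_right, Nat.mod_eq_of_lt (by omega), ← e2]
          exact hj.2
      · rw [card_eq_zero.2]
        · omega
        · rw [filter_eq_empty_iff]
          intro j hj hj2
          have h2 := hlt j hj
          have h3 := hlt _ hj2
          rw [Nat.mod_eq_of_lt (by omega)] at h3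
          omega

theorem exp_lb (x y : ℝ) (k : ℕ) (hy : 0 ≤ y) (hx : x = k + y) : (2.718:ℝ)^k * (1 + y + y^2/2) ≤ Real.exp x := by
  rw [hx, Real.exp_add]
  have h1 : (2.718:ℝ)^k ≤ Real.exp k := by
    rw [← mul_one (k:ℝ), Real.exp_nat_mul]
    have := Real.exp_one_gt_d9
    gcongr
    linarith
  have h2 := Real.quadratic_le_exp_of_nonneg hy
  gcongr

theorem quart_large (w : ℕ) (h : 600 ≤ w) : GoodM (4 * w) w ((w + 1) / 2) := by
  classical
  have hu := union_count (n := 4 * w) w (by omega) (by omega) (1/4) (by push_cast; ring) (2/5) w (by norm_num)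
  have he : Real.exp (-(2/5)) ≤ 0.6704 := by
    have h1 := Real.sum_le_exp_of_nonneg (x := 2/5) (by norm_num) 5
    simp [sum_range_succ, Nat.factorial] at h1
    rw [Real.exp_neg]
    rw [inv_le_comm₀ (Real.exp_pos _) (by norm_num)]
    refine le_trans ?_ h1
    norm_num
  have hw : (600:ℝ) ≤ w := by exact_mod_cast h
  have hex : Real.exp (2/5*w/3 - 2/3 * (1/4*(1-1/4)*((4*w:ℕ):ℝ)) * (1 - Real.exp (-(2/5)))) ≤ Real.exp (-(0.0314*w)) := by
    apply Real.exp_le_exp.2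
    push_cast
    nlinarith
  have hp : 2*(w:ℝ)*(4*w+1) < Real.exp (0.0314*w) := by
    have := exp_lb (0.0314*w) (0.0314*w-18) 18 (by linarith) (by push_cast; ring)
    refine lt_of_lt_of_le ?_ this
    have h18 : (6*10^7:ℝ) ≤ 2.718^18 := by norm_num
    have hq : (0:ℝ) ≤ 1 + (0.0314*w-18) + (0.0314*w-18)^2/2 := by nlinarith
    refine lt_of_lt_of_le ?_ (mul_le_mul_of_nonneg_right h18 hq)
    nlinarith
  have hch : 0 < (4*w).choose w := Nat.choose_pos (by omega)
  have hlt : (#(univ.filter fun x : Fin (4*w) → Fin 2 => hammingNorm x = w ∧ ∃ s, 0 < s ∧ s < 4*w ∧ (hammingDist x (cshift s x) : ℝ) ≤ w) : ℝ) < (4*w).choose w := by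
    refine lt_of_le_of_lt hu ?_
    have hch' : (0:ℝ) < (4*w).choose w := by exact_mod_cast hch
    calc _ ≤ ((4*w:ℕ):ℝ) / 2 * ((((4*w:ℕ):ℝ)+1) * (4*w).choose w * Real.exp (-(0.0314*w))) := by gcongr
      _ = (4*w).choose w * ((2*(w:ℝ)*(4*w+1)) * Real.exp (-(0.0314*w))) := by push_cast; ring
      _ < (4*w).choose w * (Real.exp (0.0314*w) * Real.exp (-(0.0314*w))) := by
        gcongr
      _ = _ := by rw [← Real.exp_add]; simp
  have hlt' : #(univ.filter fun x : Fin (4*w) → Fin 2 => hammingNorm x = w ∧ ∃ s, 0 < s ∧ s < 4*w ∧ (hammingDist x (cshift s x) : ℝ) ≤ w)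
      < #(univ.filter fun x : Fin (4*w) → Fin 2 => hammingNorm x = w) := by
    rw [card_weight]
    exact_mod_cast hlt
  obtain ⟨x, hx, hx2⟩ := exists_mem_notMem_of_card_lt_card hlt'
  simp only [mem_filter, mem_univ, true_and] at hx hx2
  refine goodM_of_word x hx fun s h0 h1 => ?_
  have h3 : w < hammingDist x (cshift s x) := by
    by_contra hle
    push Not at hle
    exact hx2 ⟨hx, s, h0, h1, by exact_mod_cast hle⟩
  obtain ⟨a1, a2, a3, -⟩ := cnt_facts x (cshift s x)
  rw [norm_cshift] at a2
  omega

theorem covW_large {n w : ℕ} (hn : 1500 ≤ n) (h1 : n ≤ 8 * w) (h2 : 2 * w ≤ n) : CovW n w := by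
  classical
  intro d hd
  have hn' : (1500:ℝ) ≤ n := by exact_mod_cast hn
  have hn0 : (0:ℝ) < n := by linarith
  have h1' : (n:ℝ) ≤ 8 * w := by exact_mod_cast h1
  have h2' : 2 * (w:ℝ) ≤ n := by exact_mod_cast h2
  have hμ : (w:ℝ)/n*(1-(w:ℝ)/n)*n = w*(n-w)/n := by field_simp
  have hd' : (d:ℝ) * n < w * (n - w) := by
    have : ((d * n : ℕ):ℝ) < ((w * (n-w) : ℕ) : ℝ) := by exact_mod_cast hd
    push_cast [Nat.cast_sub (show w ≤ n by omega)] at this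
    exact this
  have hm := many_good (n := n) w d (by omega) (by omega) ((w:ℝ)/n) (by field_simp) 
    (by rw [hμ, le_div_iff₀ hn0]; exact hd'.le) (by
      rw [hμ]
      have hlow : 7*(n:ℝ)/64 ≤ w*(n-w)/n := by
        rw [le_div_iff₀ hn0]
        nlinarith [mul_nonneg (show (0:ℝ) ≤ 8*w-n by linarith) (show (0:ℝ) ≤ 7*n-8*w by linarith)]
      refine le_trans ?_ (Real.exp_le_exp.2 (show 7*(n:ℝ)/640 ≤ _ by linarith))
      have := exp_lb (7*(n:ℝ)/640) (7*(n:ℝ)/640-16) 16 (by linarith) (by push_cast; ring)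
      refine le_trans ?_ this
      have h18 : (8*10^6:ℝ) ≤ 2.718^16 := by norm_num
      have hq : (0:ℝ) ≤ 1 + (7*(n:ℝ)/640-16) + (7*(n:ℝ)/640-16)^2/2 := by nlinarith
      refine le_trans ?_ (mul_le_mul_of_nonneg_right h18 hq)
      nlinarith)
  have hpos : (0:ℝ) < n.choose w := by exact_mod_cast Nat.choose_pos (show w ≤ n by omega)
  have hc : (0:ℝ) < #(univ.filter fun x : Fin n → Fin 2 => hammingNorm x = w ∧ SelfFar d x) := by 
    by_contra hh
    have e0 : (0:ℝ) ≤ #(univ.filter fun x : Fin n → Fin 2 => hammingNorm x = w ∧ SelfFar d x) := Nat.cast_nonneg _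
    have e1 : (2:ℝ) * #(univ.filter fun x : Fin n → Fin 2 => hammingNorm x = w ∧ SelfFar d x) ≤ 0 := by linarith
    have e2 : (n.choose w : ℝ) ≤ 2 * #(univ.filter fun x : Fin n → Fin 2 => hammingNorm x = w ∧ SelfFar d x) := by
      convert hm
    linarith
  have hc' : 0 < #(univ.filter fun x : Fin n → Fin 2 => hammingNorm x = w ∧ SelfFar d x) := by exact_mod_cast hc
  obtain ⟨x, hx⟩ := card_pos.1 hc'
  exact ⟨x, (mem_filter.1 hx).2⟩

theorem quart_all (w : ℕ) (h : 1 ≤ w) : GoodM (4 * w) w ((w + 1) / 2) := by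
  by_cases h1 : w < 25
  · exact quart_small w h h1
  · by_cases h2 : w < 600
    · exact quart_mid w (by omega) h2
    · exact quart_large w (by omega)

theorem covW_half {n w : ℕ} (h : 1 ≤ w) (h2 : 2 * w ≤ n) : CovW n w := by
  by_cases h8 : 8 * w ≤ n
  · refine covW_of_covM (by omega) ⟨_, (quart_all w h).pad (by omega), ?_⟩
    have : 2 * ((w+1)/2) ≤ w + 1 := by omega
    have := Nat.mul_le_mul_right n this
    nlinarith
  · by_cases hn : 1500 ≤ n
    · exact covW_large hn (by omega) h2
    · refine covW_of_covM (by omega) ?_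
      by_cases h100 : n < 100
      · exact cov_small n w (by omega) h100 (by omega) h2
      · exact cov_mid n w (by omega) (by omega) (by omega) h2

theorem covW_all {n w : ℕ} (h1 : 0 < w) (h2 : w < n) : CovW n w := by
  by_cases h : 2 * w ≤ n
  · exact covW_half h1 h
  · exact covW_compl h2.le (covW_half (by omega) (by omega))

end Existence

/-- GV-type bound for optical orthogonal codes (constant weight binary HCCs). -/
theorem stmt1 (p ε τ : ℝ) (hp : p ∈ Set.Ioo (0 : ℝ) 1) (hε : ε ∈ Set.Ioo (0 : ℝ) (1 / 10))
    (hτ : τ ∈ Set.Ioo (0 : ℝ) (p * (1 - p))) :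
    ∃ c : ℝ, 0 < c ∧ ∀ n d w : ℕ, 0 < n → 0 < d → (w : ℝ) = p * n →
      τ ≤ (d : ℝ) / n → (d : ℝ) / n ≤ (1 - ε) * p * (1 - p) →
      ∃ C : Finset (Fin n → Fin 2), IsHCC C ∧
        (∀ x ∈ C, hammingNorm x = w) ∧
        (∀ x ∈ C, ∀ y ∈ C, x ≠ y → d ≤ hammingDist x y) ∧
        c * n * (n.choose w : ℝ) / (volCW n (d - 1) w : ℝ) ≤ (C.card : ℝ) := by
  obtain ⟨N, hN⟩ := large_n p τ hp hτ.1
  obtain ⟨hp0, hp1⟩ := hp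
  have hτ0 := hτ.1
  have hpp : 0 < p * (1 - p) := mul_pos hp0 (by linarith)
  refine ⟨min (τ/2048) (1/2^N), lt_min (by positivity) (by positivity), ?_⟩
  intro n d w hn hd hw h1 h2
  have hn' : (0:ℝ) < n := by exact_mod_cast hn
  rw [le_div_iff₀ hn'] at h1
  rw [div_le_iff₀ hn'] at h2
  have h2' : (d:ℝ) < p * (1-p) * n := by
    have : 0 < ε * (p * (1-p) * n) := mul_pos hε.1 (mul_pos hpp hn')
    nlinarith
  by_cases hNn : N ≤ n
  · obtain ⟨C, a1, a2, a3, a4⟩ := hN n d w hNn hn hd hw h1 h2'.le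
    refine ⟨C, a1, a2, a3, le_trans ?_ a4⟩
    gcongr
    exact min_le_left _ _
  · have hw0 : 0 < w := by
      have : (0:ℝ) < w := by rw [hw]; positivity
      exact_mod_cast this
    have hwn : w < n := by
      have : (w:ℝ) < n := by rw [hw]; nlinarith
      exact_mod_cast this
    have hdn : d * n < w * (n - w) := by
      have : ((d * n : ℕ):ℝ) < ((w * (n-w) : ℕ) : ℝ) := by
        push_cast [Nat.cast_sub hwn.le]
        rw [hw]
        nlinarith
      exact_mod_cast this
    obtain ⟨x, hx, hxs⟩ := covW_all hw0 hwn d hdn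
    obtain ⟨C, a1, a2, a3, a4⟩ := code_of_reps d w hd {x} (by simpa using hx) (by simpa using hxs)
      (by intro y hy z hz hyz; rw [mem_singleton] at hy hz; exact absurd (hy.trans hz.symm) hyz)
    refine ⟨C, a1, a2, a3, ?_⟩
    rw [a4]
    simp only [card_singleton, mul_one]
    have hv : (1:ℝ) ≤ volCW n (d-1) w := by
      have : 1 ≤ volCW n (d-1) w := by
        unfold volCW
        refine le_trans ?_ (single_le_sum (f := fun i => w.choose i * (n-w).choose i) (fun i _ => Nat.zero_le _) (mem_range.2 (Nat.succ_pos _)))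
        simp
      exact_mod_cast this
    have hch : (n.choose w : ℝ) ≤ 2^N := by
      have : n.choose w ≤ 2^N := (Nat.choose_le_two_pow n w).trans (Nat.pow_le_pow_right (by norm_num) (by omega))
      exact_mod_cast this
    rw [div_le_iff₀ (by linarith)]
    have hmin : min (τ/2048) (1/2^N) * (n.choose w : ℝ) ≤ 1 := by
      calc _ ≤ 1/2^N * (2^N:ℝ) := by
            gcongr
            exact min_le_right _ _
        _ = 1 := by field_simp
    calc _ = (n:ℝ) * (min (τ/2048) (1/2^N) * (n.choose w : ℝ)) := by ring
      _ ≤ n * 1 := by gcongr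
      _ ≤ _ := by gcongr
end

section
/- For all positive integers n, q, κ and absolute reals τ, ε ∈ (0, 1 − 1/q) there exists a positive real c, depending only on τ, ε and q, such that whenever 1/q + ε ≤ κ/n ≤ 1 − τ, there exists a κ-weakly mutually uncorrelated (n, M, n−κ+1)_q code with M ≥ c·q^n / Vol_q(n, n−κ). -/
open Finset

/-- `Vol_q(n,t) = ∑_{i=0}^{t} C(n,i)(q-1)^i`. -/
def volQ (q n t : ℕ) : ℕ := ∑ i ∈ Finset.range (t + 1), n.choose i * (q - 1) ^ i
/-- A κ-weakly mutually uncorrelated code: for all codewords `x, y` (possibly equal)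
and every `κ ≤ ℓ ≤ n-1`, the length-`ℓ` prefix of `x` differs from the
length-`ℓ` suffix of `y`. -/
def IsWMU (q n κ : ℕ) (C : Finset (Fin n → Fin q)) : Prop :=
  ∀ x ∈ C, ∀ y ∈ C, ∀ ℓ : ℕ, κ ≤ ℓ → ℓ ≤ n - 1 →
    (List.ofFn x).take ℓ ≠ (List.ofFn y).drop (n - ℓ)

/-- Overlap of `x` and `y` at shift `s`. -/
def Ovl {q n : ℕ} (s : ℕ) (x y : Fin n → Fin q) : Prop :=
  ∀ (j : ℕ) (h : j + s < n), x ⟨j, by omega⟩ = y ⟨j + s, h⟩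

theorem ovl_of_list {q n ℓ : ℕ} (hl : ℓ ≤ n) (x y : Fin n → Fin q)
    (h : (List.ofFn x).take ℓ = (List.ofFn y).drop (n - ℓ)) : Ovl (n - ℓ) x y := by
  intro j hj
  have h1 : ((List.ofFn x).take ℓ)[j]? = ((List.ofFn y).drop (n - ℓ))[j]? := by rw [h]
  have hjl : j < ℓ := by omega
  have hjn : j < n := by omega
  have h2 : n - ℓ + j < n := by omega
  rw [List.getElem?_take, if_pos hjl, List.getElem?_drop, List.getElem?_ofFn,
    List.getElem?_ofFn, dif_pos hjn, dif_pos h2] at h1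
  have h3 := Option.some.inj h1
  rw [h3]
  congr 2
  omega

theorem card_le_of_inj {q n s : ℕ} (S : Finset (Fin n → Fin q))
    (e : Fin s → Fin n)
    (h : ∀ y ∈ S, ∀ z ∈ S, (∀ i, y (e i) = z (e i)) → y = z) : S.card ≤ q ^ s := by
  have := Finset.card_le_card_of_injOn (s := S) (t := (Finset.univ : Finset (Fin s → Fin q)))
    (fun y i => y (e i)) (fun _ _ => Finset.mem_coe.2 (Finset.mem_univ _))
    (fun y hy z hz hyz => h y hy z hz (fun i => congrFun hyz i))
  simpa using this

open Classical in
theorem card_right {q n s : ℕ} (hs : s ≤ n) (x : Fin n → Fin q) :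
    (Finset.univ.filter (fun y => Ovl s x y)).card ≤ q ^ s := by
  apply card_le_of_inj _ (Fin.castLE hs)
  intro y hy z hz h
  simp only [Finset.mem_filter, Finset.mem_univ, true_and] at hy hz
  funext ⟨i, hi⟩
  by_cases his : i < s
  · exact h ⟨i, his⟩
  · obtain ⟨k, rfl⟩ : ∃ k, i = k + s := ⟨i - s, by omega⟩
    rw [← hy k hi, ← hz k hi]

open Classical in
theorem card_left {q n s : ℕ} (hs : s ≤ n) (x : Fin n → Fin q) :
    (Finset.univ.filter (fun y => Ovl s y x)).card ≤ q ^ s := by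
  apply card_le_of_inj _ (fun i : Fin s => (⟨n - s + i.1, by omega⟩ : Fin n))
  intro y hy z hz h
  simp only [Finset.mem_filter, Finset.mem_univ, true_and] at hy hz
  funext ⟨i, hi⟩
  by_cases his : i + s < n
  · rw [hy i his, hz i his]
  · have := h ⟨i - (n - s), by omega⟩
    have e : n - s + (i - (n - s)) = i := by omega
    simpa only [e] using this

open Classical in
theorem card_self {q n s : ℕ} (h0 : 0 < s) (hs : s ≤ n) :
    (Finset.univ.filter (fun y : Fin n → Fin q => Ovl s y y)).card ≤ q ^ s := by
  apply card_le_of_inj _ (Fin.castLE hs)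
  intro y hy z hz h
  simp only [Finset.mem_filter, Finset.mem_univ, true_and] at hy hz
  funext ⟨i, hi⟩
  induction i using Nat.strong_induction_on with
  | _ i ih =>
    by_cases his : i < s
    · exact h ⟨i, his⟩
    · obtain ⟨k, rfl⟩ : ∃ k, i = k + s := ⟨i - s, by omega⟩
      rw [← hy k hi, ← hz k hi]
      exact ih k (by omega) _

theorem geom_bd (q t : ℕ) (hq : 2 ≤ q) : ∑ s ∈ Finset.Icc 1 t, q ^ s ≤ 2 * q ^ t := by
  induction t with
  | zero => simp
  | succ t ih =>
    rw [Finset.sum_Icc_succ_top (by omega), pow_succ]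
    nlinarith [pow_pos (show 0 < q by omega) t]

theorem pow_le_volQ (q n t : ℕ) (hq : 0 < q) (ht : t ≤ n) : q ^ t ≤ volQ q n t := by
  have h : ((q - 1) + 1) ^ t = ∑ i ∈ Finset.range (t + 1), (q - 1) ^ i * 1 ^ (t - i) * t.choose i :=
    add_pow _ _ _
  rw [Nat.sub_add_cancel hq] at h
  rw [h, volQ]
  apply Finset.sum_le_sum
  intro i _
  rw [one_pow, mul_one, mul_comm]
  exact Nat.mul_le_mul_right _ (Nat.choose_le_choose i ht)

theorem card_ball (q n t : ℕ) (x : Fin n → Fin q) :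
    (Finset.univ.filter (fun y => hammingDist x y ≤ t)).card ≤ volQ q n t := by
  classical
  have hsub : Finset.univ.filter (fun y => hammingDist x y ≤ t) ⊆
      (Finset.range (t + 1)).biUnion (fun i =>
        (Finset.powersetCard i (Finset.univ : Finset (Fin n))).biUnion (fun S =>
          Fintype.piFinset (fun j => if j ∈ S then Finset.univ.erase (x j) else {x j}))) := by
    intro y hy
    simp only [Finset.mem_filter, Finset.mem_univ, true_and] at hy
    simp only [Finset.mem_biUnion, Finset.mem_range, Finset.mem_powersetCard, Fintype.mem_piFinset]
    refine ⟨hammingDist x y, by omega, Finset.univ.filter (fun j => x j ≠ y j),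
      ⟨Finset.subset_univ _, rfl⟩, ?_⟩
    intro j
    by_cases hj : x j = y j
    · simp [hj]
    · simp [hj, Ne.symm hj]
  refine (Finset.card_le_card hsub).trans (Finset.card_biUnion_le.trans ?_)
  unfold volQ
  apply Finset.sum_le_sum
  intro i _
  refine Finset.card_biUnion_le.trans ?_
  have : ∀ S ∈ Finset.powersetCard i (Finset.univ : Finset (Fin n)),
      (Fintype.piFinset (fun j => if j ∈ S then Finset.univ.erase (x j) else {x j})).card
        = (q - 1) ^ i := by
    intro S hS
    rw [Finset.mem_powersetCard] at hS
    rw [Fintype.card_piFinset]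
    have : ∀ j, (if j ∈ S then Finset.univ.erase (x j) else {x j}).card
        = if j ∈ S then q - 1 else 1 := by
      intro j
      split_ifs <;> simp
    simp only [this]
    rw [Finset.prod_ite_mem, Finset.univ_inter, Finset.prod_const, hS.2]
  rw [Finset.sum_congr rfl this]
  simp

theorem greedy {α : Type*} [Fintype α] [DecidableEq α] (G : Finset α) (N : α → Finset α) (D : ℕ)
    (hself : ∀ x, x ∈ N x) (hsymm : ∀ x y, y ∈ N x → x ∈ N y) (hD : ∀ x, (N x).card ≤ D) :
    ∃ C ⊆ G, (∀ x ∈ C, ∀ y ∈ C, x ≠ y → y ∉ N x) ∧ G.card ≤ C.card * D := by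
  classical
  let F := G.powerset.filter (fun C => ∀ x ∈ C, ∀ y ∈ C, x ≠ y → y ∉ N x)
  have hF : F.Nonempty := ⟨∅, by simp [F]⟩
  obtain ⟨C, hC, hmax⟩ := Finset.exists_max_image F Finset.card hF
  simp only [F, Finset.mem_filter, Finset.mem_powerset] at hC hmax
  refine ⟨C, hC.1, hC.2, ?_⟩
  have hcov : G ⊆ C.biUnion N := by
    intro y hy
    by_contra hn
    simp only [Finset.mem_biUnion, not_exists, not_and] at hn
    have hyC : y ∉ C := fun h => hn y h (hself y)
    have := hmax (insert y C) ⟨Finset.insert_subset hy hC.1, by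
      intro a ha b hb hab
      rw [Finset.mem_insert] at ha hb
      rcases ha with rfl | ha <;> rcases hb with rfl | hb
      · exact absurd rfl hab
      · exact fun h => hn b hb (hsymm _ _ h)
      · exact hn a ha
      · exact hC.2 a ha b hb hab⟩
    rw [Finset.card_insert_of_notMem hyC] at this
    omega
  calc G.card ≤ (C.biUnion N).card := Finset.card_le_card hcov
    _ ≤ ∑ x ∈ C, (N x).card := Finset.card_biUnion_le
    _ ≤ ∑ _x ∈ C, D := Finset.sum_le_sum (fun x _ => hD x)
    _ = C.card * D := by simp

theorem main_nat (q n κ : ℕ) (hq : 2 ≤ q) (hκ : 0 < κ) (hκn : κ ≤ n) (h2 : 2 ≤ κ ∨ 3 ≤ q) :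
    ∃ C : Finset (Fin n → Fin q), IsWMU q n κ C ∧
        (∀ x ∈ C, ∀ y ∈ C, x ≠ y → n - κ + 1 ≤ hammingDist x y) ∧
        q ^ n ≤ 15 * (C.card * volQ q n (n - κ)) := by
  classical
  set t := n - κ with ht
  have htn : t ≤ n := by omega
  let B : Finset (Fin n → Fin q) := (Finset.Icc 1 t).biUnion
    (fun s => Finset.univ.filter (fun y => Ovl s y y))
  let L : (Fin n → Fin q) → Finset (Fin n → Fin q) := fun x => (Finset.Icc 1 t).biUnion
    (fun s => Finset.univ.filter (fun y => Ovl s y x))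
  let R : (Fin n → Fin q) → Finset (Fin n → Fin q) := fun x => (Finset.Icc 1 t).biUnion
    (fun s => Finset.univ.filter (fun y => Ovl s x y))
  let A : (Fin n → Fin q) → Finset (Fin n → Fin q) := fun x =>
    Finset.univ.filter (fun y => hammingDist x y ≤ t)
  have hg := geom_bd q t hq
  have hV := pow_le_volQ q n t (by omega) htn
  have hB : B.card ≤ 2 * q ^ t := by
    refine (Finset.card_biUnion_le.trans (Finset.sum_le_sum ?_)).trans hg
    intro s hs
    rw [Finset.mem_Icc] at hs
    exact card_self (by omega) (by omega)
  have hL : ∀ x, (L x).card ≤ 2 * q ^ t := by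
    intro x
    refine (Finset.card_biUnion_le.trans (Finset.sum_le_sum ?_)).trans hg
    intro s hs
    rw [Finset.mem_Icc] at hs
    exact card_left (by omega) x
  have hR : ∀ x, (R x).card ≤ 2 * q ^ t := by
    intro x
    refine (Finset.card_biUnion_le.trans (Finset.sum_le_sum ?_)).trans hg
    intro s hs
    rw [Finset.mem_Icc] at hs
    exact card_right (by omega) x
  obtain ⟨C, hCG, hC, hcard⟩ := greedy (Bᶜ) (fun x => A x ∪ (L x ∪ R x)) (5 * volQ q n t)
    (by intro x; simp [A])
    (by
      intro x y h
      simp only [A, L, R, Finset.mem_union, Finset.mem_filter, Finset.mem_univ, true_and,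
        Finset.mem_biUnion] at h ⊢
      rw [hammingDist_comm y x]
      exact h.imp id Or.symm)
    (by
      intro x
      have h1 := Finset.card_union_le (A x) (L x ∪ R x)
      have h2 := Finset.card_union_le (L x) (R x)
      have h3 : (A x).card ≤ volQ q n t := card_ball q n t x
      have := hL x
      have := hR x
      omega)
  refine ⟨C, ?_, ?_, ?_⟩
  · intro x hx y hy ℓ h1 hl he
    have ho := ovl_of_list (by omega) x y he
    have hs : n - ℓ ∈ Finset.Icc 1 t := by rw [Finset.mem_Icc]; omega
    by_cases hxy : x = y
    · subst hxy
      have := hCG hx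
      rw [Finset.mem_compl] at this
      apply this
      exact Finset.mem_biUnion.2 ⟨_, hs, by simpa using ho⟩
    · apply hC x hx y hy hxy
      apply Finset.mem_union_right
      apply Finset.mem_union_right
      exact Finset.mem_biUnion.2 ⟨_, hs, by simpa using ho⟩
  · intro x hx y hy hxy
    by_contra hlt
    apply hC x hx y hy hxy
    apply Finset.mem_union_left
    simp only [A, Finset.mem_filter, Finset.mem_univ, true_and]
    omega
  · have hc : (Bᶜ).card = q ^ n - B.card := by rw [Finset.card_compl]; simp
    have hn : q ^ n = q ^ t * q ^ κ := by rw [← pow_add]; congr 1; omega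
    have hk : 3 ≤ q ^ κ := by
      rcases h2 with h2 | h2
      · calc 3 ≤ 2 ^ 2 := by norm_num
          _ ≤ q ^ 2 := Nat.pow_le_pow_left hq 2
          _ ≤ q ^ κ := Nat.pow_le_pow_right (by omega) h2
      · exact h2.trans (Nat.le_self_pow (by omega) q)
    have h3 : q ^ t * 3 ≤ q ^ n := hn ▸ Nat.mul_le_mul_left _ hk
    have : C.card * (5 * volQ q n t) = 5 * (C.card * volQ q n t) := by ring
    omega

/-- Improved lower bound for error-correcting weakly mutually uncorrelated codes. -/
theorem stmt5 (q : ℕ) (hq : 0 < q) (τ ε : ℝ)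
    (hτ : τ ∈ Set.Ioo (0 : ℝ) (1 - 1 / q)) (hε : ε ∈ Set.Ioo (0 : ℝ) (1 - 1 / q)) :
    ∃ c : ℝ, 0 < c ∧ ∀ n κ : ℕ, 0 < n → 0 < κ →
      1 / q + ε ≤ (κ : ℝ) / n → (κ : ℝ) / n ≤ 1 - τ →
      ∃ C : Finset (Fin n → Fin q), IsWMU q n κ C ∧
        (∀ x ∈ C, ∀ y ∈ C, x ≠ y → n - κ + 1 ≤ hammingDist x y) ∧
        c * (q : ℝ) ^ n / (volQ q n (n - κ) : ℝ) ≤ (C.card : ℝ) := by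
  refine ⟨1 / 15, by norm_num, ?_⟩
  intro n κ hn hκ h1 h2
  have hq2 : 2 ≤ q := by
    by_contra h
    have : q = 1 := by omega
    subst this
    have := hτ.1.trans hτ.2
    norm_num at this
  have hnR : (0 : ℝ) < n := by exact_mod_cast hn
  have hκn : κ < n := by
    have : (κ : ℝ) / n < 1 := by linarith [hτ.1]
    rw [div_lt_one hnR] at this
    exact_mod_cast this
  have hor : 2 ≤ κ ∨ 3 ≤ q := by
    by_contra h
    push Not at h
    have e1 : κ = 1 := by omega
    have e2 : q = 2 := by omega
    subst e1 e2
    have h3 : (1 : ℝ) / 2 < 1 / n := by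
      have := hε.1
      push_cast at h1
      linarith
    have h4 : (2 : ℝ) ≤ n := by exact_mod_cast hκn
    have := one_div_le_one_div_of_le (by norm_num) h4
    linarith
  obtain ⟨C, hC1, hC2, hC3⟩ := main_nat q n κ hq2 hκ hκn.le hor
  refine ⟨C, hC1, hC2, ?_⟩
  have hV : 0 < volQ q n (n - κ) :=
    (pow_pos hq _).trans_le (pow_le_volQ q n (n - κ) hq (by omega))
  have hVR : (0 : ℝ) < volQ q n (n - κ) := by exact_mod_cast hV
  rw [div_le_iff₀ hVR]
  have : ((q : ℝ)) ^ n ≤ 15 * (C.card * volQ q n (n - κ)) := by exact_mod_cast hC3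
  linarith
end

section
/- Let 1 ≤ κ ≤ n and let C' ⊆ [q]^n be an (n, M', n−κ+1)_q hopping cyclic code. Let C ⊆ C' be a subcode obtained by picking exactly one codeword from each of the M'/n pairwise disjoint sets C(x) that partition C'. Then C is a κ-weakly mutually uncorrelated code with |C| = M'/n and minimum Hamming distance at least n−κ+1. -/
open Finset

/-- `C(x)`: the set of all cyclic shifts of `x`. -/
def orbit {q n : ℕ} (x : Fin n → Fin q) : Finset (Fin n → Fin q) :=
  (Finset.range n).image fun i => cshift i x
theorem aux_cshift_cshift {q n : ℕ} (i j : ℕ) (x : Fin n → Fin q) :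
    cshift i (cshift j x) = cshift (i + j) x := by
  funext k
  simp only [cshift]
  congr 1
  ext
  simp [Nat.add_assoc]

theorem aux_cshift_mod {q n : ℕ} (i : ℕ) (x : Fin n → Fin q) :
    cshift (i % n) x = cshift i x := by
  funext k
  simp only [cshift]
  congr 1
  ext
  simp

theorem aux_cshift_zero {q n : ℕ} (x : Fin n → Fin q) : cshift 0 x = x := by
  funext k
  simp only [cshift]
  congr 1
  ext
  simp [Nat.mod_eq_of_lt k.2]

theorem aux_mem_orbit {q n : ℕ} (hn : 0 < n) (i : ℕ) (x : Fin n → Fin q) :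
    cshift i x ∈ orbit x := by
  refine Finset.mem_image.2 ⟨i % n, Finset.mem_range.2 (Nat.mod_lt _ hn), aux_cshift_mod i x⟩

theorem aux_orbit_symm {q n : ℕ} (hn : 0 < n) {x z : Fin n → Fin q} (h : z ∈ orbit x) :
    x ∈ orbit z := by
  obtain ⟨i, hi, rfl⟩ := Finset.mem_image.1 h
  have hi' := Finset.mem_range.1 hi
  have := aux_mem_orbit hn (n - i) (cshift i x)
  rw [aux_cshift_cshift, Nat.sub_add_cancel hi'.le, ← aux_cshift_mod n x, Nat.mod_self,
    aux_cshift_zero] at this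
  exact this

/-- Picking one codeword from each cyclic orbit of an (n, M', n-κ+1)_q-HCC yields
a κ-WMU code of size M'/n with minimum distance at least n-κ+1. -/
theorem stmt6 {q n κ : ℕ} (hκ1 : 1 ≤ κ) (hκn : κ ≤ n)
    (C' : Finset (Fin n → Fin q)) (hHCC : IsHCC C')
    (hdist : ∀ x ∈ C', ∀ y ∈ C', x ≠ y → n - κ + 1 ≤ hammingDist x y)
    (C : Finset (Fin n → Fin q)) (hCC' : C ⊆ C')
    (hpick : ∀ x ∈ C', ∃! y, y ∈ C ∧ y ∈ orbit x) :
    IsWMU q n κ C ∧ C.card = C'.card / n ∧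
    (∀ x ∈ C, ∀ y ∈ C, x ≠ y → n - κ + 1 ≤ hammingDist x y) := by
  have hn : 0 < n := by omega
  refine ⟨?_, ?_, fun x hx y hy => hdist x (hCC' hx) y (hCC' hy)⟩
  · intro x hx y hy ℓ h1 h2 heq
    have hag : ∀ j : Fin n, j.1 < ℓ → x j = cshift (n - ℓ) y j := by
      intro j hj
      have h := congrArg (fun l => l[j.1]?) heq
      have h3 : n - ℓ + j.1 < n := by omega
      simp only [List.getElem?_take, List.getElem?_drop, hj, if_true, List.getElem?_ofFn,
        j.2, h3, dif_pos] at h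
      have h4 := Option.some.inj h
      rw [h4]
      simp only [cshift]
      congr 1
      ext
      simp only
      rw [Nat.add_comm j.1, Nat.mod_eq_of_lt h3]
    have hxz : x = cshift (n - ℓ) y := by
      by_contra hne
      have hd := hdist x (hCC' hx) _ ((hHCC y (hCC' hy)).1 (n - ℓ)) hne
      have hle : hammingDist x (cshift (n - ℓ) y) ≤ n - ℓ := by
        unfold hammingDist
        calc _ ≤ (Finset.Ico ℓ n).card := by
              refine Finset.card_le_card_of_injOn (fun j => j.1) ?_ ?_
              · intro j hj
                have hj' := (Finset.mem_filter.1 hj).2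
                refine Finset.mem_coe.2 (Finset.mem_Ico.2 ⟨?_, j.2⟩)
                by_contra hlt
                exact hj' (hag j (not_le.1 hlt))
              · intro a _ b _ hab
                exact Fin.ext hab
          _ = n - ℓ := by simp
      omega
    have hxy : x = y := by
      refine (hpick y (hCC' hy)).unique ⟨hx, ?_⟩ ⟨hy, ?_⟩
      · rw [hxz]; exact aux_mem_orbit hn _ y
      · have := aux_mem_orbit hn 0 y
        rwa [aux_cshift_zero] at this
    subst hxy
    have hinj := (hHCC x (hCC' hx)).2
    have := @hinj ⟨n - ℓ, by omega⟩ ⟨0, hn⟩ (by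
      simp only [aux_cshift_zero]; exact hxz.symm)
    have := congrArg Fin.val this
    simp only at this
    omega
  · have hU : C' = C.biUnion orbit := by
      ext w
      rw [Finset.mem_biUnion]
      constructor
      · intro hw
        obtain ⟨y, ⟨hy, hyw⟩, _⟩ := hpick w hw
        exact ⟨y, hy, aux_orbit_symm hn hyw⟩
      · rintro ⟨y, hy, hw⟩
        obtain ⟨i, _, rfl⟩ := Finset.mem_image.1 hw
        exact (hHCC y (hCC' hy)).1 i
    have hcard : C'.card = C.card * n := by
      have hb : (C.biUnion orbit).card = ∑ u ∈ C, (orbit u).card := by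
        refine Finset.card_biUnion ?_
        intro x hx y hy hne
        refine Finset.disjoint_left.2 fun z hzx hzy => hne ?_
        have hz : z ∈ C' := by
          rw [hU]; exact Finset.mem_biUnion.2 ⟨x, hx, hzx⟩
        exact (hpick z hz).unique ⟨hx, aux_orbit_symm hn hzx⟩ ⟨hy, aux_orbit_symm hn hzy⟩
      rw [hU, hb]
      refine Finset.sum_const_nat fun x hx => ?_
      unfold orbit
      rw [Finset.card_image_of_injOn, Finset.card_range]
      intro a ha b hb hab
      have ha' := Finset.mem_range.1 (Finset.mem_coe.1 ha)
      have hb' := Finset.mem_range.1 (Finset.mem_coe.1 hb)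
      have := @(hHCC x (hCC' hx)).2 ⟨a, ha'⟩ ⟨b, hb'⟩ hab
      exact congrArg Fin.val this
    rw [hcard, Nat.mul_div_cancel _ hn]
end

section
/- Let n ≥ 2 and q ≥ 2 be integers and ε ∈ (0, 1 − 1/q) a real. Let A = {x ∈ [q]^n : d(x) > n(1 − 1/q − ε)}, where d(x) = min_{1 ≤ i ≤ n−1} d(x, π_i(x)). Then |A| ≥ q^n · (1 − (n−1)·exp(−ε²n/2)). -/
open Finset

lemma hoeff_step (q : ℕ) (hq : 0 < q) (u : Fin q → ℝ) (h : ∀ a b, u a - u b ≤ 2) (t : ℝ) :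
    ∑ a, Real.exp (t * (u a - (∑ b, u b) / q)) ≤ q * Real.exp (t ^ 2 / 2) := by
  have : Nonempty (Fin q) := ⟨⟨0, hq⟩⟩
  obtain ⟨a₀, ha₀⟩ := Finite.exists_min u
  have hq' : (0 : ℝ) < q := by exact_mod_cast hq
  have key := (ProbabilityTheory.hasSubgaussianMGF_of_mem_Icc (X := u)
    (μ := (PMF.uniformOfFintype (Fin q)).toMeasure) (a := u a₀) (b := u a₀ + 2)
    (measurable_of_finite u).aemeasurable
    (Filter.Eventually.of_forall fun a => ⟨ha₀ a, by linarith [h a a₀]⟩)).mgf_le t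
  have hm : ∫ a, u a ∂(PMF.uniformOfFintype (Fin q)).toMeasure = (∑ b, u b) / q := by
    rw [PMF.integral_eq_sum]
    simp [← Finset.mul_sum, div_eq_inv_mul]
  rw [ProbabilityTheory.mgf, PMF.integral_eq_sum, hm] at key
  simp only [PMF.uniformOfFintype_apply, Fintype.card_fin, ENNReal.toReal_inv,
    ENNReal.toReal_natCast, smul_eq_mul, ← Finset.mul_sum] at key
  rw [inv_mul_le_iff₀ hq'] at key
  refine key.trans (le_of_eq ?_)
  congr 2
  simp

lemma hamming_cons {q n : ℕ} (a b : Fin q) (x y : Fin n → Fin q) :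
    hammingDist (Fin.cons a x : Fin (n+1) → Fin q) (Fin.cons b y)
      = (if a ≠ b then 1 else 0) + hammingDist x y := by
  simp only [hammingDist, Finset.card_filter, Fin.sum_univ_succ, Fin.cons_zero, Fin.cons_succ]

lemma sum_cons {q n : ℕ} (F : (Fin (n+1) → Fin q) → ℝ) :
    ∑ x, F x = ∑ a : Fin q, ∑ y : Fin n → Fin q, F (Fin.cons a y) := by
  rw [← Fintype.sum_prod_type' (f := fun (a : Fin q) (y : Fin n → Fin q) => F (Fin.cons a y))]
  exact (Equiv.sum_comp (Fin.consEquiv (fun _ : Fin (n+1) => Fin q)) F).symm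

lemma mcd (q : ℕ) (hq : 0 < q) (t : ℝ) : ∀ (n : ℕ) (f : (Fin n → Fin q) → ℝ),
    (∀ x y, f x - f y ≤ 2 * (hammingDist x y : ℝ)) →
    ∑ x, Real.exp (t * (f x - (∑ y, f y) / (q : ℝ) ^ n)) ≤
      (q : ℝ) ^ n * Real.exp (t ^ 2 * n / 2) := by
  have hq' : (0 : ℝ) < q := by exact_mod_cast hq
  intro n
  induction n with
  | zero => intro f hf; simp
  | succ n ih =>
    intro f hf
    have hqn : (0 : ℝ) < (q : ℝ) ^ n := by positivity
    set u : Fin q → ℝ := fun a => (∑ y : Fin n → Fin q, f (Fin.cons a y)) / (q : ℝ) ^ n with hu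
    have hmean : (∑ y, f y) / (q : ℝ) ^ (n+1) = (∑ a, u a) / q := by
      rw [sum_cons, hu, ← Finset.sum_div, div_div, pow_succ]
    have hub : ∀ a b, u a - u b ≤ 2 := by
      intro a b
      rw [hu]
      simp only
      rw [← sub_div, ← Finset.sum_sub_distrib, div_le_iff₀ hqn]
      refine (Finset.sum_le_card_nsmul _ _ 2 ?_).trans ?_
      · intro y _
        refine (hf _ _).trans ?_
        rw [hamming_cons, hammingDist_self]
        split_ifs <;> norm_num
      · simp [mul_comm]
    rw [hmean, sum_cons]
    have step : ∀ a : Fin q,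
        ∑ y : Fin n → Fin q, Real.exp (t * (f (Fin.cons a y) - (∑ a, u a) / q)) ≤
        Real.exp (t * (u a - (∑ a, u a) / q)) * ((q : ℝ) ^ n * Real.exp (t ^ 2 * n / 2)) := by
      intro a
      have := ih (fun y => f (Fin.cons a y)) (by
        intro x y
        refine (hf _ _).trans ?_
        rw [hamming_cons]; simp)
      refine le_trans (le_of_eq ?_) (mul_le_mul_of_nonneg_left this (Real.exp_pos _).le)
      rw [Finset.mul_sum]
      refine Finset.sum_congr rfl fun y _ => ?_
      rw [← Real.exp_add]
      congr 1
      simp only [hu]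
      ring
    refine (Finset.sum_le_sum fun a _ => step a).trans ?_
    rw [← Finset.sum_mul]
    refine (mul_le_mul_of_nonneg_right (hoeff_step q hq u hub t) (by positivity)).trans
      (le_of_eq ?_)
    have : t ^ 2 * ((n + 1 : ℕ) : ℝ) / 2 = t ^ 2 / 2 + t ^ 2 * n / 2 := by push_cast; ring
    rw [this, Real.exp_add]
    ring

lemma count_eq {q n : ℕ} (j k : Fin n) (hjk : k ≠ j) :
    (Finset.univ.filter fun x : Fin n → Fin q => x j = x k).card * q ≤ q ^ n := by
  have : ((Finset.univ.filter fun x : Fin n → Fin q => x j = x k) ×ˢ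
      (Finset.univ : Finset (Fin q))).card ≤ (Finset.univ : Finset (Fin n → Fin q)).card := by
    refine Finset.card_le_card_of_injOn (fun p => Function.update p.1 j p.2)
      (fun _ _ => by simp) ?_
    rintro ⟨x, a⟩ hx ⟨y, b⟩ hy h
    simp only [Finset.coe_product, Set.mem_prod, Finset.coe_filter, Finset.mem_univ, true_and,
      Set.mem_ofPred_eq, Finset.coe_univ, Set.mem_univ, and_true] at hx hy
    simp only at h
    have h1 : a = b := by simpa using congrFun h j
    have h2 : ∀ i, i ≠ j → x i = y i := fun i hi => by simpa [hi] using congrFun h i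
    have h3 : x = y := by
      funext i
      by_cases hi : i = j
      · subst hi; rw [hx, hy]; exact h2 k hjk
      · exact h2 i hi
    rw [h1, h3]
  simpa using this

lemma tail_bound {n q : ℕ} (hq : 0 < q) (ε : ℝ) (hε : 0 < ε) (s : Fin n → Fin n)
    (hs : Function.Injective s) (hs' : ∀ j, s j ≠ j) (B : Finset (Fin n → Fin q))
    (hB : ∀ x ∈ B, (hammingDist x (fun j => x (s j)) : ℝ) ≤ n * (1 - 1 / q - ε)) :
    (B.card : ℝ) ≤ (q : ℝ) ^ n * Real.exp (-(ε ^ 2 * n) / 2) := by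
  have hq' : (0 : ℝ) < q := by exact_mod_cast hq
  have hqn : (0 : ℝ) < (q : ℝ) ^ n := by positivity
  set f : (Fin n → Fin q) → ℝ := fun x => -(hammingDist x (fun j => x (s j)) : ℝ) with hf
  have hlip : ∀ x y, f x - f y ≤ 2 * (hammingDist x y : ℝ) := by
    intro x y
    have h1 : hammingDist (fun j => x (s j)) (fun j => y (s j)) ≤ hammingDist x y := by
      unfold hammingDist
      refine Finset.card_le_card_of_injOn s (fun j hj => by simpa using hj) hs.injOn
    have h2 := hammingDist_triangle y x (fun j => y (s j))
    have h3 := hammingDist_triangle x (fun j => x (s j)) (fun j => y (s j))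
    rw [hammingDist_comm y x] at h2
    have : hammingDist y (fun j => y (s j)) ≤
      hammingDist x (fun j => x (s j)) + 2 * hammingDist x y := by omega
    have : (hammingDist y (fun j => y (s j)) : ℝ) ≤
      hammingDist x (fun j => x (s j)) + 2 * hammingDist x y := by exact_mod_cast this
    simp only [hf]; linarith
  have hmean : (∑ x, f x) / (q : ℝ) ^ n ≤ - (n * (1 - 1 / q)) := by
    have h1 : ∀ x, f x = (∑ j, if x j = x (s j) then (1 : ℝ) else 0) - n := by
      intro x
      have : (∑ j, if x j = x (s j) then (1 : ℝ) else 0) +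
          (∑ j, if x j ≠ x (s j) then (1 : ℝ) else 0) = n := by
        rw [← Finset.sum_add_distrib, Finset.sum_congr rfl (g := fun _ => (1 : ℝ))]
        · simp
        · intro j _; by_cases h : x j = x (s j) <;> simp [h]
      have h' : (hammingDist x (fun j => x (s j)) : ℝ) =
          ∑ j, if x j ≠ x (s j) then (1 : ℝ) else 0 := by
        unfold hammingDist; rw [Finset.card_filter]; push_cast; rfl
      simp only [hf, h']; linarith
    rw [div_le_iff₀ hqn]
    simp_rw [h1]
    rw [Finset.sum_sub_distrib, Finset.sum_comm]
    have h2 : ∀ j, (∑ x : Fin n → Fin q, if x j = x (s j) then (1 : ℝ) else 0) ≤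
        (q : ℝ) ^ n / q := by
      intro j
      rw [le_div_iff₀ hq', Finset.sum_boole]
      exact_mod_cast count_eq j (s j) (hs' j)
    have h3 := Finset.sum_le_card_nsmul Finset.univ _ _ (fun j _ => h2 j)
    simp only [Finset.card_univ, Fintype.card_fin, nsmul_eq_mul] at h3
    simp only [Finset.sum_const, Finset.card_univ, Fintype.card_fun, Fintype.card_fin,
      nsmul_eq_mul, Nat.cast_pow]
    have : -(n * (1 - 1 / (q : ℝ))) * (q : ℝ) ^ n = n * ((q : ℝ) ^ n / q) - (q : ℝ) ^ n * n := by
      field_simp; ring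
    rw [this]; linarith
  have hm := mcd q hq ε n f hlip
  have hlow : (B.card : ℝ) * Real.exp (ε ^ 2 * n) ≤
      ∑ x, Real.exp (ε * (f x - (∑ y, f y) / (q : ℝ) ^ n)) := by
    rw [← nsmul_eq_mul]
    refine (Finset.card_nsmul_le_sum B _ _ ?_).trans
      (Finset.sum_le_sum_of_subset_of_nonneg (Finset.subset_univ B)
        fun _ _ _ => (Real.exp_pos _).le)
    intro x hx
    apply Real.exp_le_exp.2
    have := hB x hx
    have h4 : ε * n ≤ f x - (∑ y, f y) / (q : ℝ) ^ n := by
      simp only [hf] at hmean ⊢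
      linarith
    calc ε ^ 2 * n = ε * (ε * n) := by ring
      _ ≤ _ := mul_le_mul_of_nonneg_left h4 hε.le
  have h5 := hlow.trans hm
  rw [← le_div_iff₀ (Real.exp_pos _), mul_div_assoc, ← Real.exp_sub] at h5
  refine h5.trans (le_of_eq ?_)
  congr 2; ring

open scoped Classical in
/-- Most vectors x in [q]^n satisfy d(x) > n(1 - 1/q - ε), where
d(x) = min_{1 ≤ i ≤ n-1} d(x, π_i(x)). -/
theorem stmt7 (n q : ℕ) (hn : 2 ≤ n) (hq : 2 ≤ q) (ε : ℝ)
    (hε : ε ∈ Set.Ioo (0 : ℝ) (1 - 1 / q)) :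
    (q : ℝ) ^ n * (1 - ((n : ℝ) - 1) * Real.exp (-(ε ^ 2 * n) / 2)) ≤
      ((Finset.univ.filter fun x : Fin n → Fin q =>
        ∀ i ∈ Finset.Icc 1 (n - 1),
          (n : ℝ) * (1 - 1 / q - ε) < (hammingDist x (cshift i x) : ℝ)).card : ℝ) := by
  set P : (Fin n → Fin q) → Prop := fun x => ∀ i ∈ Finset.Icc 1 (n - 1),
          (n : ℝ) * (1 - 1 / q - ε) < (hammingDist x (cshift i x) : ℝ) with hP
  set B : ℕ → Finset (Fin n → Fin q) := fun i => Finset.univ.filter fun x =>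
    (hammingDist x (cshift i x) : ℝ) ≤ (n : ℝ) * (1 - 1 / q - ε) with hBdef
  have hB : ∀ i ∈ Finset.Icc 1 (n - 1),
      ((B i).card : ℝ) ≤ (q : ℝ) ^ n * Real.exp (-(ε ^ 2 * n) / 2) := by
    intro i hi
    rw [Finset.mem_Icc] at hi
    refine tail_bound (by omega) ε hε.1
      (fun j : Fin n => ⟨(j.1 + i) % n, Nat.mod_lt _ j.pos⟩) ?_ ?_ (B i) ?_
    · intro j k h
      simp only [Fin.mk.injEq] at h
      have h' : j.1 ≡ k.1 [MOD n] := Nat.ModEq.add_right_cancel' i h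
      exact Fin.ext (Nat.ModEq.eq_of_lt_of_lt h' j.2 k.2)
    · intro j h
      have h := congrArg Fin.val h
      simp only at h
      have hj := j.2
      rcases lt_or_ge (j.1 + i) n with h1 | h1
      · rw [Nat.mod_eq_of_lt h1] at h; omega
      · rw [Nat.mod_eq_sub_mod h1, Nat.mod_eq_of_lt (by omega)] at h; omega
    · intro x hx
      exact (Finset.mem_filter.1 hx).2
  have hcover : (Finset.univ : Finset (Fin n → Fin q)) ⊆
      Finset.univ.filter P ∪ (Finset.Icc 1 (n - 1)).biUnion B := by
    intro x _
    by_cases hx : P x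
    · exact Finset.mem_union_left _ (by simp [hx])
    · apply Finset.mem_union_right
      simp only [hP, not_forall, not_lt] at hx
      obtain ⟨i, hi, h⟩ := hx
      exact Finset.mem_biUnion.2 ⟨i, hi, Finset.mem_filter.2 ⟨Finset.mem_univ _, h⟩⟩
  have hc := (Finset.card_le_card hcover).trans
    ((Finset.card_union_le _ _).trans (Nat.add_le_add_left Finset.card_biUnion_le _))
  have hc' : (q : ℝ) ^ n ≤ ((Finset.univ.filter P).card : ℝ) +
      ∑ i ∈ Finset.Icc 1 (n - 1), ((B i).card : ℝ) := by
    have h : (Finset.univ : Finset (Fin n → Fin q)).card = q ^ n := by simp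
    rw [h] at hc
    exact_mod_cast hc
  have hsum := Finset.sum_le_card_nsmul _ _ _ hB
  rw [Nat.card_Icc, nsmul_eq_mul, Nat.add_sub_cancel, Nat.cast_sub (by omega)] at hsum
  push_cast at hsum
  have hfin : (q : ℝ) ^ n * (1 - ((n : ℝ) - 1) * Real.exp (-(ε ^ 2 * n) / 2)) ≤
      ((Finset.univ.filter P).card : ℝ) := by linarith
  convert hfin
end

section
/- Let n ≥ 2 and q ≥ 2 be integers, ε ∈ (0, 1 − 1/q) a real, and fix 1 ≤ i ≤ n−1. If X = (X_1,…,X_n) is chosen uniformly at random from [q]^n, then Pr[ d(X, π_i(X)) ≤ n(1 − 1/q − ε) ] ≤ exp(−ε²n/2). -/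
open Finset

lemma hoeff_fin (q : ℕ) (hq : 0 < q) (L : ℝ) (g : Fin q → ℝ)
    (hg : ∀ a b, |g a - g b| ≤ 2 * L) :
    ∑ a, Real.exp (g a) ≤ q * Real.exp ((∑ a, g a) / q + L ^ 2 / 2) := by
  have hq' : (0 : ℝ) < q := by exact_mod_cast hq
  haveI : Nonempty (Fin q) := ⟨⟨0, hq⟩⟩
  obtain ⟨a0, h0⟩ := Finite.exists_min g
  have hL : 0 ≤ L := by
    have := hg a0 a0
    simp at this
    linarith
  let μ : MeasureTheory.Measure (Fin q) := ProbabilityTheory.uniformOn Set.univ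
  haveI : MeasureTheory.IsProbabilityMeasure μ :=
    ProbabilityTheory.isProbabilityMeasure_uniformOn Set.finite_univ Set.univ_nonempty
  have hμ : ∀ a, μ.real {a} = (q : ℝ)⁻¹ := by
    intro a
    simp [μ, MeasureTheory.Measure.real, ProbabilityTheory.uniformOn_univ]
  have hint : ∀ f : Fin q → ℝ, ∫ x, f x ∂μ = (∑ a, f a) / q := by
    intro f
    rw [MeasureTheory.integral_fintype (MeasureTheory.Integrable.of_finite)]
    simp only [hμ, smul_eq_mul]
    rw [← Finset.mul_sum]
    field_simp
  have key := ProbabilityTheory.hasSubgaussianMGF_of_mem_Icc (μ := μ) (X := g)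
    (a := g a0) (b := g a0 + 2 * L) (measurable_of_finite g).aemeasurable
    (Filter.Eventually.of_forall fun x => ⟨h0 x, by
      have := (abs_le.1 (hg x a0)).2
      linarith⟩)
  have h1 := key.mgf_le 1
  rw [ProbabilityTheory.mgf, hint, hint] at h1
  have e1 : ((((‖g a0 + 2 * L - g a0‖₊ / 2) ^ 2 : NNReal)) : ℝ) * 1 ^ 2 / 2 = L ^ 2 / 2 := by
    push_cast
    rw [Real.norm_eq_abs]
    have : g a0 + 2 * L - g a0 = 2 * L := by ring
    rw [this, abs_of_nonneg (by positivity)]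
    ring
  rw [e1] at h1
  simp only [one_mul, Real.exp_sub] at h1
  rw [← Finset.sum_div, div_div, div_le_iff₀ (by positivity)] at h1
  rw [Real.exp_add]
  linarith

lemma mcdiarmid_fin (q : ℕ) (hq : 0 < q) (L : ℝ) (n : ℕ) :
    ∀ f : (Fin n → Fin q) → ℝ,
    (∀ x k c, |f (Function.update x k c) - f x| ≤ 2 * L) →
    ∑ x, Real.exp (f x) ≤
      (q : ℝ) ^ n * Real.exp ((∑ x, f x) / (q : ℝ) ^ n + n * (L ^ 2 / 2)) := by
  have hq' : (0 : ℝ) < q := by exact_mod_cast hq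
  induction n with
  | zero => intro f _; simp
  | succ n ih =>
    intro f hf
    have split : ∀ F : (Fin (n+1) → Fin q) → ℝ,
        ∑ x, F x = ∑ y : Fin n → Fin q, ∑ a, F (Fin.cons a y) := by
      intro F
      rw [← (Fin.consEquiv (fun _ => Fin q)).sum_comp, Fintype.sum_prod_type,
        Finset.sum_comm]
      rfl
    rw [split, split]
    have hG := ih (fun y => (∑ a, f (Fin.cons a y)) / q + L ^ 2 / 2) (by
      intro x k c
      have e : ((∑ a, f (Fin.cons a (Function.update x k c))) / q + L ^ 2 / 2)
        - ((∑ a, f (Fin.cons a x)) / q + L ^ 2 / 2) =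
        (∑ a, (f (Fin.cons a (Function.update x k c)) - f (Fin.cons a x))) / q := by
        rw [Finset.sum_sub_distrib]; ring
      rw [e, abs_div, abs_of_pos hq', div_le_iff₀ hq']
      refine (Finset.abs_sum_le_sum_abs _ _).trans ?_
      refine (Finset.sum_le_card_nsmul _ _ (2 * L) ?_).trans ?_
      · intro a _
        rw [Fin.cons_update]
        exact hf _ _ _
      · simp; linarith)
    calc _ ≤ ∑ y : Fin n → Fin q, (q : ℝ) *
            Real.exp ((∑ a, f (Fin.cons a y)) / q + L ^ 2 / 2) := by
          refine Finset.sum_le_sum fun y _ => ?_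
          refine hoeff_fin q hq L (fun a => f (Fin.cons a y)) ?_
          intro a b
          have := hf (Fin.cons b y) 0 a
          rwa [Fin.update_cons_zero] at this
      _ ≤ _ := by
          rw [← Finset.mul_sum, pow_succ' (q : ℝ) n, mul_assoc]
          refine mul_le_mul_of_nonneg_left (hG.trans (le_of_eq ?_)) hq'.le
          congr 2
          rw [Finset.sum_add_distrib, ← Finset.sum_div]
          simp
          field_simp
          ring

lemma count_eq_s8 (q n : ℕ) (hq : 0 < q) (a b : Fin n) (hab : a ≠ b) :
    (q : ℝ) * ∑ x : Fin n → Fin q, (if x a = x b then (1 : ℝ) else 0) = (q : ℝ) ^ n := by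
  haveI : NeZero q := ⟨hq.ne'⟩
  have h1 : ∀ c : Fin q, ∑ x : Fin n → Fin q, (if x a = x b then (1 : ℝ) else 0)
      = ∑ x : Fin n → Fin q, (if c = x b - x a then (1 : ℝ) else 0) := by
    intro c
    rw [← Equiv.sum_comp (Equiv.addRight (Pi.single a c : Fin n → Fin q))]
    refine Finset.sum_congr rfl fun x _ => ?_
    have : (x a + c = x b) ↔ (c = x b - x a) := by
      rw [eq_sub_iff_add_eq, add_comm]
    simp [hab.symm, this]
  have h2 : (q : ℝ) * ∑ x : Fin n → Fin q, (if x a = x b then (1 : ℝ) else 0)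
      = ∑ c : Fin q, ∑ x : Fin n → Fin q, (if x a = x b then (1 : ℝ) else 0) := by simp
  rw [h2, Finset.sum_congr rfl (fun c _ => h1 c), Finset.sum_comm]
  simp

/-- For uniform X on [q]^n, Pr[d(X, π_i(X)) ≤ n(1 - 1/q - ε)] ≤ exp(-ε²n/2). -/
theorem stmt8 (n q : ℕ) (hn : 2 ≤ n) (hq : 2 ≤ q) (ε : ℝ)
    (hε : ε ∈ Set.Ioo (0 : ℝ) (1 - 1 / q))
    (i : ℕ) (hi1 : 1 ≤ i) (hi2 : i ≤ n - 1) :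
    ((Finset.univ.filter fun x : Fin n → Fin q =>
        (hammingDist x (cshift i x) : ℝ) ≤ (n : ℝ) * (1 - 1 / q - ε)).card : ℝ) /
      (q : ℝ) ^ n ≤ Real.exp (-(ε ^ 2 * n) / 2) := by
  have hq0 : 0 < q := by omega
  have hq' : (0 : ℝ) < q := by exact_mod_cast hq0
  have hε0 := hε.1
  let σ : Fin n → Fin n := fun j => ⟨(j.1 + i) % n, Nat.mod_lt _ j.pos⟩
  have hσi : Function.Injective σ := by
    intro j k h
    have h' : (j.1 + i) % n = (k.1 + i) % n := congrArg Fin.val h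
    have h2 : j.1 ≡ k.1 [MOD n] := Nat.ModEq.add_right_cancel' i h'
    exact Fin.ext (Nat.ModEq.eq_of_lt_of_lt h2 j.2 k.2)
  have hσn : ∀ j, j ≠ σ j := by
    intro j h
    have h' : j.1 = (j.1 + i) % n := congrArg Fin.val h
    have hj := j.2
    rcases lt_or_ge (j.1 + i) n with h3 | h3
    · rw [Nat.mod_eq_of_lt h3] at h'; omega
    · rw [Nat.mod_eq_sub_mod h3, Nat.mod_eq_of_lt (by omega)] at h'; omega
  let Z : (Fin n → Fin q) → ℝ := fun x => ∑ j, if x j = x (σ j) then (1 : ℝ) else 0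
  have hZ : ∀ x, (hammingDist x (cshift i x) : ℝ) = n - Z x := by
    intro x
    have : (hammingDist x (cshift i x) : ℝ) = ∑ j, if x j = x (σ j) then (0 : ℝ) else 1 := by
      rw [hammingDist, Finset.card_filter]
      push_cast
      refine Finset.sum_congr rfl fun j _ => ?_
      change (if x j ≠ x (σ j) then (1 : ℝ) else 0) = _
      split_ifs <;> simp_all
    rw [this, eq_sub_iff_add_eq, ← Finset.sum_add_distrib]
    rw [Finset.sum_congr rfl (g := fun _ => (1 : ℝ))]
    · simp
    · intro j _
      split_ifs <;> simp
  have hmean : (∑ x, ε * Z x) / (q : ℝ) ^ n = ε * (n / q) := by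
    rw [← Finset.mul_sum]
    have : ∑ x, Z x = n * ((q : ℝ) ^ n / q) := by
      rw [Finset.sum_comm]
      rw [Finset.sum_congr rfl (g := fun _ => (q : ℝ) ^ n / q)]
      · simp
      · intro j _
        rw [eq_div_iff hq'.ne', mul_comm]
        exact count_eq_s8 q n hq0 j (σ j) (hσn j)
    rw [this]
    field_simp
  have hbd : ∀ x k c, |ε * Z (Function.update x k c) - ε * Z x| ≤ 2 * ε := by
    intro x k c
    rw [← mul_sub, abs_mul, abs_of_pos hε0, mul_comm]
    refine mul_le_mul_of_nonneg_right ?_ hε0.le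
    rw [← Finset.sum_sub_distrib]
    refine (Finset.abs_sum_le_sum_abs _ _).trans ?_
    calc _ ≤ ∑ j, ((if j = k then (1 : ℝ) else 0) + (if σ j = k then (1 : ℝ) else 0)) := by
          refine Finset.sum_le_sum fun j _ => ?_
          by_cases h1 : j = k
          · rw [if_pos h1]
            split_ifs <;> norm_num
          · by_cases h2 : σ j = k
            · rw [if_pos h2]
              split_ifs <;> norm_num
            · rw [Function.update_of_ne h1, Function.update_of_ne h2]
              simp [h1, h2]
      _ ≤ 2 := by
          rw [Finset.sum_add_distrib]
          have e1 : ∑ j, (if j = k then (1 : ℝ) else 0) = 1 := by simp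
          have e2 : ∑ j, (if σ j = k then (1 : ℝ) else 0) = 1 := by
            refine Eq.trans ?_ e1
            exact (Equiv.ofBijective σ (Finite.injective_iff_bijective.1 hσi)).sum_comp
              (fun j => if j = k then (1 : ℝ) else 0)
          rw [e1, e2]; norm_num
  have main := mcdiarmid_fin q hq0 ε n (fun x => ε * Z x) hbd
  rw [hmean] at main
  set S := Finset.univ.filter fun x : Fin n → Fin q =>
        (hammingDist x (cshift i x) : ℝ) ≤ (n : ℝ) * (1 - 1 / q - ε) with hS
  have low : (S.card : ℝ) * Real.exp (ε * (n / q) + ε ^ 2 * n) ≤ ∑ x, Real.exp (ε * Z x) := by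
    calc _ = ∑ x ∈ S, Real.exp (ε * (n / q) + ε ^ 2 * n) := by simp
      _ ≤ ∑ x ∈ S, Real.exp (ε * Z x) := by
          refine Finset.sum_le_sum fun x hx => Real.exp_le_exp.2 ?_
          have hx' := (Finset.mem_filter.1 hx).2
          rw [hZ] at hx'
          have h3 : (n : ℝ) / q + ε * n ≤ Z x := by
            have : (n : ℝ) * (1 - 1 / q - ε) = n - (n / q + ε * n) := by ring
            linarith
          nlinarith
      _ ≤ _ := Finset.sum_le_sum_of_subset_of_nonneg (Finset.subset_univ _)
          (fun _ _ _ => (Real.exp_pos _).le)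
  rw [div_le_iff₀ (by positivity)]
  have h4 := low.trans main
  have h5 : Real.exp (ε * (n / q) + n * (ε ^ 2 / 2)) =
      Real.exp (-(ε ^ 2 * n) / 2) * Real.exp (ε * (n / q) + ε ^ 2 * n) := by
    rw [← Real.exp_add]; congr 1; ring
  rw [h5, ← mul_assoc] at h4
  have h6 := le_of_mul_le_mul_right h4 (Real.exp_pos _)
  linarith
end
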